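/- Let n ≥ 2 be an integer, M a finite set of chores, v an additive positive cost function, and d = ⌊9n/11⌋. Suppose MMS^d(v, M) = 1. If the tuple (M, (A_1,…,A_n), v, 1) is First Fit Valid, then A_1 ∪ … ∪ A_n = M, i.e., the allocation contains all chores. -/

import Mathlib

open Finset

variable {α : Type*} [DecidableEq α]

/-- The total cost of a bundle `S` of chores under the additive cost function `v`. -/
def bundleCost (v : α → ℚ) (S : Finset α) : ℚ := ∑ c ∈ S, v c

/-- `P` is a partition of `M` into `d` (possibly empty) bundles. -/
def IsPartitionInto (M : Finset α) (d : ℕ) (P : Fin d → Finset α) : Prop :=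
  (∀ j, P j ⊆ M) ∧ (∀ j k, j ≠ k → Disjoint (P j) (P k)) ∧ ∀ c ∈ M, ∃ j, c ∈ P j

/-- `μ` is the `d`-maximin share `MMS^d(v, M)`: the minimum, over all partitions of `M`
into `d` bundles, of the maximum bundle cost. -/
def IsMMS (v : α → ℚ) (M : Finset α) (d : ℕ) (μ : ℚ) : Prop :=
  (∃ P : Fin d → Finset α, IsPartitionInto M d P ∧ ∀ j, bundleCost v (P j) ≤ μ) ∧
    ∀ P : Fin d → Finset α, IsPartitionInto M d P → ∃ j, μ ≤ bundleCost v (P j)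

/-- `costSeq v B p` is the cost of the `p`-th most costly chore of `B` (0-indexed),
or `0` when `p ≥ |B|`. -/
def costSeq (v : α → ℚ) (B : Finset α) (p : ℕ) : ℚ :=
  ((B.val.map v).sort (· ≤ ·)).reverse.getD p 0

/-- `B₁ =_lex B₂`. -/
def LexEq (v : α → ℚ) (B₁ B₂ : Finset α) : Prop :=
  ∀ p, costSeq v B₁ p = costSeq v B₂ p

/-- `B₁ ≤_lex B₂`. -/
def LexLe (v : α → ℚ) (B₁ B₂ : Finset α) : Prop :=
  LexEq v B₁ B₂ ∨ ∃ q, (∀ p < q, costSeq v B₁ p = costSeq v B₂ p) ∧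
    costSeq v B₁ q < costSeq v B₂ q

/-- `B₁ ≥_lex B₂`. -/
def LexGe (v : α → ℚ) (B₁ B₂ : Finset α) : Prop := LexLe v B₂ B₁

/-- The chores of `M` remaining after the first `k` bundles of `A` have been allocated. -/
def remainingChores (M : Finset α) {n : ℕ} (A : Fin n → Finset α) (k : Fin n) : Finset α :=
  M \ (Finset.univ.filter fun j => j < k).biUnion A

/-- `B` is a `k`-th benchmark bundle of `A` w.r.t. `M`, `v`, `τ`: a lexicographically
maximal subset of the remaining chores with cost at most `τ`. -/
def IsBenchmark (M : Finset α) {n : ℕ} (A : Fin n → Finset α) (v : α → ℚ) (τ : ℚ)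
    (k : Fin n) (B : Finset α) : Prop :=
  B ⊆ remainingChores M A k ∧ bundleCost v B ≤ τ ∧
    ∀ B' ⊆ remainingChores M A k, bundleCost v B' ≤ τ → LexGe v B B'

/-- The tuple `(M, A, v, τ)` is First Fit Valid. -/
def FirstFitValid (M : Finset α) {n : ℕ} (A : Fin n → Finset α) (v : α → ℚ) (τ : ℚ) : Prop :=
  (∀ k, A k ⊆ M) ∧ (∀ j k, j ≠ k → Disjoint (A j) (A k)) ∧
    ∀ k B, IsBenchmark M A v τ k B → LexGe v (A k) B

set_option linter.unusedSectionVars false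
set_option linter.unusedVariables false
set_option linter.unreachableTactic false
set_option linter.unusedTactic false

/-- greedy list -/
def Gr (v : α → ℚ) (x : ℚ) (rem : α → Prop) : ℚ → List α → Prop
  | s, [] => 1 < s + x
  | s, a :: l => s + x ≤ 1 ∧ (∀ b ∈ l, v b ≤ v a) ∧ (∀ y, rem y → s + v y ≤ 1 → v y ≤ v a) ∧
      Gr v x rem (s + v a) l

/-- packing structure -/
structure Pk (v : α → ℚ) (x : α) (M : Finset α) (K : Finset ℕ) (L : ℕ → List α)
    (D : Finset ℕ) (P : α → ℕ) : Prop where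
  xM : x ∈ M
  xpos : 0 < v x
  ge : ∀ c ∈ M, v x ≤ v c
  cover : ∀ c ∈ M, c = x ∨ ∃ k ∈ K, c ∈ L k
  sub : ∀ k ∈ K, ∀ c ∈ L k, c ∈ M ∧ c ≠ x
  nodup : ∀ k ∈ K, (L k).Nodup
  disj : ∀ i ∈ K, ∀ j ∈ K, ∀ c, c ∈ L i → c ∈ L j → i = j
  gr : ∀ k ∈ K, Gr v (v x) (fun y => y ∈ M ∧ ∀ i ∈ K, i ≤ k → y ∉ L i) 0 (L k)
  PD : ∀ c ∈ M, P c ∈ D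
  cap : ∀ j ∈ D, ∑ c ∈ M with P c = j, v c ≤ 1


lemma costSeq_list (v : α → ℚ) (l : List α) (hn : l.Nodup)
    (hs : l.Pairwise fun a b => v b ≤ v a) (p : ℕ) :
    costSeq v l.toFinset p = (l.map v).getD p 0 := by
  unfold costSeq
  congr 1
  have h1 : (l.toFinset.val.map v) = ((l.map v : List ℚ) : Multiset ℚ) := by
    rw [List.toFinset_val, hn.dedup]; rfl
  rw [h1]
  have h2 : ((Multiset.sort (l.map v : Multiset ℚ) (· ≤ ·))).Perm (l.map v) := by
    rw [← Multiset.coe_eq_coe, Multiset.sort_eq]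
  have h3 := (List.reverse_perm _).trans h2
  refine List.Perm.eq_of_pairwise (le := fun a b => b ≤ a) (fun a b _ _ h h' => le_antisymm h' h) ?_ ?_ h3
  · rw [List.pairwise_reverse]; exact Multiset.pairwise_sort _ _
  · rw [List.pairwise_map]; exact hs

lemma exists_list (v : α → ℚ) (S : Finset α) : ∃ l : List α, l.Nodup ∧
    (l.Pairwise fun a b => v b ≤ v a) ∧ l.toFinset = S := by
  have hp : (S.toList.mergeSort (fun a b => decide (v b ≤ v a))).Perm S.toList := List.mergeSort_perm _ _
  refine ⟨S.toList.mergeSort (fun a b => decide (v b ≤ v a)), ?_, ?_, ?_⟩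
  · exact hp.nodup_iff.2 S.nodup_toList
  · have := List.pairwise_mergeSort (le := fun a b => decide (v b ≤ v a))
      (by intro a b c; simp only [decide_eq_true_eq]; intro h h'; exact h'.trans h)
      (by intro a b; simp only [Bool.or_eq_true, decide_eq_true_eq]; exact le_total _ _) S.toList
    simpa using this
  · ext a; simp

lemma costSeq_zero (v : α → ℚ) (S : Finset α) (p : ℕ) (hp : S.card ≤ p) : costSeq v S p = 0 := by
  obtain ⟨l, h1, h2, rfl⟩ := exists_list v S
  rw [costSeq_list v l h1 h2]
  rw [List.toFinset_card_of_nodup h1] at hp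
  rw [List.getD_eq_default]; simpa using hp

lemma lexLe_trans (v : α → ℚ) {A B C : Finset α} (h : LexLe v A B) (h' : LexLe v B C) : LexLe v A C := by
  rcases h with h | ⟨q, h1, h2⟩
  · rcases h' with h' | ⟨q', h1', h2'⟩
    · left; intro p; rw [h p, h' p]
    · right; exact ⟨q', fun p hp => by rw [h p, h1' p hp], by rw [h q']; exact h2'⟩
  · rcases h' with h' | ⟨q', h1', h2'⟩
    · right; exact ⟨q, fun p hp => by rw [h1 p hp, h' p], by rw [← h' q]; exact h2⟩
    · right
      rcases lt_trichotomy q q' with hq | hq | hq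
      · exact ⟨q, fun p hp => by rw [h1 p hp, h1' p (hp.trans hq)], by rw [← h1' q hq]; exact h2⟩
      · subst hq
        exact ⟨q, fun p hp => by rw [h1 p hp, h1' p hp], h2.trans h2'⟩
      · exact ⟨q', fun p hp => by rw [h1 p (hp.trans hq), h1' p hp], by rw [h1 q' hq]; exact h2'⟩

lemma bench_exists (v : α → ℚ) (R : Finset α) : ∃ B ⊆ R, bundleCost v B ≤ 1 ∧
    ∀ B' ⊆ R, bundleCost v B' ≤ 1 → LexLe v B' B := by
  obtain ⟨B, hB, hmax⟩ := Finset.exists_max_image (R.powerset.filter fun S => bundleCost v S ≤ 1)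
    (fun S => (toLex fun i : Fin R.card => costSeq v S i))
    ⟨∅, Finset.mem_filter.2 ⟨by simp, by simp [bundleCost]⟩⟩
  simp only [mem_filter, mem_powerset] at hB hmax
  refine ⟨B, hB.1, hB.2, fun B' h1 h2 => ?_⟩
  have := hmax B' ⟨h1, h2⟩
  rcases this.lt_or_eq with h | h
  · right
    have h : ∃ i : Fin R.card, (∀ j < i, costSeq v B' j = costSeq v B j) ∧ costSeq v B' i < costSeq v B i := h
    obtain ⟨i, hi, hi'⟩ := h
    exact ⟨i, fun p hp => hi ⟨p, hp.trans i.2⟩ hp, hi'⟩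
  · left
    intro p
    by_cases hp : p < R.card
    · exact congrFun (toLex.injective h) ⟨p, hp⟩
    · rw [costSeq_zero, costSeq_zero]
      · exact (card_le_card hB.1).trans (not_lt.1 hp)
      · exact (card_le_card h1).trans (not_lt.1 hp)

lemma ffv_max {M : Finset α} {n : ℕ} {A : Fin n → Finset α} {v : α → ℚ}
    (h : FirstFitValid M A v 1) (k : Fin n) (S : Finset α) (hS : S ⊆ remainingChores M A k)
    (hc : bundleCost v S ≤ 1) : LexLe v S (A k) := by
  obtain ⟨B, h1, h2, h3⟩ := bench_exists v (remainingChores M A k)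
  exact lexLe_trans v (h3 S hS hc) (h.2.2 k B ⟨h1, h2, h3⟩)

lemma lex_core (v : α → ℚ) (pre rest : List α) (y : α) (hn : (pre ++ rest).Nodup)
    (hs : (pre ++ rest).Pairwise fun a b => v b ≤ v a) (hy : y ∉ pre) (hpos : 0 < v y)
    (hle : ∀ a ∈ pre, v y ≤ v a)
    (h : LexLe v (pre ++ [y]).toFinset (pre ++ rest).toFinset) :
    ∃ a l, rest = a :: l ∧ v y ≤ v a := by
  have e1 : ∀ p, costSeq v (pre ++ [y]).toFinset p = ((pre ++ [y]).map v).getD p 0 := by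
    apply costSeq_list
    · rw [List.nodup_append] at hn ⊢
      exact ⟨hn.1, by simp, by intro a ha b hb; simp at hb; subst hb; rintro rfl; exact hy ha⟩
    · rw [List.pairwise_append] at hs ⊢
      exact ⟨hs.1, by simp, by intro a ha b hb; simp at hb; subst hb; exact hle a ha⟩
  have e2 := costSeq_list v _ hn hs
  have e1' : ∀ p < pre.length, costSeq v (pre ++ [y]).toFinset p = costSeq v (pre ++ rest).toFinset p := by
    intro p hp
    rw [e1, e2, List.map_append, List.map_append, List.getD_append _ _ _ _ (by simpa using hp),
      List.getD_append _ _ _ _ (by simpa using hp)]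
  have e3 : costSeq v (pre ++ [y]).toFinset pre.length = v y := by
    rw [e1]; simp
  have e4 : costSeq v (pre ++ rest).toFinset pre.length = (rest.map v).getD 0 0 := by
    rw [e2, List.map_append, List.getD_append_right _ _ _ _ (by simp)]; simp
  have key : v y ≤ (rest.map v).getD 0 0 := by
    rw [← e3, ← e4]
    rcases h with h | ⟨q, h1, h2⟩
    · exact (h _).le
    · rcases lt_trichotomy q pre.length with hq | hq | hq
      · exact absurd (e1' q hq) h2.ne
      · subst hq; exact h2.le
      · exact (h1 _ hq).le
  cases rest with
  | nil => simp at key; linarith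
  | cons a l => exact ⟨a, l, rfl, by simpa using key⟩

/-- truncation -/
def trn (v : α → ℚ) (x : ℚ) : ℚ → List α → List α
  | _, [] => []
  | s, a :: l => if s + x ≤ 1 then a :: trn v x (s + v a) l else []

lemma trn_sublist (v : α → ℚ) (x : ℚ) (l : List α) : ∀ s, (trn v x s l).Sublist l := by
  induction l with
  | nil => intro s; simp [trn]
  | cons a l ih =>
    intro s; simp only [trn]; split_ifs
    · exact (ih _).cons_cons a
    · simp

lemma gr_trn (v : α → ℚ) (x : α) (rem : α → Prop) (l0 : List α) (hn : l0.Nodup)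
    (hs : l0.Pairwise fun a b => v b ≤ v a) (hx : rem x) (hpos : ∀ y, rem y → 0 < v y)
    (hl0 : ∀ y, rem y → y ∉ l0)  (hp0 : ∀ y ∈ l0, 0 < v y)
    (hlex : ∀ (pre : List α) y, (pre <+: l0) → rem y → (pre.map v).sum + v y ≤ 1 →
      LexLe v (pre ++ [y]).toFinset l0.toFinset) :
    ∀ (l pre : List α), pre ++ l = l0 →
      (∀ y, rem y → (pre.map v).sum + v y ≤ 1 → ∀ a ∈ pre, v y ≤ v a) →
      Gr v (v x) rem (pre.map v).sum (trn v (v x) (pre.map v).sum l) ∧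
      ∀ c ∈ trn v (v x) (pre.map v).sum l, v x ≤ v c := by
  have core : ∀ (l pre : List α), pre ++ l = l0 →
      (∀ y, rem y → (pre.map v).sum + v y ≤ 1 → ∀ a ∈ pre, v y ≤ v a) →
      ∀ y, rem y → (pre.map v).sum + v y ≤ 1 → ∃ a l', l = a :: l' ∧ v y ≤ v a := by
    intro l pre h inv y hy hle
    have h1 : pre <+: l0 := ⟨l, h⟩
    have := hlex pre y h1 hy hle
    subst h
    exact lex_core v pre l y hn hs (fun h => hl0 y hy (by simp [h])) (hpos y hy) (inv y hy hle) this
  intro l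
  induction l with
  | nil =>
    intro pre h inv
    simp only [trn, Gr]
    refine ⟨?_, by simp⟩
    by_contra hc
    obtain ⟨a, l', h', _⟩ := core [] pre h inv x hx (not_lt.1 hc)
    simp at h'
  | cons a l ih =>
    intro pre h inv
    simp only [trn]
    split_ifs with hc
    · have hC := core (a :: l) pre h inv
      have hC' : ∀ y, rem y → (pre.map v).sum + v y ≤ 1 → v y ≤ v a := by
        intro y hy hy'
        obtain ⟨a', l', h1, h2⟩ := hC y hy hy'
        simp only [List.cons.injEq] at h1
        rw [h1.1]; exact h2
      have ha : 0 < v a := hp0 a (by rw [← h]; simp)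
      have e : ((pre ++ [a]).map v).sum = (pre.map v).sum + v a := by simp
      have := ih (pre ++ [a]) (by simpa using h) (by
        rw [e]; intro y hy hy' b hb
        have hy'' : (pre.map v).sum + v y ≤ 1 := by linarith
        rw [List.mem_append] at hb
        rcases hb with hb | hb
        · exact inv y hy hy'' b hb
        · simp at hb; rw [hb]; exact hC' y hy hy'')
      rw [e] at this
      refine ⟨⟨hc, ?_, hC', this.1⟩, ?_⟩
      · intro b hb
        have hb' := (trn_sublist v (v x) l _).subset hb
        rw [← h, List.pairwise_append] at hs
        have := hs.2.1
        rw [List.pairwise_cons] at this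
        exact this.1 b hb'
      · intro c hc'
        rcases List.mem_cons.1 hc' with rfl | hc'
        · exact hC' x hx hc
        · exact this.2 c hc'
    · exact ⟨by simpa [Gr] using hc, by simp⟩

lemma Gr_congr (v : α → ℚ) (x : ℚ) (r r' : α → Prop) (h : ∀ y, r' y → r y) :
    ∀ l s, Gr v x r s l → Gr v x r' s l := by
  intro l
  induction l with
  | nil => intro s h; exact h
  | cons a l ih => intro s hh; exact ⟨hh.1, hh.2.1, fun y hy => hh.2.2.1 y (h y hy), ih _ hh.2.2.2⟩

lemma pk_of_ffv (n : ℕ) (M : Finset α) (v : α → ℚ) (hv : ∀ c ∈ M, 0 < v c) (d : ℕ)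
    (P : Fin d → Finset α) (hP : IsPartitionInto M d P) (hPc : ∀ j, bundleCost v (P j) ≤ 1)
    (A : Fin n → Finset α) (hffv : FirstFitValid M A v 1) (x : α) (hxM : x ∈ M)
    (hxA : ∀ k, x ∉ A k) :
    ∃ M' K L D P', Pk v x M' K L D P' ∧ K.card = n ∧ D.card = d := by
  choose l hln hls hlA using fun k => exists_list v (A k)
  set L : ℕ → List α := fun k => if h : k < n then trn v (v x) 0 (l ⟨k, h⟩) else [] with hL
  have hLk : ∀ k : Fin n, L k = trn v (v x) 0 (l k) := by intro k; simp [hL, k.2]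
  have hLsub : ∀ k : Fin n, ∀ c ∈ L k, c ∈ A k := by
    intro k c hc
    rw [hLk] at hc
    rw [← hlA k, List.mem_toFinset]
    exact (trn_sublist _ _ _ _).subset hc
  set M' : Finset α := insert x (univ.biUnion fun k : Fin n => (L k).toFinset) with hM'
  have hM'M : M' ⊆ M := by
    intro c hc
    simp only [hM', mem_insert, mem_biUnion, mem_univ, true_and, List.mem_toFinset] at hc
    rcases hc with rfl | ⟨k, hk⟩
    · exact hxM
    · exact hffv.1 k (hLsub k c hk)
  have hgr : ∀ k : Fin n, Gr v (v x) (fun y => y ∈ M ∧ (∀ i ≤ k, y ∉ A i)) 0 (L k) ∧ ∀ c ∈ L k, v x ≤ v c := by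
    intro k
    rw [hLk]
    have := gr_trn v x (fun y => y ∈ M ∧ (∀ i ≤ k, y ∉ A i)) (l k) (hln k) (hls k) ⟨hxM, fun i _ => hxA i⟩
      (fun y hy => hv y hy.1) (fun y hy => by
        have := hy.2 k le_rfl; rw [← hlA k, List.mem_toFinset] at this; exact this)
      (fun y hy => by
        rw [← List.mem_toFinset, hlA k] at hy; exact hv y (hffv.1 k hy))
      (by
        intro pre y hpre hy hle
        rw [hlA k]
        have hsub : ∀ c ∈ pre, c ∈ A k := by
          intro c hc; rw [← hlA k, List.mem_toFinset]; exact hpre.sublist.subset hc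
        apply ffv_max hffv
        · intro c hc
          simp only [List.mem_toFinset, List.mem_append, List.mem_singleton] at hc
          simp only [remainingChores, mem_sdiff, mem_biUnion, mem_filter, mem_univ, true_and, not_exists, not_and]
          rcases hc with hc | rfl
          · refine ⟨hffv.1 k (hsub c hc), fun i hi hci => ?_⟩
            exact Finset.disjoint_left.1 (hffv.2.1 i k hi.ne) hci (hsub c hc)
          · exact ⟨hy.1, fun i hi => hy.2 i hi.le⟩
        · have hnd : (pre ++ [y]).Nodup := by
            rw [List.nodup_append]
            refine ⟨(hln k).sublist hpre.sublist, by simp, ?_⟩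
            intro a ha b hb; simp at hb; subst hb; rintro rfl; exact hy.2 k le_rfl (hsub _ ha)
          rw [bundleCost, List.sum_toFinset _ hnd]
          simpa using hle)
      (l k) [] (by simp) (by simp)
    simpa using this
  have hPc' : ∀ c ∈ M, ∃ j : Fin d, c ∈ P j := hP.2.2
  set P' : α → ℕ := fun c => if h : ∃ j : Fin d, c ∈ P j then (h.choose : ℕ) else 0 with hP'
  have hP's : ∀ c ∈ M, ∃ j : Fin d, c ∈ P j ∧ P' c = j := by
    intro c hc
    refine ⟨(hPc' c hc).choose, (hPc' c hc).choose_spec, ?_⟩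
    simp only [hP']; rw [dif_pos (hPc' c hc)]
  have hdj : ∀ i j : Fin n, ∀ c, c ∈ A i → c ∈ A j → i = j := by
    intro i j c hi hj
    by_contra hne
    exact Finset.disjoint_left.1 (hffv.2.1 i j hne) hi hj
  refine ⟨M', range n, L, range d, P', ⟨?_, hv x hxM, ?_, ?_, ?_, ?_, ?_, ?_, ?_, ?_⟩, by simp, by simp⟩
  · simp [hM']
  · intro c hc
    simp only [hM', mem_insert, mem_biUnion, mem_univ, true_and, List.mem_toFinset] at hc
    rcases hc with rfl | ⟨k, hk⟩
    · exact le_rfl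
    · exact (hgr k).2 c hk
  · intro c hc
    simp only [hM', mem_insert, mem_biUnion, mem_univ, true_and, List.mem_toFinset] at hc
    rcases hc with rfl | ⟨k, hk⟩
    · left; rfl
    · right; exact ⟨k, by simp, hk⟩
  · intro k hk c hc
    have hk := mem_range.1 hk
    refine ⟨?_, ?_⟩
    · simp only [hM', mem_insert, mem_biUnion, mem_univ, true_and, List.mem_toFinset]
      right; exact ⟨⟨k, hk⟩, hc⟩
    · rintro rfl; exact hxA ⟨k, hk⟩ (hLsub ⟨k, hk⟩ _ hc)
  · intro k hk
    have hk := mem_range.1 hk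
    rw [hLk ⟨k, hk⟩]
    exact (hln _).sublist (trn_sublist _ _ _ _)
  · intro i hi j hj c hci hcj
    have hi := mem_range.1 hi
    have hj := mem_range.1 hj
    have := hdj _ _ c (hLsub ⟨i, hi⟩ c hci) (hLsub ⟨j, hj⟩ c hcj)
    simpa using this
  · intro k hk
    have hk := mem_range.1 hk
    refine Gr_congr _ _ _ _ ?_ _ _ (hgr ⟨k, hk⟩).1
    rintro y ⟨hy, hy'⟩
    refine ⟨hM'M hy, fun i hi hyi => ?_⟩
    simp only [hM', mem_insert, mem_biUnion, mem_univ, true_and, List.mem_toFinset] at hy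
    rcases hy with rfl | ⟨j, hj⟩
    · exact hxA _ hyi
    · have := hdj _ _ y hyi (hLsub j y hj)
      subst this
      exact hy' i (by simp) hi hj
  · intro c hc
    obtain ⟨j, _, h⟩ := hP's c (hM'M hc)
    rw [h]; simp
  · intro j hj
    have hj := mem_range.1 hj
    refine le_trans (Finset.sum_le_sum_of_subset_of_nonneg (t := P ⟨j, hj⟩) ?_ ?_) (hPc ⟨j, hj⟩)
    · intro c hc
      simp only [mem_filter] at hc
      obtain ⟨j', h1, h2⟩ := hP's c (hM'M hc.1)
      have : j' = ⟨j, hj⟩ := by ext; simp [← h2, hc.2]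
      rw [← this]; exact h1
    · intro c hc _
      exact (hv c (hP.1 _ hc)).le


namespace Pk
variable {v : α → ℚ} {x : α} {M : Finset α} {K : Finset ℕ} {L : ℕ → List α} {D : Finset ℕ} {P : α → ℕ}

lemma pos (h : Pk v x M K L D P) {c : α} (hc : c ∈ M) : 0 < v c := h.xpos.trans_le (h.ge c hc)

lemma bin_le (h : Pk v x M K L D P) {c : α} (hc : c ∈ M) (S : Finset α) (hS : ∀ y ∈ S, y ∈ M ∧ P y = P c) :
    ∑ y ∈ S, v y ≤ 1 := by
  refine le_trans (Finset.sum_le_sum_of_subset_of_nonneg ?_ ?_) (h.cap (P c) (h.PD c hc))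
  · intro y hy; simpa using hS y hy
  · intro y hy _; exact (h.pos (mem_filter.1 hy).1).le

lemma le_one (h : Pk v x M K L D P) {c : α} (hc : c ∈ M) : v c ≤ 1 := by
  have := h.bin_le hc {c} (by simp [hc])
  simpa using this

/-- remaining -/
def rem (_ : Pk v x M K L D P) (k : ℕ) (y : α) : Prop := y ∈ M ∧ ∀ i ∈ K, i ≤ k → y ∉ L i

lemma ne (h : Pk v x M K L D P) {k : ℕ} (hk : k ∈ K) : ∃ a l, L k = a :: l := by
  have := h.gr k hk
  cases hL : L k with
  | nil =>
    rw [hL] at this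
    have h1 := h.le_one h.xM
    simp only [Gr] at this; linarith
  | cons a l => exact ⟨a, l, rfl⟩

lemma rem_of (h : Pk v x M K L D P) {k : ℕ} {c : α} (hc : c ∈ M)
    (hh : ∀ i ∈ K, c ∈ L i → k < i) : h.rem k c :=
  ⟨hc, fun i hi hik hci => absurd (hh i hi hci) (not_lt.2 hik)⟩

lemma rem_x (h : Pk v x M K L D P) (k : ℕ) : h.rem k x :=
  ⟨h.xM, fun i hi _ hx => (h.sub i hi x hx).2 rfl⟩

lemma rem_later (h : Pk v x M K L D P) {i k : ℕ} {c : α} (hi : i ∈ K) (hc : c ∈ L i) (hk : k < i) : h.rem k c :=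
  h.rem_of (h.sub i hi c hc).1 (fun j hj hcj => by rw [h.disj j hj i hi c hcj hc]; exact hk)

lemma top (h : Pk v x M K L D P) {k : ℕ} (hk : k ∈ K) {a : α} {l : List α} (hL : L k = a :: l) {y : α}
    (hy : h.rem k y) : v y ≤ v a := by
  have := h.gr k hk
  rw [hL] at this
  exact this.2.2.1 y hy (by simpa using h.le_one hy.1)

lemma exch (h : Pk v x M K L D P) {k : ℕ} (hk : k ∈ K) {j : ℕ} (g : α → α)
    (hg : ∀ c ∈ M, P c = j → c ∉ L k → g c ∈ L k ∧ P (g c) ≠ j ∧ v c ≤ v (g c))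
    (hinj : ∀ c ∈ M, P c = j → c ∉ L k → ∀ c' ∈ M, P c' = j → c' ∉ L k → g c = g c' → c = c') :
    Pk v x (M \ (L k).toFinset) (K.erase k) L (D.erase j) (fun c => if P c = j then P (g c) else P c) := by
  have hmem : ∀ c, c ∈ M \ (L k).toFinset ↔ c ∈ M ∧ c ∉ L k := by intro c; simp
  refine ⟨?_, h.xpos, ?_, ?_, ?_, ?_, ?_, ?_, ?_, ?_⟩
  · rw [hmem]; exact ⟨h.xM, fun hx => (h.sub k hk x hx).2 rfl⟩
  · intro c hc; exact h.ge c ((hmem c).1 hc).1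
  · intro c hc
    obtain ⟨h1, h2⟩ := (hmem c).1 hc
    rcases h.cover c h1 with h3 | ⟨i, hi, hci⟩
    · left; exact h3
    · right; exact ⟨i, mem_erase.2 ⟨by rintro rfl; exact h2 hci, hi⟩, hci⟩
  · intro i hi c hc
    obtain ⟨h1, h2⟩ := mem_erase.1 hi
    refine ⟨(hmem c).2 ⟨(h.sub i h2 c hc).1, fun hck => h1 (h.disj _ h2 _ hk c hc hck)⟩, (h.sub i h2 c hc).2⟩
  · intro i hi; exact h.nodup i (mem_erase.1 hi).2
  · intro i hi i' hi'; exact h.disj i (mem_erase.1 hi).2 i' (mem_erase.1 hi').2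
  · intro i hi
    have aux : ∀ l s, Gr v (v x) (fun y => y∈M ∧ ∀ i' ∈ K, i' ≤ i → y ∉ L i') s l →
      Gr v (v x) (fun y => y∈(M \ (L k).toFinset) ∧ ∀ i' ∈ (K.erase k), i' ≤ i → y ∉ L i') s l := by
      intro l
      induction l with
      | nil => intro s hh; exact hh
      | cons a l ih =>
        intro s hh
        refine ⟨hh.1, hh.2.1, fun y hy => hh.2.2.1 y ?_, ih _ hh.2.2.2⟩
        obtain ⟨h1, h2⟩ := hy
        rw [hmem] at h1
        refine ⟨h1.1, fun i' hi' hle => ?_⟩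
        by_cases e : i' = k
        · rw [e]; exact h1.2
        · exact h2 i' (mem_erase.2 ⟨e, hi'⟩) hle
    exact aux _ _ (h.gr i (mem_erase.1 hi).2)
  · intro c hc
    obtain ⟨h1, h2⟩ := (hmem c).1 hc
    by_cases e : P c = j
    · simp only [e, if_true]
      obtain ⟨h3, h4, h5⟩ := hg c h1 e h2
      exact mem_erase.2 ⟨h4, h.PD _ (h.sub k hk _ h3).1⟩
    · simp only [e, if_false]
      exact mem_erase.2 ⟨e, h.PD _ h1⟩
  · intro j' hj'
    obtain ⟨hne, hj'⟩ := mem_erase.1 hj'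
    refine le_trans ?_ (h.cap j' hj')
    set S := (M \ (L k).toFinset).filter fun c => (if P c = j then P (g c) else P c) = j' with hS
    have hSm : ∀ c ∈ S, c ∈ M ∧ c ∉ L k ∧ (if P c = j then P (g c) else P c) = j' := by
      intro c hc
      rw [hS, mem_filter, hmem] at hc
      exact ⟨hc.1.1, hc.1.2, hc.2⟩
    calc ∑ c ∈ S, v c ≤ ∑ c ∈ S, v (if P c = j then g c else c) := by
          refine Finset.sum_le_sum fun c hc => ?_
          obtain ⟨h1, h2, h3⟩ := hSm c hc
          split_ifs with e
          · exact (hg c h1 e h2).2.2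
          · exact le_rfl
      _ = ∑ c ∈ S.image (fun c => if P c = j then g c else c), v c := by
          rw [Finset.sum_image]
          intro c hc c' hc' he
          obtain ⟨h1, h2, h3⟩ := hSm c hc
          obtain ⟨h1', h2', h3'⟩ := hSm c' hc'
          dsimp only at he
          split_ifs at he with e e'
          · exact hinj c h1 e h2 c' h1' e' h2' he
          · exact absurd (hg c h1 e h2).1 (by rw [he]; exact h2')
          · rename_i e'; exact absurd (hg c' h1' e' h2').1 (by rw [← he]; exact h2)
          · exact he
      _ ≤ _ := by
          refine Finset.sum_le_sum_of_subset_of_nonneg ?_ ?_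
          · intro y hy
            obtain ⟨c, hc, rfl⟩ := mem_image.1 hy
            obtain ⟨h1, h2, h3⟩ := hSm c hc
            rw [mem_filter]
            split_ifs at h3 ⊢ with e
            · exact ⟨(h.sub k hk _ (hg c h1 e h2).1).1, h3⟩
            · exact ⟨h1, h3⟩
          · intro y hy _; exact (h.pos (mem_filter.1 hy).1).le

lemma red1 (h : Pk v x M K L D P) (hK : K.Nonempty) {a : α} (ha : a ∈ M)
    (h1 : ∀ c ∈ M, P c = P a → c = a) : ∃ k ∈ K, ∃ P', Pk v x (M \ (L k).toFinset) (K.erase k) L (D.erase (P a)) P' := by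
  set k := K.min' hK
  have hk : k ∈ K := K.min'_mem hK
  obtain ⟨t, l, hL⟩ := h.ne hk
  refine ⟨k, hk, _, h.exch hk (fun _ => t) ?_ ?_⟩
  · intro c hc hPc hck
    have := h1 c hc hPc
    subst this
    refine ⟨by simp [hL], ?_, ?_⟩
    · intro e
      have := h1 t (h.sub k hk t (by simp [hL])).1 e
      subst this; simp [hL] at hck
    · apply h.top hk hL
      apply h.rem_of hc
      intro i hi hci
      refine lt_of_le_of_ne (K.min'_le i hi) ?_
      intro e; rw [← e] at hci; exact hck hci
  · intro c hc hPc _ c' hc' hPc' _ _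
    rw [h1 c hc hPc, h1 c' hc' hPc']

lemma red2 (h : Pk v x M K L D P) {a b : α} (ha : a ∈ M) (hb : b ∈ M) (hab : a ≠ b)
    (hP : P b = P a) (hle : v b ≤ v a)
    (h2 : ∀ c ∈ M, P c = P a → c = a ∨ c = b) :
    ∃ k ∈ K, ∃ P', Pk v x (M \ (L k).toFinset) (K.erase k) L (D.erase (P a)) P' := by
  have hsum : v a + v b ≤ 1 := by
    have := h.bin_le ha {a, b} (by intro y hy; simp at hy; rcases hy with rfl | rfl <;> simp [*])
    rwa [Finset.sum_pair hab] at this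
  by_cases hi : ∃ i ∈ K, ∃ t l, L i = t :: l ∧ 1 - v b < v t ∧ (a ∈ l ∨ b ∈ l)
  · obtain ⟨i, hi, t, l, hL, ht, hab'⟩ := hi
    have hta : t ≠ a := by rintro rfl; linarith
    have htb : t ≠ b := by rintro rfl; linarith
    refine ⟨i, hi, _, h.exch hi (fun _ => t) ?_ ?_⟩
    · intro c hc hPc hck
      refine ⟨by simp [hL], ?_, ?_⟩
      · intro e
        rcases h2 t (h.sub i hi t (by simp [hL])).1 e with e | e
        · exact hta e
        · exact htb e
      · rcases h2 c hc hPc with rfl | rfl <;> linarith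
    · intro c hc hPc hck c' hc' hPc' hck' _
      rw [hL] at hck hck'
      rcases h2 c hc hPc with rfl | rfl <;> rcases h2 c' hc' hPc' with rfl | rfl <;> simp at * <;> tauto
  · push Not at hi
    have hex : ∃ k ∈ K, ∀ t l, L k = t :: l → v t ≤ 1 - v b := by
      have aux : ∀ c, c ∈ M → c ≠ x → (c = a ∨ c = b) → ∃ k ∈ K, ∀ t l, L k = t :: l → v t ≤ 1 - v b := by
        intro c hc hcx hcab
        obtain ⟨k, hk, hck⟩ := (h.cover c hc).resolve_left hcx
        refine ⟨k, hk, fun t l hL => ?_⟩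
        by_contra hlt
        have h3 := hi k hk t l hL (not_le.1 hlt)
        rw [hL] at hck
        rcases List.mem_cons.1 hck with e | e
        · rw [← e] at hlt
          rcases hcab with rfl | rfl <;> exact hlt (by linarith)
        · rcases hcab with rfl | rfl
          · exact h3.1 e
          · exact h3.2 e
      by_cases hax : a = x
      · exact aux b hb (by rintro rfl; exact hab hax) (Or.inr rfl)
      · exact aux a ha hax (Or.inl rfl)
    classical
    have hne : (K.filter fun k => ∀ t l, L k = t :: l → v t ≤ 1 - v b).Nonempty := by
      obtain ⟨k, hk, hk'⟩ := hex; exact ⟨k, mem_filter.2 ⟨hk, hk'⟩⟩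
    obtain ⟨hk, hkt⟩ := mem_filter.1 (Finset.min'_mem _ hne)
    set k := (K.filter fun k => ∀ t l, L k = t :: l → v t ≤ 1 - v b).min' hne with hkdef
    have hmin : ∀ i ∈ K, i < k → ∀ c, c = a ∨ c = b → c ∉ L i := by
      intro i hiK hik c hcab hci
      have : i ∉ (K.filter fun k => ∀ t l, L k = t :: l → v t ≤ 1 - v b) := by
        intro hmem; exact absurd (Finset.min'_le _ i hmem) (not_le.2 hik)
      rw [mem_filter, not_and] at this
      have := this hiK
      push Not at this
      obtain ⟨t, l, hL, hlt⟩ := this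
      have h3 := hi i hiK t l hL hlt
      rw [hL] at hci
      rcases List.mem_cons.1 hci with e | e
      · rw [← e] at hlt
        rcases hcab with rfl | rfl <;> linarith
      · rcases hcab with rfl | rfl
        · exact h3.1 e
        · exact h3.2 e
    have hrem : ∀ c, c = a ∨ c = b → c ∉ L k → h.rem k c := by
      intro c hcab hck
      apply h.rem_of (by rcases hcab with rfl | rfl <;> assumption)
      intro i hiK hci
      by_contra hlt
      rcases (not_lt.1 hlt).lt_or_eq with e | e
      · exact hmin i hiK e c hcab hci
      · rw [e] at hci; exact hck hci
    obtain ⟨t, l, hL⟩ := h.ne hk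
    have ht := hkt t l hL
    have hgr := h.gr k hk
    have hxb := h.ge b hb
    have hnd := h.nodup k hk
    rw [hL] at hgr
    obtain ⟨-, hg1, hg2, hg3⟩ := hgr
    cases l with
    | nil => simp only [Gr] at hg3; linarith
    | cons s l =>
    obtain ⟨-, hg4, hg5, -⟩ := hg3
    have htM := (h.sub k hk t (by simp [hL])).1
    have hsM := (h.sub k hk s (by simp [hL])).1
    have htL : t ∈ L k := by simp [hL]
    have hsL : s ∈ L k := by simp [hL]
    have hts : t ≠ s := by rw [hL] at hnd; simp at hnd; tauto
    have ht' : ∀ c, c = a ∨ c = b → c ∉ L k → v c ≤ v t := fun c h1 h3 => h.top hk hL (hrem c h1 h3)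
    have hs' : ∀ c, c = a ∨ c = b → c ∉ L k → v t + v c ≤ 1 → v c ≤ v s := fun c h1 h3 h4 =>
      hg5 c (hrem c h1 h3) (by linarith)
    by_cases hak : a ∈ L k
    · by_cases hbk : b ∈ L k
      · refine ⟨k, hk, _, h.exch hk (fun _ => t) ?_ ?_⟩
        · intro c hc hPc hck
          rcases h2 c hc hPc with rfl | rfl <;> contradiction
        · intro c hc hPc hck
          rcases h2 c hc hPc with rfl | rfl <;> contradiction
      · refine ⟨k, hk, _, h.exch hk (fun _ => if a = t then s else t) ?_ ?_⟩
        · intro c hc hPc hck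
          have hcb : c = b := by
            rcases h2 c hc hPc with rfl | rfl
            · contradiction
            · rfl
          subst hcb
          split_ifs with e
          · refine ⟨hsL, ?_, hs' c (Or.inr rfl) hck (by linarith)⟩
            intro e'
            rcases h2 s hsM e' with rfl | rfl
            · exact hts e.symm
            · contradiction
          · refine ⟨htL, ?_, ht' c (Or.inr rfl) hck⟩
            intro e'
            rcases h2 t htM e' with rfl | rfl
            · exact e rfl
            · contradiction
        · intro c hc hPc hck c' hc' hPc' hck' _
          rcases h2 c hc hPc with rfl | rfl <;> rcases h2 c' hc' hPc' with rfl | rfl <;> first | rfl | contradiction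
    · by_cases hbk : b ∈ L k
      · refine ⟨k, hk, _, h.exch hk (fun _ => if b = t then s else t) ?_ ?_⟩
        · intro c hc hPc hck
          have hcb : c = a := by
            rcases h2 c hc hPc with rfl | rfl
            · rfl
            · contradiction
          subst hcb
          split_ifs with e
          · refine ⟨hsL, ?_, hs' c (Or.inl rfl) hck (by rw [← e]; linarith)⟩
            intro e'
            rcases h2 s hsM e' with rfl | rfl
            · contradiction
            · exact hts e.symm
          · refine ⟨htL, ?_, ht' c (Or.inl rfl) hck⟩
            intro e'
            rcases h2 t htM e' with rfl | rfl
            · contradiction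
            · exact e rfl
        · intro c hc hPc hck c' hc' hPc' hck' _
          rcases h2 c hc hPc with rfl | rfl <;> rcases h2 c' hc' hPc' with rfl | rfl <;> first | rfl | contradiction
      · refine ⟨k, hk, _, h.exch hk (fun c => if c = a then t else s) ?_ ?_⟩
        · intro c hc hPc hck
          split_ifs with e
          · subst e
            refine ⟨htL, ?_, ht' c (Or.inl rfl) hck⟩
            intro e'
            rcases h2 t htM e' with rfl | rfl <;> contradiction
          · have hcb := (h2 c hc hPc).resolve_left e
            subst hcb
            refine ⟨hsL, ?_, hs' c (Or.inr rfl) hck (by linarith)⟩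
            intro e'
            rcases h2 s hsM e' with rfl | rfl <;> contradiction
        · intro c hc hPc hck c' hc' hPc' hck' he
          skip
          rcases h2 c hc hPc with e1 | e1 <;> rcases h2 c' hc' hPc' with e2 | e2
          · rw [e1, e2]
          · rw [e1, e2, if_pos rfl, if_neg (Ne.symm hab)] at he; exact absurd he hts
          · rw [e1, e2, if_pos rfl, if_neg (Ne.symm hab)] at he; exact absurd he.symm hts
          · rw [e1, e2]

end Pk

lemma Pk_reduce (v : α → ℚ) (x : α) (L : ℕ → List α) : ∀ (m : ℕ) (M : Finset α) (K : Finset ℕ)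
    (D : Finset ℕ) (P : α → ℕ), K.card = m → Pk v x M K L D P → 11 * D.card ≤ 9 * K.card →
    ∃ M K D P, Pk v x M K L D P ∧ 11 * D.card ≤ 9 * K.card ∧
      ∀ c ∈ M, 3 ≤ #{y ∈ M | P y = P c} := by
  intro m
  induction m with
  | zero =>
    intro M K D P hm h hc
    have : 0 < D.card := card_pos.2 ⟨_, h.PD x h.xM⟩
    omega
  | succ m ih =>
    intro M K D P hm h hc
    by_cases hall : ∀ c ∈ M, 3 ≤ #{y ∈ M | P y = P c}
    · exact ⟨M, K, D, P, h, hc, hall⟩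
    · push Not at hall
      obtain ⟨c, hcM, hlt⟩ := hall
      have hK : K.Nonempty := card_pos.1 (by omega)
      have hc0 : c ∈ ({y ∈ M | P y = P c} : Finset α) := by simp [hcM]
      have key : ∃ k ∈ K, ∃ P', Pk v x (M \ (L k).toFinset) (K.erase k) L (D.erase (P c)) P' := by
        have hpos : 0 < #{y ∈ M | P y = P c} := card_pos.2 ⟨c, hc0⟩
        have h12 : #{y ∈ M | P y = P c} = 1 ∨ #{y ∈ M | P y = P c} = 2 := by omega
        rcases h12 with h1 | h2
        · obtain ⟨a, ha⟩ := card_eq_one.1 h1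
          rw [ha] at hc0
          have hca := mem_singleton.1 hc0
          subst hca
          refine h.red1 hK hcM (fun y hy hyP => ?_)
          have : y ∈ ({y ∈ M | P y = P c} : Finset α) := by simp [hy, hyP]
          rw [ha] at this; exact mem_singleton.1 this
        · obtain ⟨a, b, hab, he⟩ := card_eq_two.1 h2
          have hmem : ∀ y, (y ∈ M ∧ P y = P c) ↔ (y = a ∨ y = b) := by
            intro y
            have : y ∈ ({y ∈ M | P y = P c} : Finset α) ↔ y ∈ ({a, b} : Finset α) := by rw [he]
            simpa using this
          have ha := (hmem a).2 (Or.inl rfl)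
          have hb := (hmem b).2 (Or.inr rfl)
          rcases le_total (v b) (v a) with hle | hle
          · rw [← ha.2]
            exact h.red2 ha.1 hb.1 hab (by rw [ha.2, hb.2]) hle
              (fun y hy hyP => (hmem y).1 ⟨hy, by rw [hyP, ha.2]⟩)
          · rw [← hb.2]
            exact h.red2 hb.1 ha.1 hab.symm (by rw [ha.2, hb.2]) hle
              (fun y hy hyP => ((hmem y).1 ⟨hy, by rw [hyP, hb.2]⟩).symm)
      obtain ⟨k, hk, P', hP'⟩ := key
      refine ih _ _ _ _ ?_ hP' ?_
      · rw [card_erase_of_mem hk]; omega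
      · rw [card_erase_of_mem hk, card_erase_of_mem (h.PD c hcM)]; omega


lemma Gr_sum (v : α → ℚ) (x : ℚ) (r : α → Prop) : ∀ l s, Gr v x r s l → 1 < s + (l.map v).sum + x := by
  intro l
  induction l with
  | nil => intro s h; simpa [Gr] using h
  | cons a l ih => intro s h; have := ih _ h.2.2.2; simp only [List.map_cons, List.sum_cons]; linarith

section
variable {v : α → ℚ} {x : α} {M : Finset α} {K : Finset ℕ} {L : ℕ → List α} {D : Finset ℕ} {P : α → ℕ}

lemma sum_M (h : Pk v x M K L D P) (W : α → ℚ) :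
    ∑ c ∈ M, W c = W x + ∑ k ∈ K, ((L k).map W).sum := by
  have hM : M = insert x (K.biUnion fun k => (L k).toFinset) := by
    ext c
    simp only [mem_insert, mem_biUnion, List.mem_toFinset]
    constructor
    · exact h.cover c
    · rintro (rfl | ⟨k, hk, hc⟩)
      · exact h.xM
      · exact (h.sub k hk c hc).1
  rw [hM, sum_insert, sum_biUnion]
  · congr 1
    exact sum_congr rfl fun k hk => List.sum_toFinset _ (h.nodup k hk)
  · intro i hi j hj hij
    refine Finset.disjoint_left.2 fun c hc hc' => hij ?_
    exact h.disj i hi j hj c (by simpa using hc) (by simpa using hc')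
  · simp only [mem_biUnion, List.mem_toFinset, not_exists, not_and]
    intro k hk hx
    exact (h.sub k hk x hx).2 rfl

lemma fw (h : Pk v x M K L D P) (hc : 11 * D.card ≤ 9 * K.card) (W : α → ℚ)
    (hopt : ∀ j ∈ D, ∑ c ∈ M with P c = j, W c ≤ 88)
    (hffd : 72 * (K.card : ℚ) < W x + ∑ k ∈ K, ((L k).map W).sum) : False := by
  rw [← sum_M h, ← Finset.sum_fiberwise_of_maps_to h.PD] at hffd
  have h1 : ∑ j ∈ D, ∑ c ∈ M with P c = j, W c ≤ ∑ j ∈ D, 88 := sum_le_sum hopt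
  rw [sum_const, nsmul_eq_mul] at h1
  have : (11 * D.card : ℚ) ≤ 9 * K.card := by exact_mod_cast hc
  linarith

lemma case_small (h : Pk v x M K L D P) (hc : 11 * D.card ≤ 9 * K.card) (hx : v x ≤ 2 / 11) : False := by
  refine fw h hc (fun c => 88 * v c) ?_ ?_
  · intro j hj
    rw [← mul_sum]
    have := h.cap j hj
    linarith
  · have : ∑ k ∈ K, (72 : ℚ) ≤ ∑ k ∈ K, ((L k).map (fun c => 88 * v c)).sum := by
      refine sum_le_sum fun k hk => ?_
      have := Gr_sum _ _ _ _ _ (h.gr k hk)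
      rw [List.sum_map_mul_left]
      linarith
    rw [sum_const, nsmul_eq_mul] at this
    have := h.xpos
    linarith

lemma sum_last (K' : Finset ℕ) (δ : ℕ → ℚ) (hδ : ∀ k ∈ K', δ k ≤ 0 ∨ ∀ i ∈ K', i ≤ k) :
    ∑ k ∈ K', δ k ≤ 0 ∨ ∃ k ∈ K', (∀ i ∈ K', i ≤ k) ∧ ∑ k ∈ K', δ k ≤ δ k := by
  by_cases hall : ∀ k ∈ K', δ k ≤ 0
  · left; exact sum_nonpos hall
  · right
    push Not at hall
    obtain ⟨k, hk, hpos⟩ := hall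
    have hlast := (hδ k hk).resolve_left (not_le.2 hpos)
    refine ⟨k, hk, hlast, ?_⟩
    rw [← add_sum_erase _ _ hk]
    have : ∑ i ∈ K'.erase k, δ i ≤ 0 := by
      refine sum_nonpos fun i hi => ?_
      obtain ⟨h1, h2⟩ := mem_erase.1 hi
      refine (hδ i h2).resolve_right fun hh => h1 (le_antisymm (hlast i h2) (hh k hk))
    linarith

/-- top item -/
def tp (L : ℕ → List α) (x : α) (k : ℕ) : α := (L k).headD x

lemma tp_eq {L : ℕ → List α} {x : α} {k : ℕ} {a : α} {l : List α} (h : L k = a :: l) : tp L x k = a := by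
  simp [tp, h]

lemma Pk.tp_mem (h : Pk v x M K L D P) {k : ℕ} (hk : k ∈ K) : tp L x k ∈ L k := by
  obtain ⟨a, l, hL⟩ := h.ne hk
  rw [tp_eq hL, hL]; simp

lemma Pk.tp_top (h : Pk v x M K L D P) {k : ℕ} (hk : k ∈ K) {y : α} (hy : h.rem k y) : v y ≤ v (tp L x k) := by
  obtain ⟨a, l, hL⟩ := h.ne hk
  rw [tp_eq hL]; exact h.top hk hL hy

lemma Pk.tp_lt (h : Pk v x M K L D P) {i k : ℕ} (hi : i ∈ K) (hk : k ∈ K) (hlt : v (tp L x i) < v (tp L x k)) :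
    k < i := by
  by_contra hc
  rcases (not_lt.1 hc).lt_or_eq with e | e
  · have := h.tp_top hi (h.rem_later hk (h.tp_mem hk) e)
    linarith
  · rw [e] at hlt; exact lt_irrefl _ hlt

lemma Pk.tp_le (h : Pk v x M K L D P) {i k : ℕ} (hi : i ∈ K) (hk : k ∈ K) (hlt : i ≤ k) :
    v (tp L x k) ≤ v (tp L x i) := by
  by_contra hc
  exact absurd (h.tp_lt hi hk (not_le.1 hc)) (not_lt.2 hlt)

lemma Pk.tp_rem (h : Pk v x M K L D P) {i k : ℕ} (hi : i ∈ K) (hk : k ∈ K) (hlt : v (tp L x i) < v (tp L x k)) :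
    h.rem k (tp L x i) := h.rem_later hi (h.tp_mem hi) (h.tp_lt hi hk hlt)

lemma class_sum (h : Pk v x M K L D P) (K' : Finset ℕ) (hK : K' ⊆ K) (δ : ℕ → ℚ) (lo : ℚ)
    (hlo : ∀ k ∈ K', lo < v (tp L x k))
    (hδ : ∀ k ∈ K', δ k ≤ 0 ∨ ∀ y, h.rem k y → v y ≤ lo) :
    ∑ k ∈ K', δ k ≤ 0 ∨ ∃ k ∈ K', (∀ y, h.rem k y → v y ≤ lo) ∧ 0 < δ k ∧ ∑ k ∈ K', δ k ≤ δ k := by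
  by_cases h0 : ∑ k ∈ K', δ k ≤ 0
  · left; exact h0
  right
  have := sum_last K' δ ?_
  · obtain ⟨k, hk, hlast, hle⟩ := this.resolve_left h0
    have hpos : 0 < δ k := (not_le.1 h0).trans_le hle
    exact ⟨k, hk, (hδ k hk).resolve_left (not_le.2 hpos), hpos, hle⟩
  · intro k hk
    refine (hδ k hk).imp id fun hh i hi => ?_
    by_contra hlt
    have := hh _ (h.rem_later (hK hi) (h.tp_mem (hK hi)) (not_le.1 hlt))
    have := hlo i hi
    linarith

/-- reduced: every bin has at least three items -/
def Red (M : Finset α) (P : α → ℕ) : Prop := ∀ c ∈ M, 3 ≤ #{y ∈ M | P y = P c}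

lemma Red.three (hR : Red M P) {c : α} (hc : c ∈ M) : ∃ y z, y ∈ M ∧ z ∈ M ∧ y ≠ c ∧ z ≠ c ∧ y ≠ z ∧
    P y = P c ∧ P z = P c := by
  have h1 := hR c hc
  have hm : c ∈ ({y ∈ M | P y = P c} : Finset α) := by simp [hc]
  have h2 : 1 < #(({y ∈ M | P y = P c} : Finset α).erase c) := by
    rw [card_erase_of_mem hm]; omega
  obtain ⟨y, hy, z, hz, hne⟩ := one_lt_card.1 h2
  simp only [mem_erase, mem_filter] at hy hz
  exact ⟨y, z, hy.2.1, hz.2.1, hy.1, hz.1, hne, hy.2.2, hz.2.2⟩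

lemma Pk.three (h : Pk v x M K L D P) {a b c : α} (ha : a ∈ M) (hb : b ∈ M) (hc : c ∈ M) (hab : b ≠ a)
    (hac : c ≠ a) (hbc : b ≠ c) (hPb : P b = P a) (hPc : P c = P a) : v a + v b + v c ≤ 1 := by
  have := h.bin_le ha {a, b, c} (by intro y hy; simp at hy; rcases hy with rfl | rfl | rfl <;> simp [*])
  rw [sum_insert (by simp; tauto), sum_pair hbc] at this
  linarith

lemma Pk.four (h : Pk v x M K L D P) {a b c d : α} (ha : a ∈ M) (hb : b ∈ M) (hc : c ∈ M) (hd : d ∈ M) (hab : b ≠ a)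
    (hac : c ≠ a) (hbc : b ≠ c) (had : d ≠ a) (hbd : d ≠ b) (hcd : d ≠ c) (hPb : P b = P a) (hPc : P c = P a)
    (hPd : P d = P a) : v a + v b + v c + v d ≤ 1 := by
  have := h.bin_le ha {a, b, c, d} (by intro y hy; simp at hy; rcases hy with rfl | rfl | rfl | rfl <;> simp [*])
  rw [sum_insert (by simp; tauto), sum_insert (by simp; tauto), sum_pair hcd.symm] at this
  linarith

lemma Pk.le2 (h : Pk v x M K L D P) (hR : Red M P) {c : α} (hc : c ∈ M) : v c ≤ 1 - 2 * v x := by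
  obtain ⟨y, z, hy, hz, h1, h2, h3, h4, h5⟩ := hR.three hc
  have := h.three hc hy hz h1 h2 h3 h4 h5
  have := h.ge y hy
  have := h.ge z hz
  linarith

/-- bin has shape a :: b :: l -/
lemma Pk.two (h : Pk v x M K L D P) (hR : Red M P) {k : ℕ} (hk : k ∈ K) :
    ∃ a b l, L k = a :: b :: l ∧ v b ≤ v a ∧ (∀ y, h.rem k y → v y ≤ v a) ∧
      (∀ y, h.rem k y → v a + v y ≤ 1 → v y ≤ v b) ∧ (∀ c ∈ l, v c ≤ v b) ∧
      Gr v (v x) (h.rem k) (v a + v b) l := by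
  obtain ⟨a, l, hL⟩ := h.ne hk
  have ha := h.le2 hR (h.sub k hk a (by simp [hL])).1
  have hg := h.gr k hk
  have hx := h.xpos
  rw [hL] at hg
  obtain ⟨-, h1, h2, h3⟩ := hg
  cases l with
  | nil => simp only [Gr] at h3; linarith
  | cons b l =>
    obtain ⟨-, h4, h5, h6⟩ := h3
    refine ⟨a, b, l, hL, h1 b (by simp), fun y hy => h.top hk hL hy, ?_, h4, by rw [zero_add] at h6; exact h6⟩
    intro y hy hle
    exact h5 y hy (by linarith)

lemma ffd_fw (K : Finset ℕ) (f : ℕ → ℚ) (wx : ℚ) (hd : ∑ k ∈ K, (72 - f k) < wx) :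
    72 * (K.card : ℚ) < wx + ∑ k ∈ K, f k := by
  rw [sum_sub_distrib, sum_const, nsmul_eq_mul] at hd
  linarith

lemma case_large (h : Pk v x M K L D P) (hR : Red M P) (hc : 11 * D.card ≤ 9 * K.card) (hx : 1 / 4 < v x) : False := by
  set w : α → ℚ := fun c => if (1 - v x) / 2 < v c then 36 else 24 with hw
  have w1 : ∀ c, (1 - v x) / 2 < v c → w c = 36 := fun c hc => by simp [hw, hc]
  have w2 : ∀ c, ¬ (1 - v x) / 2 < v c → w c = 24 := fun c hc => by simp only [hw, if_neg hc]
  have w3 : ∀ c, 24 ≤ w c := fun c => by simp only [hw]; split_ifs <;> norm_num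
  have hx3 := h.le2 hR h.xM
  refine fw h hc w ?_ ?_
  · intro j hj
    by_cases hne : ({c ∈ M | P c = j} : Finset α) = ∅
    · rw [hne]; simp
    obtain ⟨c, hc⟩ := Finset.nonempty_iff_ne_empty.2 hne
    obtain ⟨hcM, rfl⟩ := mem_filter.1 hc
    obtain ⟨y, z, hy, hz, h1, h2, h3, h4, h5⟩ := hR.three hcM
    have heq : ({c' ∈ M | P c' = P c} : Finset α) = {c, y, z} := by
      ext d
      simp only [mem_filter, mem_insert, mem_singleton]
      constructor
      · rintro ⟨hd, hdP⟩
        by_contra hcon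
        push Not at hcon
        have := h.four hcM hy hz hd h1 h2 h3 hcon.1 hcon.2.1 hcon.2.2 h4 h5 hdP
        have := h.ge c hcM
        have := h.ge y hy
        have := h.ge z hz
        have := h.ge d hd
        linarith
      · rintro (rfl | rfl | rfl)
        · exact ⟨hcM, rfl⟩
        · exact ⟨hy, h4⟩
        · exact ⟨hz, h5⟩
    rw [heq, sum_insert (by simp; tauto), sum_pair h3]
    have := h.three hcM hy hz h1 h2 h3 h4 h5
    have := h.ge c hcM
    have := h.ge y hy
    have := h.ge z hz
    simp only [hw]
    split_ifs <;> linarith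
  · apply ffd_fw
    have hS : ∀ k ∈ K, ∀ a b l, L k = a :: b :: l → ¬ (1 - v x) / 2 < v a → 72 - ((L k).map w).sum ≤ 0 := by
      intro k hk a b l hL hna
      obtain ⟨a', b', l', hL', hba, -, -, -, hg⟩ := h.two hR hk
      rw [hL] at hL'
      simp only [List.cons.injEq] at hL'
      obtain ⟨rfl, rfl, rfl⟩ := hL'
      cases l with
      | nil => simp only [Gr] at hg; linarith
      | cons c l =>
        rw [hL]
        simp only [List.map_cons, List.sum_cons]
        have := w3 a
        have := w3 b
        have := w3 c
        have : 0 ≤ (l.map w).sum := List.sum_nonneg (by simp only [List.mem_map]; rintro _ ⟨c, _, rfl⟩; linarith [w3 c])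
        linarith
    have h0 : ∀ l : List α, 0 ≤ (l.map w).sum := fun l =>
      List.sum_nonneg (by simp only [List.mem_map]; rintro _ ⟨c, _, rfl⟩; linarith [w3 c])
    rw [← sum_filter_add_sum_filter_not K (fun k => (1 - v x) / 2 < v (tp L x k))]
    have hn : ∑ k ∈ K with ¬ (1 - v x) / 2 < v (tp L x k), (72 - ((L k).map w).sum) ≤ 0 := by
      refine sum_nonpos fun k hk => ?_
      obtain ⟨hk, hk'⟩ := mem_filter.1 hk
      obtain ⟨a, b, l, hL, -⟩ := h.two hR hk
      exact hS k hk a b l hL (by rwa [tp_eq hL] at hk')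
    have key := class_sum h (K.filter (fun k => (1 - v x) / 2 < v (tp L x k))) (filter_subset _ _)
      (fun k => 72 - ((L k).map w).sum) ((1 - v x) / 2) (fun k hk => (mem_filter.1 hk).2) ?_
    · rcases key with key | ⟨k, hk, -, -, key⟩
      · have := w3 x; linarith
      · obtain ⟨hk, ha⟩ := mem_filter.1 hk
        obtain ⟨a, b, l, hL, -⟩ := h.two hR hk
        rw [tp_eq hL] at ha
        simp only [hL, List.map_cons, List.sum_cons] at key
        have := w1 a ha
        have := w3 b
        have := h0 l
        have := w3 x
        linarith
    · intro k hk
      obtain ⟨hk, ha⟩ := mem_filter.1 hk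
      obtain ⟨a, b, l, hL, hba, h1, h2, -⟩ := h.two hR hk
      rw [tp_eq hL] at ha
      by_cases hb : (1 - v x) / 2 < v b
      · left
        simp only [hL, List.map_cons, List.sum_cons, w1 a ha, w1 b hb]
        have := h0 l; linarith
      · right
        intro y hy
        have := h2 y hy (by
          have := h.le2 hR hy.1
          have := h.le2 hR (h.sub k hk a (by simp [hL])).1
          linarith)
        linarith

end

/-- level -/
structure Lv where
  a : ℕ
  b : ℕ
  w : ℕ
  s : Bool

/-- infeasible -/
def Lv.inf (t : Lv) (st : Bool) (rL rR : ℕ) : Bool :=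
  (decide (rL ≤ t.a) && decide (rR ≤ t.b) && (st || t.s)) || (decide (rL ≤ t.a) && decide (rR < t.b))

/-- checker -/
def chk : ℕ → List Lv → Bool → ℕ → ℕ → ℕ → Bool
  | 0, _, _, _, _, _ => false
  | _ + 1, [], _, _, _, w => decide (w ≤ 88)
  | n + 1, t :: ls, st, rL, rR, w =>
    chk n ls st rL rR w && (t.inf st rL rR || chk n (t :: ls) (st || t.s) (rL - t.a) (rR - t.b) (w + t.w))

/-- checker with a start -/
def chk1 (n : ℕ) (t : Lv) (ls : List Lv) (st : Bool) (rL rR w : ℕ) : Bool :=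
  t.inf st rL rR || chk n ls (st || t.s) (rL - t.a) (rR - t.b) (w + t.w)

/-- above level -/
def Lv.ab (A B : ℚ) (v W : α → ℚ) (c : α) (t : Lv) : Prop :=
  W c ≤ t.w ∧ t.a * A + t.b * B ≤ v c ∧ (t.s = true → t.a * A + t.b * B < v c)

/-- sum bounded -/
def bd (st : Bool) (s r : ℚ) : Prop := s ≤ r ∧ (st = true → s < r)

lemma step_sound {A B : ℚ} (hA : 0 ≤ A) (hB' : 0 < B) {v W : α → ℚ} {t : Lv} {c : α}
    (hc : t.ab A B v W c) {st : Bool} {rL rR : ℕ} {S : Finset α} (hcS : c ∈ S) (hpos : ∀ c ∈ S, 0 ≤ v c)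
    (hb : bd st (∑ c ∈ S, v c) (rL * A + rR * B)) :
    t.inf st rL rR = false ∧ bd (st || t.s) (∑ c ∈ S.erase c, v c) ((rL - t.a : ℕ) * A + (rR - t.b : ℕ) * B) := by
  have hB : 0 ≤ B := hB'.le
  have hsum := add_sum_erase S v hcS
  have hnn : 0 ≤ ∑ c ∈ S.erase c, v c := sum_nonneg fun c hc => hpos c (mem_of_mem_erase hc)
  obtain ⟨hW, h1, h2⟩ := hc
  obtain ⟨h3, h4⟩ := hb
  constructor
  · rw [Bool.eq_false_iff]
    intro hinf
    simp only [Lv.inf, Bool.or_eq_true, Bool.and_eq_true, decide_eq_true_eq] at hinf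
    rcases hinf with ⟨⟨h5, h6⟩, h7⟩ | ⟨h5, h6⟩
    · have h5' : (rL : ℚ) ≤ t.a := by exact_mod_cast h5
      have h6' : (rR : ℚ) ≤ t.b := by exact_mod_cast h6
      have := mul_le_mul_of_nonneg_right h5' hA
      have := mul_le_mul_of_nonneg_right h6' hB
      rcases h7 with h7 | h7
      · have := h4 h7; linarith
      · have := h2 h7; linarith
    · have h5' : (rL : ℚ) ≤ t.a := by exact_mod_cast h5
      have h6' : (rR : ℚ) + 1 ≤ t.b := by exact_mod_cast h6
      have := mul_le_mul_of_nonneg_right h5' hA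
      have := mul_le_mul_of_nonneg_right h6' hB
      linarith
  · have e1 : (rL : ℚ) - t.a ≤ ((rL - t.a : ℕ) : ℚ) := by
      have : rL ≤ (rL - t.a) + t.a := by omega
      have : (rL : ℚ) ≤ ((rL - t.a : ℕ) : ℚ) + t.a := by exact_mod_cast this
      linarith
    have e2 : (rR : ℚ) - t.b ≤ ((rR - t.b : ℕ) : ℚ) := by
      have : rR ≤ (rR - t.b) + t.b := by omega
      have : (rR : ℚ) ≤ ((rR - t.b : ℕ) : ℚ) + t.b := by exact_mod_cast this
      linarith
    have e1' := mul_le_mul_of_nonneg_right e1 hA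
    have e2' := mul_le_mul_of_nonneg_right e2 hB
    refine ⟨by linarith, fun h => ?_⟩
    rw [Bool.or_eq_true] at h
    rcases h with h | h
    · have := h4 h; linarith
    · have := h2 h; linarith

lemma chk_sound {A B : ℚ} (hA : 0 ≤ A) (hB' : 0 < B) {v W : α → ℚ} :
    ∀ (n : ℕ) (ls : List Lv) (st : Bool) (rL rR w : ℕ), chk n ls st rL rR w = true →
    ∀ S : Finset α, (∀ c ∈ S, 0 ≤ v c) → (∀ c ∈ S, ∃ t ∈ ls, t.ab A B v W c) →
      bd st (∑ c ∈ S, v c) (rL * A + rR * B) → w + ∑ c ∈ S, W c ≤ 88 := by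
  intro n
  induction n with
  | zero => intro ls st rL rR w h; simp [chk] at h
  | succ n ih =>
    intro ls st rL rR w h S hpos hS hb
    cases ls with
    | nil =>
      have : S = ∅ := by
        rw [Finset.eq_empty_iff_forall_notMem]; intro c hc; obtain ⟨t, ht, _⟩ := hS c hc; simp at ht
      subst this
      simp only [chk, decide_eq_true_eq] at h
      simp only [sum_empty, add_zero]
      exact_mod_cast h
    | cons t ls =>
      simp only [chk, Bool.and_eq_true, Bool.or_eq_true] at h
      by_cases hex : ∃ c ∈ S, t.ab A B v W c
      · obtain ⟨c, hcS, hc⟩ := hex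
        obtain ⟨h1, h2⟩ := step_sound hA hB' hc hcS hpos hb
        have h3 := h.2.resolve_left (by rw [h1]; simp)
        have := ih _ _ _ _ _ h3 (S.erase c) (fun c hc => hpos c (mem_of_mem_erase hc))
          (fun c hc => hS c (mem_of_mem_erase hc)) h2
        rw [← add_sum_erase S W hcS]
        have := hc.1
        push_cast at *
        linarith
      · push Not at hex
        refine ih _ _ _ _ _ h.1 S hpos (fun c hc => ?_) hb
        obtain ⟨t', ht', hab⟩ := hS c hc
        rcases List.mem_cons.1 ht' with rfl | ht'
        · exact absurd hab (hex c hc)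
        · exact ⟨t', ht', hab⟩

lemma chk1_sound {A B : ℚ} (hA : 0 ≤ A) (hB' : 0 < B) {v W : α → ℚ}
    {n : ℕ} {t : Lv} {ls : List Lv} {st : Bool} {rL rR w : ℕ} (h : chk1 n t ls st rL rR w = true)
    {S : Finset α} {c : α} (hcS : c ∈ S) (hc : t.ab A B v W c) (hpos : ∀ c ∈ S, 0 ≤ v c)
    (hS : ∀ c' ∈ S, c' ≠ c → ∃ t ∈ ls, t.ab A B v W c')
    (hb : bd st (∑ c ∈ S, v c) (rL * A + rR * B)) : w + ∑ c ∈ S, W c ≤ 88 := by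
  obtain ⟨h1, h2⟩ := step_sound hA hB' hc hcS hpos hb
  simp only [chk1, Bool.or_eq_true] at h
  have h3 := h.resolve_left (by rw [h1]; simp)
  have := chk_sound hA hB' _ _ _ _ _ _ h3 (S.erase c) (fun c hc => hpos c (mem_of_mem_erase hc))
    (fun c' hc' => hS c' (mem_of_mem_erase hc') (ne_of_mem_erase hc')) h2
  rw [← add_sum_erase S W hcS]
  have := hc.1
  push_cast at *
  linarith

section
variable {v : α → ℚ} {x : α} {M : Finset α} {K : Finset ℕ} {L : ℕ → List α} {D : Finset ℕ} {P : α → ℕ}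

/-- the R structure -/
structure RS (v : α → ℚ) (x : α) (M : Finset α) (K : Finset ℕ) (L : ℕ → List α) (P : α → ℕ)
    (R : Finset ℕ) (p q y z : ℕ → α) : Prop where
  RK : ∀ k ∈ R, k ∈ K
  Lk : ∀ k ∈ R, L k = [p k, q k]
  pB : ∀ k ∈ R, (1 - v x) / 2 < v (p k)
  qx : ∀ k ∈ R, v (q k) ≤ 2 * v x
  compl : ∀ k ∈ K, k ∉ R → ∀ a b, L k = [a, b] → (1 - v x) / 2 < v a → 2 * v x < v b
  bin : ∀ k ∈ R, ({c ∈ M | P c = P (p k)} : Finset α) = {p k, y k, z k}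
  yp : ∀ k ∈ R, y k ≠ p k
  zp : ∀ k ∈ R, z k ≠ p k
  yz : ∀ k ∈ R, y k ≠ z k

lemma exists_RS (h : Pk v x M K L D P) (hR : Red M P) : ∃ R p q y z, RS v x M K L P R p q y z := by
  classical
  set R := K.filter (fun k => ∃ p q, L k = [p, q] ∧ (1 - v x) / 2 < v p ∧ v q ≤ 2 * v x) with hRd
  have key : ∀ k, ∃ p q y z, k ∈ R → L k = [p, q] ∧ (1 - v x) / 2 < v p ∧ v q ≤ 2 * v x ∧
      ({c ∈ M | P c = P p} : Finset α) = {p, y, z} ∧ y ≠ p ∧ z ≠ p ∧ y ≠ z := by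
    intro k
    by_cases hk : k ∈ R
    · obtain ⟨hkK, p, q, hL, h1, h2⟩ := mem_filter.1 hk
      have hp := (h.sub k hkK p (by simp [hL])).1
      have hg := Gr_sum _ _ _ _ _ (h.gr k hkK)
      rw [hL] at hg; simp at hg
      obtain ⟨y, z, hy, hz, h3, h4, h5, h6, h7⟩ := hR.three hp
      refine ⟨p, q, y, z, fun _ => ⟨hL, h1, h2, ?_, h3, h4, h5⟩⟩
      ext d
      simp only [mem_filter, mem_insert, mem_singleton]
      constructor
      · rintro ⟨hd, hdP⟩
        by_contra hcon
        push Not at hcon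
        have := h.four hp hy hz hd h3 h4 h5 hcon.1 hcon.2.1 hcon.2.2 h6 h7 hdP
        have := h.ge y hy
        have := h.ge z hz
        have := h.ge d hd
        linarith
      · rintro (rfl | rfl | rfl)
        · exact ⟨hp, rfl⟩
        · exact ⟨hy, h6⟩
        · exact ⟨hz, h7⟩
    · exact ⟨x, x, x, x, fun h => absurd h hk⟩
  choose p q y z hh using key
  refine ⟨R, p, q, y, z, ⟨fun k hk => (mem_filter.1 hk).1, fun k hk => (hh k hk).1, fun k hk => (hh k hk).2.1,
    fun k hk => (hh k hk).2.2.1, ?_, fun k hk => (hh k hk).2.2.2.1, fun k hk => (hh k hk).2.2.2.2.1,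
    fun k hk => (hh k hk).2.2.2.2.2.1, fun k hk => (hh k hk).2.2.2.2.2.2⟩⟩
  intro k hk hkR a b hL ha
  by_contra hb
  exact hkR (mem_filter.2 ⟨hk, a, b, hL, ha, not_lt.1 hb⟩)

namespace RS
variable {R : Finset ℕ} {p q y z : ℕ → α}

lemma pM (r : RS v x M K L P R p q y z) (h : Pk v x M K L D P) {k : ℕ} (hk : k ∈ R) : p k ∈ M :=
  (h.sub k (r.RK k hk) _ (by simp [r.Lk k hk])).1
lemma qM (r : RS v x M K L P R p q y z) (h : Pk v x M K L D P) {k : ℕ} (hk : k ∈ R) : q k ∈ M :=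
  (h.sub k (r.RK k hk) _ (by simp [r.Lk k hk])).1
lemma pL (r : RS v x M K L P R p q y z) {k : ℕ} (hk : k ∈ R) : p k ∈ L k := by simp [r.Lk k hk]
lemma qL (r : RS v x M K L P R p q y z) {k : ℕ} (hk : k ∈ R) : q k ∈ L k := by simp [r.Lk k hk]
lemma tpR (r : RS v x M K L P R p q y z) {k : ℕ} (hk : k ∈ R) : tp L x k = p k := tp_eq (r.Lk k hk)

lemma yM (r : RS v x M K L P R p q y z) {k : ℕ} (hk : k ∈ R) : y k ∈ M ∧ P (y k) = P (p k) := by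
  have : y k ∈ ({c ∈ M | P c = P (p k)} : Finset α) := by rw [r.bin k hk]; simp
  simpa using this
lemma zM (r : RS v x M K L P R p q y z) {k : ℕ} (hk : k ∈ R) : z k ∈ M ∧ P (z k) = P (p k) := by
  have : z k ∈ ({c ∈ M | P c = P (p k)} : Finset α) := by rw [r.bin k hk]; simp
  simpa using this

lemma pyz (r : RS v x M K L P R p q y z) (h : Pk v x M K L D P) {k : ℕ} (hk : k ∈ R) :
    v (p k) + v (y k) + v (z k) ≤ 1 :=
  h.three (r.pM h hk) (r.yM hk).1 (r.zM hk).1 (r.yp k hk) (r.zp k hk) (r.yz k hk) (r.yM hk).2 (r.zM hk).2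

lemma pqx (r : RS v x M K L P R p q y z) (h : Pk v x M K L D P) {k : ℕ} (hk : k ∈ R) :
    1 < v (p k) + v (q k) + v x := by
  have hg := Gr_sum _ _ _ _ _ (h.gr k (r.RK k hk))
  rw [r.Lk k hk] at hg; simpa [add_assoc] using hg

lemma qp (r : RS v x M K L P R p q y z) (h : Pk v x M K L D P) {k : ℕ} (hk : k ∈ R) :
    v (q k) ≤ v (p k) := by
  have hg := h.gr k (r.RK k hk)
  rw [r.Lk k hk] at hg; exact hg.2.1 _ (by simp)

lemma pneq (r : RS v x M K L P R p q y z) (h : Pk v x M K L D P) {k : ℕ} (hk : k ∈ R) :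
    p k ≠ q k := by
  have hg := h.nodup k (r.RK k hk)
  rw [r.Lk k hk] at hg; simpa using hg

lemma fits (r : RS v x M K L P R p q y z) (h : Pk v x M K L D P) (hR : Red M P) {k : ℕ} (hk : k ∈ R) {c : α}
    (hc : h.rem k c) (hcx : v (p k) + v c ≤ 1) : v c ≤ v (q k) := by
  have hg := h.gr k (r.RK k hk)
  rw [r.Lk k hk] at hg
  exact hg.2.2.2.2.2.1 c hc (by linarith)

/-- o is y or z -/
lemma o_lt (r : RS v x M K L P R p q y z) (h : Pk v x M K L D P) {k : ℕ} (hk : k ∈ R) {o : α}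
    (ho : o = y k ∨ o = z k) : v o < v (q k) := by
  have := r.pyz h hk
  have := r.pqx h hk
  have := h.ge _ (r.yM hk).1
  have := h.ge _ (r.zM hk).1
  rcases ho with rfl | rfl <;> linarith

lemma yzq (r : RS v x M K L P R p q y z) (h : Pk v x M K L D P) {k : ℕ} (hk : k ∈ R) :
    v (y k) + v (z k) - v x < v (q k) := by
  have := r.pyz h hk
  have := r.pqx h hk
  linarith

lemma o_ne_q (r : RS v x M K L P R p q y z) (h : Pk v x M K L D P) (hR : Red M P) {k i : ℕ} (hk : k ∈ R)
    (hi : i ∈ R) {o : α} (ho : o = y k ∨ o = z k) : o ≠ q i := by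
  rintro rfl
  have h1 := r.o_lt h hk ho
  have h2 := r.pyz h hk
  have h3 := h.ge _ (r.yM hk).1
  have h4 := h.ge _ (r.zM hk).1
  have h2' : v (p k) + v (q i) + v x ≤ 1 := by rcases ho with e | e <;> rw [e] <;> linarith
  rcases lt_trichotomy i k with e | e | e
  · have hrem := h.rem_later (r.RK k hk) (r.qL hk) e
    have := r.fits h hR hi hrem (by
      have := h.le2 hR (r.pM h hi)
      have := r.qx k hk
      linarith)
    linarith
  · subst e; linarith
  · have hrem := h.rem_later (r.RK i hi) (r.pL hi) e
    have := h.top (r.RK k hk) (r.Lk k hk) hrem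
    have := r.pqx h hi
    linarith

lemma big_eq (r : RS v x M K L P R p q y z) (h : Pk v x M K L D P) {k : ℕ} (hk : k ∈ R) {c : α} (hc : c ∈ M)
    (hP : P c = P (p k)) (hb : (1 - v x) / 2 < v c) : c = p k := by
  have : c ∈ ({c ∈ M | P c = P (p k)} : Finset α) := by simp [hc, hP]
  rw [r.bin k hk] at this
  have h2 := r.pyz h hk
  have h3 := h.ge _ (r.yM hk).1
  have h4 := h.ge _ (r.zM hk).1
  have h5 := r.pB k hk
  simp only [mem_insert, mem_singleton] at this
  rcases this with rfl | rfl | rfl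
  · rfl
  · linarith
  · linarith

lemma o_small (r : RS v x M K L P R p q y z) (h : Pk v x M K L D P) {k : ℕ} (hk : k ∈ R) {o : α}
    (ho : o = y k ∨ o = z k) : v o ≤ (1 - v x) / 2 := by
  by_contra hc
  have : o ∈ M ∧ P o = P (p k) := by
    rcases ho with rfl | rfl
    · exact r.yM hk
    · exact r.zM hk
  have := r.big_eq h hk this.1 this.2 (not_le.1 hc)
  rcases ho with rfl | rfl
  · exact r.yp k hk this
  · exact r.zp k hk this

lemma o_ne_p (r : RS v x M K L P R p q y z) (h : Pk v x M K L D P) {k i : ℕ} (hk : k ∈ R)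
    (hi : i ∈ R) {o : α} (ho : o = y k ∨ o = z k) : o ≠ p i := by
  rintro rfl
  have := r.o_small h hk ho
  have := r.pB i hi
  linarith

lemma p_inj (r : RS v x M K L P R p q y z) (h : Pk v x M K L D P) {k i : ℕ} (hk : k ∈ R)
    (hi : i ∈ R) (he : p k = p i) : k = i :=
  h.disj k (r.RK k hk) i (r.RK i hi) _ (r.pL hk) (he ▸ r.pL hi)
lemma q_inj (r : RS v x M K L P R p q y z) (h : Pk v x M K L D P) {k i : ℕ} (hk : k ∈ R)
    (hi : i ∈ R) (he : q k = q i) : k = i :=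
  h.disj k (r.RK k hk) i (r.RK i hi) _ (r.qL hk) (he ▸ r.qL hi)
lemma p_ne_q (r : RS v x M K L P R p q y z) (h : Pk v x M K L D P) {k i : ℕ} (hk : k ∈ R)
    (hi : i ∈ R) : p k ≠ q i := by
  intro he
  have := h.disj k (r.RK k hk) i (r.RK i hi) _ (r.pL hk) (he ▸ r.qL hi)
  subst this; exact r.pneq h hk he

/-- F4 -/
lemma F4 (r : RS v x M K L P R p q y z) (h : Pk v x M K L D P) (hR : Red M P) {c : α} (hc : c ∈ M)
    (hq : ∀ k ∈ R, c ≠ q k) (h1 : v c ≤ (1 - v x) / 2) (h2 : v c ≤ 2 * v x) {i : ℕ} (hi : i ∈ R) :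
    v c ≤ v (q i) := by
  have hpi := h.le2 hR (r.pM h hi)
  by_cases hrem : h.rem i c
  · exact r.fits h hR hi hrem (by linarith)
  · have : ∃ j ∈ K, j ≤ i ∧ c ∈ L j := by
      by_contra hcon
      push Not at hcon
      exact hrem ⟨hc, hcon⟩
    obtain ⟨j, hj, hji, hcj⟩ := this
    have hpB := r.pB i hi
    by_cases hjR : j ∈ R
    · rw [r.Lk j hjR] at hcj
      simp at hcj
      rcases hcj with e | e
      · have := r.pB j hjR; rw [← e] at this; linarith
      · exact absurd e (hq j hjR)
    · have hji' : j < i := lt_of_le_of_ne hji (by rintro rfl; exact hjR hi)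
      obtain ⟨a, b, l, hL, hba, ht, hf, hl, hg⟩ := h.two hR hj
      have hat := ht _ (h.rem_later (r.RK i hi) (r.pL hi) hji')
      have haM := h.le2 hR (h.sub j hj a (by simp [hL])).1
      have hqi := r.qx i hi
      have hqb := hf _ (h.rem_later (r.RK i hi) (r.qL hi) hji') (by linarith)
      have hpqx := r.pqx h hi
      cases l with
      | nil =>
        rw [hL] at hcj
        simp at hcj
        rcases hcj with rfl | rfl
        · linarith
        · have := r.compl j hj hjR a c hL (by linarith); linarith
      | cons d l => have := hg.1; linarith

lemma special_unique (r : RS v x M K L P R p q y z) (h : Pk v x M K L D P) (hR : Red M P) {i j : ℕ} (hi : i ∈ R)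
    (hj : j ∈ R) (h1 : v (p i) ≤ 1 / 2) (h2 : v (q i) ≤ (1 - v x) / 2) (h3 : v (p j) ≤ 1 / 2)
    (h4 : v (q j) ≤ (1 - v x) / 2) : i = j := by
  have aux : ∀ i j, i ∈ R → j ∈ R → v (p i) ≤ 1 / 2 → v (q i) ≤ (1 - v x) / 2 → v (p j) ≤ 1 / 2 → ¬ i < j := by
    intro i j hi hj h1 h2 h3 hlt
    have := r.fits h hR hi (h.rem_later (r.RK j hj) (r.pL hj) hlt) (by linarith)
    have := r.pB j hj
    linarith
  rcases lt_trichotomy i j with e | e | e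
  · exact absurd e (aux i j hi hj h1 h2 h3)
  · exact e
  · exact absurd e (aux j i hj hi h3 h4 h1)

/-- framework with R -/
lemma fwR (r : RS v x M K L P R p q y z) (h : Pk v x M K L D P) (hR : Red M P)
    (hc : 11 * D.card ≤ 9 * K.card) (w : α → ℚ) (e : ℕ → ℚ)
    (hopt : ∀ W : α → ℚ, (∀ k ∈ R, W (q k) = w (y k) + w (z k) - 16 - e k) →
      (∀ c, (∀ k ∈ R, c ≠ q k) → W c = w c) →
      ∀ S : Finset α, S ⊆ M → (∀ c ∈ S, 0 ≤ v c) → (∀ c ∈ S, ∀ k ∈ R, c ≠ p k) → ∑ c ∈ S, v c ≤ 1 →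
      (∀ c ∈ S, ∃ y' ∈ S, ∃ z' ∈ S, y' ≠ c ∧ z' ≠ c ∧ y' ≠ z') →
      ∑ c ∈ S, W c ≤ 88)
    (hffd : ∑ k ∈ K \ R, (72 - ((L k).map w).sum) + ∑ k ∈ R, e k < w x) : False := by
  classical
  set W0 : α → ℚ := fun c => if hq : ∃ k, k ∈ R ∧ c = q k then
    w (y hq.choose) + w (z hq.choose) - 16 - e hq.choose else w c with hW0
  have W0q : ∀ k ∈ R, W0 (q k) = w (y k) + w (z k) - 16 - e k := by
    intro k hk
    have hq : ∃ k', k' ∈ R ∧ q k = q k' := ⟨k, hk, rfl⟩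
    have e1 : hq.choose = k := (r.q_inj h hk hq.choose_spec.1 hq.choose_spec.2).symm
    simp only [hW0]; rw [dif_pos hq, e1]
  have W0n : ∀ c, (∀ k ∈ R, c ≠ q k) → W0 c = w c := by
    intro c hcq
    have hq : ¬ ∃ k, k ∈ R ∧ c = q k := by push Not; exact hcq
    simp only [hW0]; rw [dif_neg hq]
  set W : α → ℚ := fun c => if hp : ∃ k, k ∈ R ∧ c = p k then
    88 - w (y hp.choose) - w (z hp.choose) else W0 c with hW
  have Wp : ∀ k ∈ R, W (p k) = 88 - w (y k) - w (z k) := by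
    intro k hk
    have hq : ∃ k', k' ∈ R ∧ p k = p k' := ⟨k, hk, rfl⟩
    have e1 : hq.choose = k := (r.p_inj h hk hq.choose_spec.1 hq.choose_spec.2).symm
    simp only [hW]; rw [dif_pos hq, e1]
  have Wn : ∀ c, (∀ k ∈ R, c ≠ p k) → W c = W0 c := by
    intro c hcq
    have hq : ¬ ∃ k, k ∈ R ∧ c = p k := by push Not; exact hcq
    simp only [hW]; rw [dif_neg hq]
  have Ww : ∀ c, (∀ k ∈ R, c ≠ p k) → (∀ k ∈ R, c ≠ q k) → W c = w c := fun c h1 h2 => by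
    rw [Wn c h1, W0n c h2]
  refine fw h hc W ?_ ?_
  · intro j hj
    by_cases hex : ∃ k ∈ R, P (p k) = j
    · obtain ⟨k, hk, rfl⟩ := hex
      rw [r.bin k hk, sum_insert, sum_pair (r.yz k hk), Wp k hk,
        Ww (y k) (fun i hi => r.o_ne_p h hk hi (Or.inl rfl)) (fun i hi => r.o_ne_q h hR hk hi (Or.inl rfl)),
        Ww (z k) (fun i hi => r.o_ne_p h hk hi (Or.inr rfl)) (fun i hi => r.o_ne_q h hR hk hi (Or.inr rfl))]
      · linarith
      · simp only [mem_insert, mem_singleton]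
        push Not
        exact ⟨(r.yp k hk).symm, (r.zp k hk).symm⟩
    · push Not at hex
      have hnp : ∀ c ∈ ({c ∈ M | P c = j} : Finset α), ∀ k ∈ R, c ≠ p k := by
        rintro c hc k hk rfl
        exact hex k hk (mem_filter.1 hc).2
      rw [sum_congr rfl fun c hc => Wn c (hnp c hc)]
      refine hopt W0 W0q W0n _ (filter_subset _ _) (fun c hc => (h.pos (mem_filter.1 hc).1).le) hnp (h.cap j hj) ?_
      intro c hc
      obtain ⟨hcM, hcP⟩ := mem_filter.1 hc
      obtain ⟨y', z', h1, h2, h3, h4, h5, h6, h7⟩ := hR.three hcM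
      exact ⟨y', by simp [h1, h6, hcP], z', by simp [h2, h7, hcP], h3, h4, h5⟩
  · apply ffd_fw
    have hx : W x = w x := by
      apply Ww
      · intro k hk e; exact (h.sub k (r.RK k hk) _ (r.pL hk)).2 e.symm
      · intro k hk e; exact (h.sub k (r.RK k hk) _ (r.qL hk)).2 e.symm
    rw [hx]
    refine lt_of_le_of_lt (le_of_eq ?_) hffd
    rw [← sum_sdiff (show R ⊆ K from r.RK)]
    congr 1
    · refine sum_congr rfl fun k hk => ?_
      obtain ⟨hkK, hkR⟩ := mem_sdiff.1 hk
      congr 2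
      refine List.map_congr_left fun c hc => Ww c ?_ ?_
      · rintro i hi rfl
        exact hkR (h.disj k hkK i (r.RK i hi) _ hc (r.pL hi) ▸ hi)
      · rintro i hi rfl
        exact hkR (h.disj k hkK i (r.RK i hi) _ hc (r.qL hi) ▸ hi)
    · refine sum_congr rfl fun k hk => ?_
      rw [r.Lk k hk]
      simp only [List.map_cons, List.map_nil, List.sum_cons, List.sum_nil]
      rw [Wp k hk, Wn _ (fun i hi => (r.p_ne_q h hi hk).symm), W0q k hk]
      linarith

end RS
end

section
variable {v : α → ℚ} {x : α} {M : Finset α} {K : Finset ℕ} {L : ℕ → List α} {D : Finset ℕ} {P : α → ℕ}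
  {R : Finset ℕ} {p q y z : ℕ → α}

lemma abn {A B : ℚ} {v W : α → ℚ} {c : α} {a b w : ℕ} (hW : W c ≤ w) (hle : (a : ℚ) * A + b * B ≤ v c) :
    (Lv.mk a b w false).ab A B v W c := ⟨hW, hle, by simp⟩
lemma abs' {A B : ℚ} {v W : α → ℚ} {c : α} {a b w : ℕ} (hW : W c ≤ w) (hle : (a : ℚ) * A + b * B < v c) :
    (Lv.mk a b w true).ab A B v W c := ⟨hW, hle.le, fun _ => hle⟩

/-- items in the bin of the special q -/
lemma RS.special_bin (r : RS v x M K L P R p q y z) (h : Pk v x M K L D P) (hR : Red M P)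
    {k : ℕ} (hk : k ∈ R) (h1 : v (p k) ≤ 1 / 2) (h2 : v (q k) ≤ (1 - v x) / 2)
    {S : Finset α} (hSM : S ⊆ M) (hnp : ∀ c ∈ S, ∀ k ∈ R, c ≠ p k) (hS1 : ∑ c ∈ S, v c ≤ 1)
    (h3 : ∀ c ∈ S, ∃ y' ∈ S, ∃ z' ∈ S, y' ≠ c ∧ z' ≠ c ∧ y' ≠ z') (hqS : q k ∈ S) {b : α} (hb : b ∈ S)
    (hb1 : (1 - v x) / 2 < v b) (hb2 : v b ≤ 2 * v x) : ∃ j ∈ R, b = q j ∧ 1 / 2 < v (p j) := by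
  have hbq : b ≠ q k := by rintro rfl; linarith
  have hsum : v b + v (q k) + v x ≤ 1 := by
    have : ∃ c ∈ S, c ≠ b ∧ c ≠ q k := by
      obtain ⟨y', hy', z', hz', e1, e2, e3⟩ := h3 b hb
      by_cases e : y' = q k
      · exact ⟨z', hz', e2, by rintro rfl; exact e3 e⟩
      · exact ⟨y', hy', e1, e⟩
    obtain ⟨c, hc, hcb, hcq⟩ := this
    have hsub : ({b, q k, c} : Finset α) ⊆ S := by
      intro d hd; simp at hd; rcases hd with rfl | rfl | rfl <;> assumption
    have := sum_le_sum_of_subset_of_nonneg (f := v) hsub (fun c hc _ => (h.pos (hSM hc)).le)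
    rw [sum_insert (by simp; tauto), sum_pair hcq.symm] at this
    have := h.ge c (hSM hc)
    linarith
  have hpq := r.pqx h hk
  have hlt : v b < v (p k) := by linarith
  have hnrem : ¬ h.rem k b := by
    intro hrem
    have := r.fits h hR hk hrem (by linarith)
    linarith
  have : ∃ j ∈ K, j ≤ k ∧ b ∈ L j := by
    by_contra hcon
    push Not at hcon
    exact hnrem ⟨hSM hb, hcon⟩
  obtain ⟨j, hj, hjk, hbj⟩ := this
  have hjk' : j < k := by
    refine lt_of_le_of_ne hjk ?_
    rintro rfl
    rw [r.Lk j hk] at hbj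
    simp at hbj
    rcases hbj with e | e
    · exact hnp b hb j hk e
    · exact hbq e
  obtain ⟨t, s, l, hL, hst, ht, hf, hl, hg⟩ := h.two hR hj
  have htk := ht _ (h.rem_later (r.RK k hk) (r.pL hk) hjk')
  have hbs : v b ≤ v s := by
    rw [hL] at hbj
    simp only [List.mem_cons] at hbj
    rcases hbj with rfl | rfl | e
    · linarith
    · exact le_rfl
    · exact hl b e
  cases l with
  | cons d l => have := hg.1; linarith
  | nil =>
    have hbs' : b = s := by
      rw [hL] at hbj
      simp only [List.mem_cons, List.not_mem_nil, or_false] at hbj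
      rcases hbj with rfl | rfl
      · linarith
      · rfl
    subst hbs'
    have hjR : j ∈ R := by
      by_contra hjR
      have := r.compl j hj hjR t b hL (by linarith)
      linarith
    have hLj := r.Lk j hjR
    rw [hL] at hLj
    simp only [List.cons.injEq, and_true] at hLj
    obtain ⟨rfl, rfl⟩ := hLj
    refine ⟨j, hjR, rfl, ?_⟩
    by_contra hcon
    have := hf _ (h.rem_later (r.RK k hk) (r.pL hk) hjk') (by linarith)
    linarith

/-- weights for the middle case -/
def wm (v : α → ℚ) (x : α) (c : α) : ℚ :=
  if v c ≤ (1 - v x) / 3 then 18 else if v c ≤ 1 / 3 then 24 else if v c ≤ (1 - v x) / 2 then 27 else 36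

lemma mid_ffd (r : RS v x M K L P R p q y z) (h : Pk v x M K L D P) (hR : Red M P) (hx1 : 1 / 5 < v x) (hx2 : v x ≤ 1 / 4) :
    ∑ k ∈ K \ R, (72 - ((L k).map (wm v x)).sum) + ∑ k ∈ R, 0 < wm v x x := by
  have hwx : wm v x x = 18 := by unfold wm; rw [if_pos (by linarith)]
  have w1 : ∀ c, 18 ≤ wm v x c := fun c => by unfold wm; split_ifs <;> norm_num
  have w2 : ∀ c, (1 - v x) / 3 < v c → 24 ≤ wm v x c := fun c hc => by
    unfold wm; rw [if_neg (not_le.2 hc)]; split_ifs <;> norm_num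
  have w3 : ∀ c, 1 / 3 < v c → 27 ≤ wm v x c := fun c hc => by
    unfold wm; rw [if_neg (by linarith), if_neg (by linarith)]; split_ifs <;> norm_num
  have w4 : ∀ c, (1 - v x) / 2 < v c → 36 ≤ wm v x c := fun c hc => by
    unfold wm; rw [if_neg (by linarith), if_neg (by linarith), if_neg (by linarith)]
  have h0 : ∀ l : List α, 0 ≤ (l.map (wm v x)).sum := fun l =>
      List.sum_nonneg (by simp only [List.mem_map]; rintro _ ⟨c, _, rfl⟩; linarith [w1 c])
  rw [hwx, sum_const_zero, add_zero]
  set δ : ℕ → ℚ := fun k => 72 - ((L k).map (wm v x)).sum with hδ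
  change ∑ k ∈ K \ R, δ k < 18
  -- B or T tops
  have hB : ∀ k ∈ K \ R, (1 - v x) / 2 < v (tp L x k) → δ k ≤ 0 := by
    intro k hk ht
    obtain ⟨hk, hkR⟩ := mem_sdiff.1 hk
    obtain ⟨a, b, l, hL, -, -, -, hl, hg⟩ := h.two hR hk
    rw [tp_eq hL] at ht
    simp only [hδ, hL, List.map_cons, List.sum_cons]
    have := w4 a ht
    cases l with
    | nil =>
      have := r.compl k hk hkR a b hL ht
      have := w4 b (by linarith)
      simp; linarith
    | cons c l =>
      have := w1 b
      have := w1 c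
      have := h0 l
      simp only [List.map_cons, List.sum_cons]
      linarith
  -- at least three items when the top is small
  have h3 : ∀ k ∈ K, v (tp L x k) ≤ (1 - v x) / 2 → ∃ a b c l, L k = a :: b :: c :: l ∧ tp L x k = a ∧ v b ≤ v a ∧ v c ≤ v b ∧
      (∀ y, h.rem k y → v y ≤ v a) ∧ (∀ y, h.rem k y → v a + v y ≤ 1 → v y ≤ v b) ∧
      (∀ y, h.rem k y → v a + v b + v y ≤ 1 → v y ≤ v c) ∧ Gr v (v x) (h.rem k) (v a + v b + v c) l := by
    intro k hk ht
    obtain ⟨a, b, l, hL, h1, h2, h3, hl, hg⟩ := h.two hR hk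
    rw [tp_eq hL] at ht
    cases l with
    | nil => simp only [Gr] at hg; linarith
    | cons c l =>
      exact ⟨a, b, c, l, hL, tp_eq hL, h1, hl c (by simp), h2, h3, fun y hy hle => hg.2.2.1 y hy hle, hg.2.2.2⟩
  have hT : ∀ k ∈ K \ R, v (tp L x k) ≤ (1 - v x) / 3 → δ k ≤ 0 := by
    intro k hk ht
    obtain ⟨hk, hkR⟩ := mem_sdiff.1 hk
    obtain ⟨a, b, c, l, hL, hta, h1, h2, -, -, -, hg⟩ := h3 k hk (by linarith)
    rw [hta] at ht
    cases l with
    | nil => simp only [Gr] at hg; linarith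
    | cons d l =>
      simp only [hδ, hL, List.map_cons, List.sum_cons]
      have := w1 a
      have := w1 b
      have := w1 c
      have := w1 d
      have := h0 l
      linarith
  rw [← sum_filter_add_sum_filter_not (K \ R) (fun k => (1 - v x) / 2 < v (tp L x k)),
    ← sum_filter_add_sum_filter_not ((K \ R).filter (fun k => ¬ (1 - v x) / 2 < v (tp L x k))) (fun k => 1 / 3 < v (tp L x k)),
    ← sum_filter_add_sum_filter_not (((K \ R).filter (fun k => ¬ (1 - v x) / 2 < v (tp L x k))).filter (fun k => ¬ 1 / 3 < v (tp L x k)))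
      (fun k => (1 - v x) / 3 < v (tp L x k))]
  have s1 : ∑ k ∈ (K \ R).filter (fun k => (1 - v x) / 2 < v (tp L x k)), δ k ≤ 0 :=
    sum_nonpos fun k hk => hB k (mem_filter.1 hk).1 (mem_filter.1 hk).2
  have s4 : ∑ k ∈ ((((K \ R).filter (fun k => ¬ (1 - v x) / 2 < v (tp L x k))).filter (fun k => ¬ 1 / 3 < v (tp L x k)))).filter
      (fun k => ¬ (1 - v x) / 3 < v (tp L x k)), δ k ≤ 0 :=
    sum_nonpos fun k hk => hT k (by simp only [mem_filter] at hk; exact hk.1.1.1) (not_lt.1 (mem_filter.1 hk).2)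
  set KL := ((K \ R).filter (fun k => ¬ (1 - v x) / 2 < v (tp L x k))).filter (fun k => 1 / 3 < v (tp L x k)) with hKL
  set KM := (((K \ R).filter (fun k => ¬ (1 - v x) / 2 < v (tp L x k))).filter (fun k => ¬ 1 / 3 < v (tp L x k))).filter
      (fun k => (1 - v x) / 3 < v (tp L x k)) with hKM
  have mKL : ∀ k ∈ KL, k ∈ K ∧ v (tp L x k) ≤ (1 - v x) / 2 ∧ 1 / 3 < v (tp L x k) := by
    intro k hk
    simp only [hKL, mem_filter, mem_sdiff, not_lt] at hk
    exact ⟨hk.1.1.1, hk.1.2, hk.2⟩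
  have mKM : ∀ k ∈ KM, k ∈ K ∧ v (tp L x k) ≤ 1 / 3 ∧ (1 - v x) / 3 < v (tp L x k) := by
    intro k hk
    simp only [hKM, mem_filter, mem_sdiff, not_lt] at hk
    exact ⟨hk.1.1.1.1, hk.1.2, hk.2⟩
  have sM : ∑ k ∈ KM, δ k ≤ 12 := by
    have := class_sum h KM (fun k hk => (mKM k hk).1) δ ((1 - v x) / 3) (fun k hk => (mKM k hk).2.2) ?_
    · rcases this with e | ⟨k, hk, -, -, e⟩
      · linarith
      · obtain ⟨h1, h2, h4⟩ := mKM k hk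
        obtain ⟨a, b, c, l, hL, hta, -⟩ := h3 k h1 (by linarith)
        rw [hta] at h4
        have := w2 a h4
        have := w1 b
        have := w1 c
        have := h0 l
        simp only [hδ, hL, List.map_cons, List.sum_cons] at e
        simp only [hδ]
        linarith
    · intro k hk
      obtain ⟨h1, h2, h4⟩ := mKM k hk
      obtain ⟨a, b, c, l, hL, hta, hba, hcb, hf1, hf2, hf3, -⟩ := h3 k h1 (by linarith)
      rw [hta] at h2 h4
      by_cases hc : (1 - v x) / 3 < v c
      · left
        have := w2 a h4
        have := w2 b (by linarith)
        have := w2 c hc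
        have := h0 l
        simp only [hδ, hL, List.map_cons, List.sum_cons]
        linarith
      · right
        intro y hy
        have := hf1 y hy
        have := hf3 y hy (by linarith)
        linarith
  have key := class_sum h KL (fun k hk => (mKL k hk).1) δ (1 / 3) (fun k hk => (mKL k hk).2.2) ?_
  · rcases key with e | ⟨k, hk, -, -, e⟩
    · linarith
    · obtain ⟨h1, h2, h4⟩ := mKL k hk
      obtain ⟨a, b, c, l, hL, hta, hba, hcb, hf1, hf2, hf3, -⟩ := h3 k h1 (by linarith)
      have e' := e
      simp only [hδ, hL, List.map_cons, List.sum_cons] at e'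
      have hwa := w3 a (by rwa [hta] at h4)
      have := w1 c
      have := h0 l
      by_cases hb : (1 - v x) / 3 < v b
      · have := w2 b hb
        simp only [hδ] at sM s1 s4 ⊢
        linarith
      · have hKM0 : KM = ∅ := by
          rw [Finset.eq_empty_iff_forall_notMem]
          intro i hi
          obtain ⟨g1, g2, g3⟩ := mKM i hi
          have := hf2 _ (h.tp_rem g1 h1 (by linarith)) (by rw [hta] at h2; linarith)
          linarith
        have sM0 : ∑ k ∈ KM, δ k = 0 := by rw [hKM0]; simp
        have := w1 b
        simp only [hδ] at sM0 s1 s4 ⊢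
        linarith
  · intro k hk
    obtain ⟨h1, h2, h4⟩ := mKL k hk
    obtain ⟨a, b, c, l, hL, hta, hba, hcb, hf1, hf2, hf3, -⟩ := h3 k h1 (by linarith)
    rw [hta] at h2 h4
    by_cases hb : 1 / 3 < v b
    · left
      have := w3 a h4
      have := w3 b hb
      have := w1 c
      have := h0 l
      simp only [hδ, hL, List.map_cons, List.sum_cons]
      linarith
    · right
      intro y hy
      have := hf1 y hy
      have := hf2 y hy (by linarith)
      linarith

/-- levels -/
def lvA : List Lv := [⟨24, 30, 18, false⟩, ⟨32, 30, 26, true⟩, ⟨48, 45, 36, true⟩]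
def lvA' : List Lv := [⟨24, 30, 18, false⟩, ⟨32, 30, 26, true⟩, ⟨48, 60, 36, true⟩]
def lvB : List Lv := [⟨24, 30, 18, false⟩, ⟨32, 30, 24, true⟩, ⟨40, 40, 27, true⟩, ⟨48, 45, 36, true⟩]
def lvB' : List Lv := [⟨24, 30, 18, false⟩, ⟨32, 30, 24, true⟩, ⟨40, 40, 27, true⟩, ⟨48, 60, 36, true⟩]
def lvC : List Lv := [⟨24, 30, 20, false⟩, ⟨48, 45, 36, true⟩]
lemma chkA : chk 30 lvA false 120 120 0 = true := by decide +kernel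
lemma chkA' : chk1 30 ⟨40, 30, 32, true⟩ lvA' false 120 120 0 = true := by decide +kernel
lemma chkB : chk 30 lvB false 120 120 0 = true := by decide +kernel
lemma chkB1 : chk1 30 ⟨40, 40, 32, true⟩ lvB' false 120 120 0 = true := by decide +kernel
lemma chkB2 : chk1 30 ⟨48, 40, 35, true⟩ lvB' false 120 120 0 = true := by decide +kernel
lemma chkC : chk 30 lvC false 120 120 0 = true := by decide +kernel
end

section
variable {v : α → ℚ} {x : α} {M : Finset α} {K : Finset ℕ} {L : ℕ → List α} {D : Finset ℕ} {P : α → ℕ}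
  {R : Finset ℕ} {p q y z : ℕ → α}

lemma mid_case (r : RS v x M K L P R p q y z) (h : Pk v x M K L D P) (hR : Red M P)
    (hc : 11 * D.card ≤ 9 * K.card) (hx1 : 1 / 5 < v x) (hx2 : v x ≤ 1 / 4) : False := by
  refine r.fwR h hR hc (wm v x) (fun _ => 0) ?_ (mid_ffd r h hR hx1 hx2)
  intro W Wq Wn S hSM hS0 hnp hS1 h3
  have hA : 0 ≤ (1 - 4 * v x) / 24 := by linarith
  have hB : 0 < (5 * v x - 1) / 30 := by linarith
  have hbd : bd false (∑ c ∈ S, v c) ((120 : ℕ) * ((1 - 4 * v x) / 24) + (120 : ℕ) * ((5 * v x - 1) / 30)) := by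
    refine ⟨?_, by simp⟩
    push_cast; linarith
  -- weights upper
  have u1 : ∀ c, v c ≤ (1 - v x) / 3 → wm v x c = 18 := fun c hc => by unfold wm; rw [if_pos hc]
  have u2 : ∀ c, v c ≤ 1 / 3 → wm v x c ≤ 24 := fun c hc => by unfold wm; split_ifs <;> norm_num
  have u3 : ∀ c, v c ≤ (1 - v x) / 2 → wm v x c ≤ 27 := fun c hc => by unfold wm; split_ifs <;> norm_num
  have u4 : ∀ c, wm v x c ≤ 36 := fun c => by unfold wm; split_ifs <;> norm_num
  have hge : ∀ c ∈ S, v x ≤ v c := fun c hc => h.ge c (hSM hc)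
  have hoW : ∀ k ∈ R, v (y k) ≤ (1 - v x) / 2 ∧ v (z k) ≤ (1 - v x) / 2 ∧ v x ≤ v (y k) ∧ v x ≤ v (z k) := fun k hk =>
    ⟨r.o_small h hk (Or.inl rfl), r.o_small h hk (Or.inr rfl), h.ge _ (r.yM hk).1, h.ge _ (r.zM hk).1⟩
  have hF4 : ∀ c ∈ M, (∀ k ∈ R, c ≠ q k) → v c ≤ (1 - v x) / 2 → ∀ i ∈ R, v c ≤ v (q i) := fun c hc hq hc2 i hi =>
    r.F4 h hR hc hq hc2 (by linarith) hi
  have hF4o : ∀ k ∈ R, ∀ i ∈ R, v (y k) ≤ v (q i) ∧ v (z k) ≤ v (q i) := fun k hk i hi =>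
    ⟨hF4 _ (r.yM hk).1 (fun j hj => r.o_ne_q h hR hk hj (Or.inl rfl)) (hoW k hk).1 i hi,
      hF4 _ (r.zM hk).1 (fun j hj => r.o_ne_q h hR hk hj (Or.inr rfl)) (hoW k hk).2.1 i hi⟩
  -- G-p bound
  have hG : ∀ k ∈ R, 1 / 2 < v (p k) → W (q k) ≤ 26 := by
    intro k hk hpk
    have h1 := r.pyz h hk
    obtain ⟨-, -, h2, h4⟩ := hoW k hk
    rw [Wq k hk]
    by_cases e : v (y k) ≤ (1 - v x) / 3
    · have := u1 _ e
      have := u2 (z k) (by linarith)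
      linarith
    · have := u1 (z k) (by linarith)
      have := u2 (y k) (by linarith)
      linarith
  -- special bin
  have hsp : ∀ k ∈ R, v (p k) ≤ 1 / 2 → v (q k) ≤ (1 - v x) / 2 → q k ∈ S → ∀ c ∈ S, (1 - v x) / 2 < v c →
      W c ≤ 26 ∨ (2 * v x < v c ∧ W c ≤ 36) := by
    intro k hk h1 h2 hqS c hcS hc1
    by_cases hc2 : v c ≤ 2 * v x
    · left
      obtain ⟨j, hj, rfl, hpj⟩ := r.special_bin h hR hk h1 h2 hSM hnp hS1 h3 hqS hcS hc1 hc2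
      exact hG j hj hpj
    · right
      refine ⟨not_le.1 hc2, ?_⟩
      rw [Wn c (by rintro i hi rfl; exact hc2 (r.qx i hi))]
      exact u4 c
  by_cases hC : ∃ i ∈ R, v (q i) ≤ (1 - v x) / 3
  · -- scenario C
    obtain ⟨i, hi, hqi⟩ := hC
    have := chk_sound hA hB _ _ _ _ _ _ chkC S hS0 (W := W) ?_ hbd
    · simpa using this
    intro c hcS
    have hcM := hSM hcS
    have hge := hge c hcS
    by_cases hq : ∃ k ∈ R, c = q k
    · obtain ⟨k, hk, rfl⟩ := hq
      refine ⟨⟨24, 30, 20, false⟩, by simp [lvC], abn ?_ (by push_cast; linarith)⟩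
      rw [Wq k hk, u1 _ ((hF4o k hk i hi).1.trans hqi), u1 _ ((hF4o k hk i hi).2.trans hqi)]
      norm_num
    · push Not at hq
      have hw := Wn c hq
      by_cases hcB : v c ≤ (1 - v x) / 2
      · refine ⟨⟨24, 30, 20, false⟩, by simp [lvC], abn ?_ (by push_cast; linarith)⟩
        rw [hw, u1 _ ((hF4 c hcM hq hcB i hi).trans hqi)]
        norm_num
      · refine ⟨⟨48, 45, 36, true⟩, by simp [lvC], abs' ?_ (by push_cast; linarith)⟩
        rw [hw]; exact_mod_cast u4 c
  push Not at hC
  by_cases hAs : ∃ i ∈ R, v (q i) ≤ 1 / 3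
  · -- scenario A
    obtain ⟨i, hi, hqi⟩ := hAs
    have hN : ∀ c ∈ S, (∀ k ∈ R, c ≠ q k) → v c ≤ (1 - v x) / 2 →
        ∃ t ∈ ([⟨24, 30, 18, false⟩, ⟨32, 30, 26, true⟩] : List Lv), t.ab ((1 - 4 * v x) / 24) ((5 * v x - 1) / 30) v W c := by
      intro c hcS hq hcB
      have hge := hge c hcS
      have hw := Wn c hq
      by_cases e : v c ≤ (1 - v x) / 3
      · refine ⟨⟨24, 30, 18, false⟩, by simp, abn ?_ (by push_cast; linarith)⟩
        rw [hw, u1 c e]; norm_num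
      · refine ⟨⟨32, 30, 26, true⟩, by simp, abs' ?_ (by push_cast; linarith)⟩
        rw [hw]
        have := u2 c ((hF4 c (hSM hcS) hq hcB i hi).trans hqi)
        push_cast; linarith
    have hQ : ∀ k ∈ R, W (q k) ≤ 26 ∨ ((1 - v x) / 3 < v (y k) ∧ (1 - v x) / 3 < v (z k) ∧ W (q k) ≤ 32) := by
      intro k hk
      rw [Wq k hk]
      have h1 := u2 (y k) ((hF4o k hk i hi).1.trans hqi)
      have h2 := u2 (z k) ((hF4o k hk i hi).2.trans hqi)
      by_cases e : v (y k) ≤ (1 - v x) / 3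
      · left; have := u1 _ e; linarith
      · by_cases e' : v (z k) ≤ (1 - v x) / 3
        · left; have := u1 _ e'; linarith
        · right; exact ⟨not_le.1 e, not_le.1 e', by linarith⟩
    by_cases hspec : ∃ k ∈ R, q k ∈ S ∧ v (q k) ≤ (1 - v x) / 2 ∧ (1 - v x) / 3 < v (y k) ∧ (1 - v x) / 3 < v (z k)
    · obtain ⟨k, hk, hqS, hq1, hy, hz⟩ := hspec
      have hpk : v (p k) ≤ 1 / 2 := by have := r.pyz h hk; linarith
      have hyzq := r.yzq h hk
      have hab : (Lv.mk 40 30 32 true).ab ((1 - 4 * v x) / 24) ((5 * v x - 1) / 30) v W (q k) := by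
        refine abs' ?_ (by push_cast; linarith)
        rcases hQ k hk with e | e
        · push_cast; linarith
        · exact_mod_cast e.2.2
      have := chk1_sound hA hB chkA' (S := S) hqS hab hS0 ?_ hbd
      · simpa using this
      intro c hcS hck
      by_cases hcB : v c ≤ (1 - v x) / 2
      · by_cases hq : ∃ j ∈ R, c = q j
        · obtain ⟨j, hj, rfl⟩ := hq
          have hCj := hC j hj
          refine ⟨⟨32, 30, 26, true⟩, by simp [lvA'], abs' ?_ (by push_cast; linarith)⟩
          rcases hQ j hj with e | e
          · exact_mod_cast e
          · exfalso
            have hpj : v (p j) ≤ 1 / 2 := by have := r.pyz h hj; linarith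
            have := r.special_unique h hR hk hj hpk hq1 hpj hcB
            exact hck (by rw [this])
        · push Not at hq
          obtain ⟨t, ht, hab⟩ := hN c hcS hq hcB
          exact ⟨t, by simp [lvA'] at ht ⊢; tauto, hab⟩
      · rcases hsp k hk hpk hq1 hqS c hcS (not_le.1 hcB) with e | ⟨e1, e2⟩
        · exact ⟨⟨32, 30, 26, true⟩, by simp [lvA'], abs' (by exact_mod_cast e) (by push_cast; linarith)⟩
        · exact ⟨⟨48, 60, 36, true⟩, by simp [lvA'], abs' (by exact_mod_cast e2) (by push_cast; linarith)⟩
    · push Not at hspec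
      have := chk_sound hA hB _ _ _ _ _ _ chkA S hS0 (W := W) ?_ hbd
      · simpa using this
      intro c hcS
      by_cases hcB : v c ≤ (1 - v x) / 2
      · by_cases hq : ∃ j ∈ R, c = q j
        · obtain ⟨j, hj, rfl⟩ := hq
          have hCj := hC j hj
          refine ⟨⟨32, 30, 26, true⟩, by simp [lvA], abs' ?_ (by push_cast; linarith)⟩
          rcases hQ j hj with e | e
          · exact_mod_cast e
          · exfalso
            have := hspec j hj hcS hcB e.1
            linarith [e.2.1]
        · push Not at hq
          obtain ⟨t, ht, hab⟩ := hN c hcS hq hcB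
          exact ⟨t, by simp [lvA] at ht ⊢; tauto, hab⟩
      · refine ⟨⟨48, 45, 36, true⟩, by simp [lvA], abs' ?_ (by push_cast; linarith)⟩
        by_cases hq : ∃ j ∈ R, c = q j
        · obtain ⟨j, hj, rfl⟩ := hq
          rcases hQ j hj with e | e
          · push_cast; linarith
          · push_cast; linarith [e.2.2]
        · push Not at hq
          rw [Wn c hq]; exact_mod_cast u4 c
  push Not at hAs
  -- scenario B
  have hN : ∀ c ∈ S, (∀ k ∈ R, c ≠ q k) → v c ≤ (1 - v x) / 2 →
      ∃ t ∈ ([⟨24, 30, 18, false⟩, ⟨32, 30, 24, true⟩, ⟨40, 40, 27, true⟩] : List Lv), t.ab ((1 - 4 * v x) / 24) ((5 * v x - 1) / 30) v W c := by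
    intro c hcS hq hcB
    have hge := hge c hcS
    have hw := Wn c hq
    by_cases e : v c ≤ (1 - v x) / 3
    · refine ⟨⟨24, 30, 18, false⟩, by simp, abn ?_ (by push_cast; linarith)⟩
      rw [hw, u1 c e]; norm_num
    · by_cases e' : v c ≤ 1 / 3
      · refine ⟨⟨32, 30, 24, true⟩, by simp, abs' ?_ (by push_cast; linarith)⟩
        rw [hw]; exact_mod_cast u2 c e'
      · refine ⟨⟨40, 40, 27, true⟩, by simp, abs' ?_ (by push_cast; linarith)⟩
        rw [hw]; exact_mod_cast u3 c hcB
  have hQ : ∀ k ∈ R, W (q k) ≤ 26 ∨ (W (q k) ≤ 32 ∧ v (p k) ≤ 1 / 2) ∨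
      (2 / 3 - 4 / 3 * v x < v (q k) ∧ W (q k) ≤ 35 ∧ v (p k) ≤ 1 / 2) := by
    intro k hk
    by_cases hpk : v (p k) ≤ 1 / 2
    swap
    · left; exact hG k hk (not_le.1 hpk)
    have hyzq := r.yzq h hk
    have hpyz := r.pyz h hk
    have hpB := r.pB k hk
    obtain ⟨h1, h2, h4, h5⟩ := hoW k hk
    rw [Wq k hk]
    have a1 := u3 _ h1
    have a2 := u3 _ h2
    by_cases e : v (y k) ≤ 1 / 3
    · by_cases e' : v (z k) ≤ 1 / 3
      · right; left; have := u2 _ e; have := u2 _ e'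
        exact ⟨by linarith, hpk⟩
      · by_cases e2 : v (y k) ≤ (1 - v x) / 3
        · right; left; have := u1 _ e2
          exact ⟨by linarith, hpk⟩
        · right; right; have := u2 _ e
          exact ⟨by linarith, by linarith, hpk⟩
    · by_cases e' : v (z k) ≤ 1 / 3
      · by_cases e2 : v (z k) ≤ (1 - v x) / 3
        · right; left; have := u1 _ e2
          exact ⟨by linarith, hpk⟩
        · right; right; have := u2 _ e'
          exact ⟨by linarith, by linarith, hpk⟩
      · linarith
  by_cases hspec : ∃ k ∈ R, q k ∈ S ∧ v (q k) ≤ (1 - v x) / 2 ∧ v (p k) ≤ 1 / 2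
  · obtain ⟨k, hk, hqS, hq1, hpk⟩ := hspec
    have hqk := hAs k hk
    have hrest : ∀ c' ∈ S, c' ≠ q k → ∃ t ∈ lvB', t.ab ((1 - 4 * v x) / 24) ((5 * v x - 1) / 30) v W c' := by
      intro c hcS hck
      by_cases hcB : v c ≤ (1 - v x) / 2
      · by_cases hq : ∃ j ∈ R, c = q j
        · obtain ⟨j, hj, rfl⟩ := hq
          have hCj := hAs j hj
          refine ⟨⟨40, 40, 27, true⟩, by simp [lvB'], abs' ?_ (by push_cast; linarith)⟩
          have hpj : 1 / 2 < v (p j) := by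
            by_contra hcon
            have := r.special_unique h hR hk hj hpk hq1 (not_lt.1 hcon) hcB
            exact hck (by rw [this])
          have := hG j hj hpj
          push_cast; linarith
        · push Not at hq
          obtain ⟨t, ht, hab⟩ := hN c hcS hq hcB
          exact ⟨t, by simp [lvB'] at ht ⊢; tauto, hab⟩
      · rcases hsp k hk hpk hq1 hqS c hcS (not_le.1 hcB) with e | ⟨e1, e2⟩
        · exact ⟨⟨40, 40, 27, true⟩, by simp [lvB'], abs' (by push_cast; linarith) (by push_cast; linarith)⟩
        · exact ⟨⟨48, 60, 36, true⟩, by simp [lvB'], abs' (by exact_mod_cast e2) (by push_cast; linarith)⟩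
    have h12 : W (q k) ≤ 32 ∨ (2 / 3 - 4 / 3 * v x < v (q k) ∧ W (q k) ≤ 35) := by
      rcases hQ k hk with e | e | e
      · left; linarith
      · left; exact e.1
      · right; exact ⟨e.1, e.2.1⟩
    rcases h12 with e | ⟨e1, e2⟩
    · have := chk1_sound hA hB chkB1 (S := S) hqS (abs' (by exact_mod_cast e) (by push_cast; linarith)) hS0 hrest hbd
      simpa using this
    · have := chk1_sound hA hB chkB2 (S := S) hqS (abs' (by exact_mod_cast e2) (by push_cast; linarith)) hS0 hrest hbd
      simpa using this
  · push Not at hspec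
    have := chk_sound hA hB _ _ _ _ _ _ chkB S hS0 (W := W) ?_ hbd
    · simpa using this
    intro c hcS
    by_cases hcB : v c ≤ (1 - v x) / 2
    · by_cases hq : ∃ j ∈ R, c = q j
      · obtain ⟨j, hj, rfl⟩ := hq
        have hCj := hAs j hj
        refine ⟨⟨40, 40, 27, true⟩, by simp [lvB], abs' ?_ (by push_cast; linarith)⟩
        have := hG j hj (hspec j hj hcS hcB)
        push_cast; linarith
      · push Not at hq
        obtain ⟨t, ht, hab⟩ := hN c hcS hq hcB
        exact ⟨t, by simp [lvB] at ht ⊢; tauto, hab⟩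
    · refine ⟨⟨48, 45, 36, true⟩, by simp [lvB], abs' ?_ (by push_cast; linarith)⟩
      by_cases hq : ∃ j ∈ R, c = q j
      · obtain ⟨j, hj, rfl⟩ := hq
        rcases hQ j hj with e | e | e
        · push_cast; linarith
        · push_cast; linarith [e.1]
        · push_cast; linarith [e.2.1]
      · push Not at hq
        rw [Wn c hq]; exact_mod_cast u4 c
end


/-- level of a combined small item -/
def cmb (e : ℕ) (t1 t2 : Lv) : Lv := ⟨t1.a + t2.a - 24, t1.b + t2.b - 12, t1.w + t2.w - 16 - e, true⟩
/-- infeasible triple -/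
def inf3 (a b : ℕ) (t1 t2 : Lv) : Bool := decide (132 ≤ a + t1.a + t2.a) && decide (60 ≤ b + t1.b + t2.b)
/-- dominated level -/
def dom (ls : List Lv) (t : Lv) : Bool := ls.any fun s => decide (s.a ≤ t.a) && decide (s.b ≤ t.b) && decide (t.w ≤ s.w)
/-- all pairs are dominated -/
def okG (a b : ℕ) (ba bb : ℕ) (ls N : List Lv) : Bool :=
  N.all fun t1 => N.all fun t2 => inf3 a b t1 t2 || dom ls (cmb 0 t1 t2) || dom ls ⟨ba, bb, t1.w + t2.w - 16, true⟩
/-- all pairs as starts -/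
def okS (a b : ℕ) (ba bb e : ℕ) (ls N : List Lv) : Bool :=
  N.all fun t1 => N.all fun t2 => inf3 a b t1 t2 || chk1 40 (cmb e t1 t2) ls false 132 60 0 ||
    chk1 40 ⟨ba, bb, t1.w + t2.w - 16 - e, true⟩ ls false 132 60 0

/-- levels -/
def nB : List Lv := [⟨24, 12, 17, false⟩, ⟨27, 12, 18, true⟩, ⟨33, 15, 19, true⟩, ⟨36, 16, 24, true⟩, ⟨39, 17, 25, true⟩,
  ⟨42, 18, 26, true⟩, ⟨44, 20, 29, true⟩, ⟨45, 20, 30, true⟩]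
def kB : List Lv := nB ++ [⟨48, 24, 34, true⟩, ⟨54, 24, 36, true⟩, ⟨66, 30, 38, true⟩]
lemma kB0 : chk 40 kB false 132 60 0 = true := by decide +kernel
lemma kB1 : okG 66 30 44 20 kB nB = true := by decide +kernel
lemma kB2 : okS 54 24 44 20 2 kB nB = true := by decide +kernel

def nA : List Lv := [⟨24, 12, 17, false⟩, ⟨27, 12, 18, true⟩, ⟨33, 15, 19, true⟩, ⟨36, 16, 24, true⟩, ⟨42, 18, 26, true⟩]
def bigs : List Lv := [⟨36, 16, 24, true⟩, ⟨42, 18, 26, true⟩, ⟨48, 24, 34, true⟩, ⟨54, 24, 36, true⟩, ⟨66, 30, 38, true⟩]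
def qA : List Lv := [⟨36, 16, 25, true⟩, ⟨39, 16, 26, true⟩]
def kA1 : List Lv := [⟨24, 12, 17, false⟩, ⟨27, 12, 18, true⟩] ++ bigs ++ qA
def kA2 : List Lv := [⟨24, 12, 17, false⟩, ⟨33, 15, 19, true⟩] ++ bigs ++ qA
def kA3 : List Lv := [⟨24, 12, 17, false⟩, ⟨27, 12, 18, true⟩, ⟨33, 15, 19, true⟩] ++ bigs
lemma kAq : okG 66 30 36 16 qA nA = true := by decide +kernel
lemma kA10 : chk 40 kA1 false 132 60 0 = true := by decide +kernel
lemma kA1s : okS 54 24 36 16 2 kA1 nA = true := by decide +kernel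
lemma kA20 : chk 40 kA2 false 132 60 0 = true := by decide +kernel
lemma kA2s : okS 54 24 36 16 2 kA2 nA = true := by decide +kernel
lemma kA30 : chk 40 kA3 false 132 60 0 = true := by decide +kernel
lemma kA3s : okS 54 24 36 16 2 kA3 nA = true := by decide +kernel
lemma kA3q : chk1 40 ⟨36, 16, 25, true⟩ kA3 false 132 60 0 = true ∧ chk1 40 ⟨39, 16, 26, true⟩ kA3 false 132 60 0 = true := by decide +kernel

def nC : List Lv := [⟨24, 12, 16, false⟩, ⟨27, 12, 18, true⟩, ⟨33, 15, 19, true⟩]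
def kC : List Lv := [⟨24, 12, 16, false⟩, ⟨27, 12, 18, true⟩, ⟨33, 15, 19, true⟩, ⟨48, 24, 34, true⟩, ⟨54, 24, 36, true⟩, ⟨66, 30, 40, true⟩,
   ⟨30, 12, 20, true⟩, ⟨36, 15, 21, true⟩, ⟨42, 18, 22, true⟩]
lemma kC0 : chk 40 kC false 132 60 0 = true := by decide +kernel
lemma kCq : okG 54 24 24 12 kC nC = true := by decide +kernel

section
variable {v : α → ℚ} {x : α} {M : Finset α} {K : Finset ℕ} {L : ℕ → List α} {D : Finset ℕ} {P : α → ℕ}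
  {R : Finset ℕ} {p q y z : ℕ → α}

lemma Pk.i3 (h : Pk v x M K L D P) (hR : Red M P) {k : ℕ} (hk : k ∈ K) (ht : v (tp L x k) ≤ (1 - v x) / 2) :
    ∃ a b c l, L k = a :: b :: c :: l ∧ tp L x k = a ∧ v b ≤ v a ∧ v c ≤ v b ∧
      (∀ y, h.rem k y → v y ≤ v a) ∧ (∀ y, h.rem k y → v a + v y ≤ 1 → v y ≤ v b) ∧
      (∀ y, h.rem k y → v a + v b + v y ≤ 1 → v y ≤ v c) ∧ Gr v (v x) (h.rem k) (v a + v b + v c) l ∧ ∀ d ∈ l, v d ≤ v c := by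
  obtain ⟨a, b, l, hL, h1, h2, h3, hl, hg⟩ := h.two hR hk
  rw [tp_eq hL] at ht
  cases l with
  | nil => simp only [Gr] at hg; linarith
  | cons c l =>
    exact ⟨a, b, c, l, hL, tp_eq hL, h1, hl c (by simp), h2, h3, fun y hy hle => hg.2.2.1 y hy hle, hg.2.2.2, hg.2.1⟩

lemma Pk.i4 (h : Pk v x M K L D P) (hR : Red M P) {k : ℕ} (hk : k ∈ K) (ht : v (tp L x k) ≤ (1 - v x) / 3) :
    ∃ a b c d l, L k = a :: b :: c :: d :: l ∧ tp L x k = a ∧ v b ≤ v a ∧ v c ≤ v b ∧ v d ≤ v c ∧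
      (∀ y, h.rem k y → v y ≤ v a) ∧ (∀ y, h.rem k y → v a + v y ≤ 1 → v y ≤ v b) ∧
      (∀ y, h.rem k y → v a + v b + v y ≤ 1 → v y ≤ v c) ∧
      (∀ y, h.rem k y → v a + v b + v c + v y ≤ 1 → v y ≤ v d) ∧
      Gr v (v x) (h.rem k) (v a + v b + v c + v d) l := by
  have hx1 := h.ge _ (h.sub k hk _ (h.tp_mem hk)).1
  obtain ⟨a, b, c, l, hL, h1, h2, h3, h4, h5, h6, hg, hl⟩ := h.i3 hR hk (by linarith [h.xpos])
  rw [h1] at ht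
  cases l with
  | nil => simp only [Gr] at hg; linarith
  | cons d l =>
    exact ⟨a, b, c, d, l, hL, h1, h2, h3, hl d (by simp), h4, h5, h6, fun y hy hle => hg.2.2.1 y hy hle, hg.2.2.2⟩

/-- deficit -/
def dl (L : ℕ → List α) (w : α → ℚ) (k : ℕ) : ℚ := 72 - ((L k).map w).sum

lemma wsum_nonneg {w : α → ℚ} {u : ℚ} (hu : 0 ≤ u) (w1 : ∀ c, u ≤ w c) (l : List α) : 0 ≤ (l.map w).sum :=
  List.sum_nonneg (by simp only [List.mem_map]; rintro _ ⟨c, _, rfl⟩; linarith [w1 c])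

/-- big tops -/
lemma ffd_top (r : RS v x M K L P R p q y z) (h : Pk v x M K L D P) (hR : Red M P) (hx2 : v x ≤ 1 / 5)
    {w : α → ℚ} {u : ℚ} (hu : 0 ≤ u) (hu' : u ≤ 17)
    (w1 : ∀ c, u ≤ w c) (w5 : ∀ c, 2 * v x < v c → 34 ≤ w c) (w6 : ∀ c, (1 - v x) / 2 < v c → 36 ≤ w c)
    (w7 : ∀ c, 1 / 2 < v c → 72 - 2 * u ≤ w c) :
    ∑ k ∈ K \ R with (1 - v x) / 2 < v (tp L x k), dl L w k ≤ 36 - 2 * u ∧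
    ((∃ k ∈ R, v (p k) ≤ 1 / 2) → ∑ k ∈ K \ R with (1 - v x) / 2 < v (tp L x k), dl L w k ≤ 0) := by
  have hG : ∀ k ∈ K \ R, 1 / 2 < v (tp L x k) → dl L w k ≤ 0 := by
    intro k hk ht
    obtain ⟨hk, hkR⟩ := mem_sdiff.1 hk
    obtain ⟨a, b, l, hL, -, -, -, hl, hg⟩ := h.two hR hk
    rw [tp_eq hL] at ht
    simp only [dl, hL, List.map_cons, List.sum_cons]
    have := w7 a ht
    cases l with
    | nil =>
      have := r.compl k hk hkR a b hL (by linarith [h.xpos])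
      have := w5 b (by linarith)
      simp; linarith
    | cons c l =>
      have := w1 b
      have := w1 c
      have := wsum_nonneg hu w1 l
      simp only [List.map_cons, List.sum_cons]
      linarith
  have hB : ∀ k ∈ K \ R, (1 - v x) / 2 < v (tp L x k) → v (tp L x k) ≤ 1 / 2 →
      dl L w k ≤ 36 - 2 * u ∧ (dl L w k ≤ 0 ∨ ∀ y, h.rem k y → v y ≤ (1 - v x) / 2) := by
    intro k hk ht ht2
    obtain ⟨hk, hkR⟩ := mem_sdiff.1 hk
    obtain ⟨a, b, l, hL, hba, h1, h2, hl, hg⟩ := h.two hR hk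
    rw [tp_eq hL] at ht ht2
    have := w6 a ht
    have h0 := wsum_nonneg hu w1
    constructor
    · cases l with
      | nil =>
        have := r.compl k hk hkR a b hL ht
        have := w5 b (by linarith)
        simp only [dl, hL, List.map_cons, List.sum_cons, List.map_nil, List.sum_nil]
        linarith
      | cons c l =>
        have := w1 b
        have := w1 c
        have := h0 l
        simp only [dl, hL, List.map_cons, List.sum_cons]
        linarith
    · by_cases hb : (1 - v x) / 2 < v b
      · left
        have := w6 b hb
        have := h0 l
        simp only [dl, hL, List.map_cons, List.sum_cons]
        linarith
      · right
        intro y hy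
        have := h1 y hy
        have := h2 y hy (by linarith)
        linarith
  rw [← sum_filter_add_sum_filter_not ((K \ R).filter (fun k => (1 - v x) / 2 < v (tp L x k))) (fun k => 1 / 2 < v (tp L x k))]
  have s1 : ∑ k ∈ ((K \ R).filter (fun k => (1 - v x) / 2 < v (tp L x k))).filter (fun k => 1 / 2 < v (tp L x k)), dl L w k ≤ 0 :=
    sum_nonpos fun k hk => by
      simp only [mem_filter] at hk
      exact hG k hk.1.1 hk.2
  set KB := ((K \ R).filter (fun k => (1 - v x) / 2 < v (tp L x k))).filter (fun k => ¬ 1 / 2 < v (tp L x k)) with hKB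
  have mKB : ∀ k ∈ KB, k ∈ K \ R ∧ (1 - v x) / 2 < v (tp L x k) ∧ v (tp L x k) ≤ 1 / 2 := by
    intro k hk
    simp only [hKB, mem_filter, not_lt] at hk
    exact ⟨hk.1.1, hk.1.2, hk.2⟩
  have key := class_sum h KB (fun k hk => (mem_sdiff.1 (mKB k hk).1).1) (dl L w) ((1 - v x) / 2) (fun k hk => (mKB k hk).2.1)
    (fun k hk => (hB k (mKB k hk).1 (mKB k hk).2.1 (mKB k hk).2.2).2)
  constructor
  · rcases key with e | ⟨k, hk, -, -, e⟩
    · linarith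
    · have := (hB k (mKB k hk).1 (mKB k hk).2.1 (mKB k hk).2.2).1
      linarith
  · rintro ⟨i, hi, hpi⟩
    rcases key with e | ⟨k, hk, e1, e2, e⟩
    · linarith
    · exfalso
      obtain ⟨g1, g2, g3⟩ := mKB k hk
      obtain ⟨hkK, hkR⟩ := mem_sdiff.1 g1
      have hpB := r.pB i hi
      rcases lt_trichotomy i k with o | o | o
      · have := r.fits h hR hi (h.rem_later hkK (h.tp_mem hkK) o) (by linarith)
        have := r.qx i hi
        linarith
      · exact hkR (o ▸ hi)
      · have := e1 _ (h.rem_later (r.RK i hi) (r.pL hi) o)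
        linarith

/-- L and M tops -/
lemma ffd_LM (h : Pk v x M K L D P) (hR : Red M P) (hx1 : 2 / 11 < v x) (hx2 : v x ≤ 1 / 5)
    {w : α → ℚ} {u DM : ℚ} (hu : 16 ≤ u) (hDM : 0 ≤ DM)
    (w1 : ∀ c, u ≤ w c) (w2 : ∀ c, (1 - v x) / 3 < v c → 24 ≤ w c) (w3 : ∀ c, 1 / 3 < v c → 29 ≤ w c)
    (H1 : ∀ k ∈ K \ R, ∀ a b c l, L k = a :: b :: c :: l → 1 / 3 < v a → v a ≤ (1 - v x) / 2 → v c ≤ v b → v b ≤ 1 / 3 →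
      1 < v a + v b + (c :: l |>.map v).sum + v x → dl L w k ≤ DM)
    (H2 : ∀ k ∈ K \ R, ∀ j ∈ K \ R, k < j → (1 - v x) / 3 < v (tp L x j) → v (tp L x j) ≤ 1 / 3 → ∀ a b c l, L k = a :: b :: c :: l →
      1 / 3 < v a → v a ≤ (1 - v x) / 2 →
      (1 - v x) / 3 < v b → v b ≤ 1 / 3 → (∀ y, h.rem k y → v a + v b + v y ≤ 1 → v y ≤ v c) → 0 < dl L w k → dl L w k + dl L w j ≤ DM)
    (H3 : ∀ k ∈ K \ R, ∀ a b c l, L k = a :: b :: c :: l → (1 - v x) / 3 < v a → v a ≤ 1 / 3 → v b ≤ v a → v c ≤ v b →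
      v c ≤ (1 - v x) / 3 → Gr v (v x) (h.rem k) (v a + v b + v c) l → dl L w k ≤ DM) :
    ∑ k ∈ K \ R with (1 - v x) / 3 < v (tp L x k) ∧ v (tp L x k) ≤ (1 - v x) / 2, dl L w k ≤ DM := by
  have h0 := wsum_nonneg (by linarith) w1
  rw [← sum_filter_add_sum_filter_not ((K \ R).filter (fun k => (1 - v x) / 3 < v (tp L x k) ∧ v (tp L x k) ≤ (1 - v x) / 2))
    (fun k => 1 / 3 < v (tp L x k))]
  set KL := ((K \ R).filter (fun k => (1 - v x) / 3 < v (tp L x k) ∧ v (tp L x k) ≤ (1 - v x) / 2)).filter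
    (fun k => 1 / 3 < v (tp L x k)) with hKL
  set KM := ((K \ R).filter (fun k => (1 - v x) / 3 < v (tp L x k) ∧ v (tp L x k) ≤ (1 - v x) / 2)).filter
    (fun k => ¬ 1 / 3 < v (tp L x k)) with hKM
  have mKL : ∀ k ∈ KL, k ∈ K \ R ∧ v (tp L x k) ≤ (1 - v x) / 2 ∧ 1 / 3 < v (tp L x k) := by
    intro k hk
    simp only [hKL, mem_filter] at hk
    exact ⟨hk.1.1, hk.1.2.2, hk.2⟩
  have mKM : ∀ k ∈ KM, k ∈ K \ R ∧ v (tp L x k) ≤ 1 / 3 ∧ (1 - v x) / 3 < v (tp L x k) := by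
    intro k hk
    simp only [hKM, mem_filter, not_lt] at hk
    exact ⟨hk.1.1, hk.2, hk.1.2.1⟩
  have cM := class_sum h KM (fun k hk => (mem_sdiff.1 (mKM k hk).1).1) (dl L w) ((1 - v x) / 3) (fun k hk => (mKM k hk).2.2) (by
    intro k hk
    obtain ⟨h1, h2, h4⟩ := mKM k hk
    obtain ⟨a, b, c, l, hL, hta, hba, hcb, hf1, hf2, hf3, -⟩ := h.i3 hR (mem_sdiff.1 h1).1 (by linarith)
    rw [hta] at h2 h4
    by_cases hc : (1 - v x) / 3 < v c
    · left
      have := w2 a h4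
      have := w2 b (by linarith)
      have := w2 c hc
      have := h0 l
      simp only [dl, hL, List.map_cons, List.sum_cons]
      linarith
    · right
      intro y hy
      have := hf1 y hy
      have := hf3 y hy (by linarith)
      linarith)
  have cL := class_sum h KL (fun k hk => (mem_sdiff.1 (mKL k hk).1).1) (dl L w) (1 / 3) (fun k hk => (mKL k hk).2.2) (by
    intro k hk
    obtain ⟨h1, h2, h4⟩ := mKL k hk
    obtain ⟨a, b, c, l, hL, hta, hba, hcb, hf1, hf2, hf3, -⟩ := h.i3 hR (mem_sdiff.1 h1).1 (by linarith)
    rw [hta] at h2 h4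
    by_cases hb : 1 / 3 < v b
    · left
      have := w3 a h4
      have := w3 b hb
      have := w1 c
      have := h0 l
      simp only [dl, hL, List.map_cons, List.sum_cons]
      linarith
    · right
      intro y hy
      have := hf1 y hy
      have := hf2 y hy (by linarith)
      linarith)
  have sM : ∀ k ∈ KM, 0 < dl L w k → (∀ y, h.rem k y → v y ≤ (1 - v x) / 3) → dl L w k ≤ DM := by
    intro k hk hd hl
    obtain ⟨h1, h2, h4⟩ := mKM k hk
    obtain ⟨a, b, c, l, hL, hta, hba, hcb, hf1, hf2, hf3, hg, -⟩ := h.i3 hR (mem_sdiff.1 h1).1 (by linarith)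
    rw [hta] at h2 h4
    refine H3 k h1 a b c l hL h4 h2 hba hcb ?_ hg
    by_contra hc
    rw [not_le] at hc
    have := w2 a h4
    have := w2 b (by linarith)
    have := w2 c hc
    have := h0 l
    simp only [dl, hL, List.map_cons, List.sum_cons] at hd
    linarith
  have sM' : ∑ k ∈ KM, dl L w k ≤ DM := by
    rcases cM with e | ⟨k, hk, e1, e2, e3⟩
    · linarith
    · exact e3.trans (sM k hk e2 e1)
  rcases cL with e | ⟨k, hk, e1, e2, e3⟩
  · linarith
  obtain ⟨h1, h2, h4⟩ := mKL k hk
  obtain ⟨a, b, c, l, hL, hta, hba, hcb, hf1, hf2, hf3, hg, -⟩ := h.i3 hR (mem_sdiff.1 h1).1 (by linarith)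
  have hb : v b ≤ 1 / 3 := by
    by_contra hb
    rw [not_le] at hb
    have := w3 a (by rwa [hta] at h4)
    have := w3 b hb
    have := w1 c
    have := h0 l
    simp only [dl, hL, List.map_cons, List.sum_cons] at e2
    linarith
  have dk : dl L w k ≤ DM := by
    refine H1 k h1 a b c l hL (by rwa [hta] at h4) (by rwa [hta] at h2) hcb hb ?_
    have := Gr_sum _ _ _ _ _ hg
    simp only [List.map_cons, List.sum_cons]
    linarith
  by_cases hb2 : (1 - v x) / 3 < v b
  · rcases cM with e | ⟨j, hj, g1, g2, g3⟩
    · linarith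
    · have := H2 k h1 j (mKM j hj).1 (h.tp_lt (mem_sdiff.1 (mKM j hj).1).1 (mem_sdiff.1 h1).1 (by linarith [(mKM j hj).2.1]))
        (mKM j hj).2.2 (mKM j hj).2.1 a b c l hL (by rwa [hta] at h4) (by rwa [hta] at h2) hb2 hb hf3 e2
      linarith
  · have hKM0 : KM = ∅ := by
      rw [Finset.eq_empty_iff_forall_notMem]
      intro i hi
      obtain ⟨g1, g2, g3⟩ := mKM i hi
      have := hf2 _ (h.tp_rem (mem_sdiff.1 g1).1 (mem_sdiff.1 h1).1 (by linarith)) (by rw [hta] at h2; linarith)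
      linarith
    have sM0 : ∑ k ∈ KM, dl L w k = 0 := by rw [hKM0]; simp
    linarith

/-- small tops -/
lemma ffd_ST (h : Pk v x M K L D P) (hR : Red M P) (hx1 : 2 / 11 < v x) (hx2 : v x ≤ 1 / 5)
    {w : α → ℚ} {u D1 D2 D3 E : ℚ} (hu : 16 ≤ u) (hE : 0 ≤ E) (hD1 : 0 ≤ D1) (hD3 : 0 ≤ D3) (hE1 : D1 + D3 ≤ E) (hE2 : D2 ≤ E)
    (w1 : ∀ c, u ≤ w c)
    (H1 : ∀ k ∈ K \ R, ∀ a b c d l, L k = a :: b :: c :: d :: l → v a ≤ (1 - v x) / 3 → v b ≤ v a → v c ≤ v b → 1 / 4 < v c →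
      (∀ y, h.rem k y → v a + v b + v y ≤ 1 → v y ≤ v c) → dl L w k ≤ 0)
    (H2 : ∀ k ∈ K \ R, ∀ a b c d l, L k = a :: b :: c :: d :: l → v a ≤ (1 - v x) / 3 → 1 / 4 < v a → v b ≤ v a → v c ≤ v b →
      (1 - v x) / 4 < v c → v c ≤ 1 / 4 → (∀ y, h.rem k y → v a + v b + v y ≤ 1 → v y ≤ v c) → dl L w k ≤ D1)
    (H3 : ∀ k ∈ K \ R, ∀ a b c d l, L k = a :: b :: c :: d :: l → 1 / 4 < v a → dl L w k ≤ D2)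
    (H4 : ∀ k ∈ K \ R, ∀ a b c d l, L k = a :: b :: c :: d :: l → (1 - v x) / 4 < v a → v a ≤ 1 / 4 → v b ≤ v a → v c ≤ v b →
      v d ≤ v c → dl L w k ≤ D3 ∧ ((1 - v x) / 4 < v d → dl L w k ≤ 0)) :
    ∑ k ∈ K \ R with v (tp L x k) ≤ (1 - v x) / 3, dl L w k ≤ E := by
  have h0 := wsum_nonneg (by linarith) w1
  rw [← sum_filter_add_sum_filter_not ((K \ R).filter (fun k => v (tp L x k) ≤ (1 - v x) / 3)) (fun k => 1 / 4 < v (tp L x k)),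
    ← sum_filter_add_sum_filter_not (((K \ R).filter (fun k => v (tp L x k) ≤ (1 - v x) / 3)).filter (fun k => ¬ 1 / 4 < v (tp L x k)))
      (fun k => (1 - v x) / 4 < v (tp L x k))]
  have sU : ∑ k ∈ ((((K \ R).filter (fun k => v (tp L x k) ≤ (1 - v x) / 3)).filter (fun k => ¬ 1 / 4 < v (tp L x k)))).filter
      (fun k => ¬ (1 - v x) / 4 < v (tp L x k)), dl L w k ≤ 0 := by
    refine sum_nonpos fun k hk => ?_
    simp only [mem_filter, not_lt] at hk
    obtain ⟨⟨⟨h1, h2⟩, h4⟩, h5⟩ := hk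
    obtain ⟨a, b, c, d, l, hL, hta, hba, hcb, hdc, -, -, -, -, hg⟩ := h.i4 hR (mem_sdiff.1 h1).1 h2
    rw [hta] at h5
    cases l with
    | nil => simp only [Gr] at hg; linarith
    | cons e l =>
      simp only [dl, hL, List.map_cons, List.sum_cons]
      have := w1 a
      have := w1 b
      have := w1 c
      have := w1 d
      have := w1 e
      have := h0 l
      linarith
  set KS := ((K \ R).filter (fun k => v (tp L x k) ≤ (1 - v x) / 3)).filter (fun k => 1 / 4 < v (tp L x k)) with hKS
  set KT := (((K \ R).filter (fun k => v (tp L x k) ≤ (1 - v x) / 3)).filter (fun k => ¬ 1 / 4 < v (tp L x k))).filter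
      (fun k => (1 - v x) / 4 < v (tp L x k)) with hKT
  have mKS : ∀ k ∈ KS, k ∈ K \ R ∧ v (tp L x k) ≤ (1 - v x) / 3 ∧ 1 / 4 < v (tp L x k) := by
    intro k hk
    simp only [hKS, mem_filter] at hk
    exact ⟨hk.1.1, hk.1.2, hk.2⟩
  have mKT : ∀ k ∈ KT, k ∈ K \ R ∧ v (tp L x k) ≤ (1 - v x) / 3 ∧ v (tp L x k) ≤ 1 / 4 ∧ (1 - v x) / 4 < v (tp L x k) := by
    intro k hk
    simp only [hKT, mem_filter, not_lt] at hk
    exact ⟨hk.1.1.1, hk.1.1.2, hk.1.2, hk.2⟩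
  have sT : ∑ k ∈ KT, dl L w k ≤ D3 := by
    have := class_sum h KT (fun k hk => (mem_sdiff.1 (mKT k hk).1).1) (dl L w) ((1 - v x) / 4) (fun k hk => (mKT k hk).2.2.2) ?_
    · rcases this with e | ⟨k, hk, e1, e2, e3⟩
      · linarith
      · obtain ⟨h1, h2, h4, h5⟩ := mKT k hk
        obtain ⟨a, b, c, d, l, hL, hta, hba, hcb, hdc, -, -, -, -, hg⟩ := h.i4 hR (mem_sdiff.1 h1).1 h2
        rw [hta] at h4 h5
        exact e3.trans (H4 k h1 a b c d l hL h5 h4 hba hcb hdc).1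
    · intro k hk
      obtain ⟨h1, h2, h4, h5⟩ := mKT k hk
      obtain ⟨a, b, c, d, l, hL, hta, hba, hcb, hdc, hf1, hf2, hf3, hf4, hg⟩ := h.i4 hR (mem_sdiff.1 h1).1 h2
      rw [hta] at h4 h5
      by_cases hd : (1 - v x) / 4 < v d
      · left; exact (H4 k h1 a b c d l hL h5 h4 hba hcb hdc).2 hd
      · right
        intro y hy
        have := hf1 y hy
        have := hf4 y hy (by linarith)
        linarith
  have cS := class_sum h KS (fun k hk => (mem_sdiff.1 (mKS k hk).1).1) (dl L w) (1 / 4) (fun k hk => (mKS k hk).2.2) (by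
    intro k hk
    obtain ⟨h1, h2, h4⟩ := mKS k hk
    obtain ⟨a, b, c, d, l, hL, hta, hba, hcb, hdc, hf1, hf2, hf3, hf4, hg⟩ := h.i4 hR (mem_sdiff.1 h1).1 h2
    rw [hta] at h2 h4
    by_cases hc : 1 / 4 < v c
    · left; exact H1 k h1 a b c d l hL h2 hba hcb hc hf3
    · right
      intro y hy
      have := hf1 y hy
      have := hf3 y hy (by linarith)
      linarith)
  rcases cS with e | ⟨k, hk, e1, e2, e3⟩
  · linarith
  obtain ⟨h1, h2, h4⟩ := mKS k hk
  obtain ⟨a, b, c, d, l, hL, hta, hba, hcb, hdc, hf1, hf2, hf3, hf4, hg⟩ := h.i4 hR (mem_sdiff.1 h1).1 h2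
  by_cases hc : (1 - v x) / 4 < v c
  · have hc4 : v c ≤ 1 / 4 := by
      by_contra hc4
      have := H1 k h1 a b c d l hL (by rwa [hta] at h2) hba hcb (not_le.1 hc4) hf3
      linarith
    have := H2 k h1 a b c d l hL (by rwa [hta] at h2) (by rwa [hta] at h4) hba hcb hc hc4 hf3
    linarith
  · have hKT0 : KT = ∅ := by
      rw [Finset.eq_empty_iff_forall_notMem]
      intro i hi
      obtain ⟨g1, g2, g3, g4⟩ := mKT i hi
      have := hf3 _ (h.tp_rem (mem_sdiff.1 g1).1 (mem_sdiff.1 h1).1 (by linarith)) (by rw [hta] at h2; linarith)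
      linarith
    have sT0 : ∑ k ∈ KT, dl L w k = 0 := by rw [hKT0]; simp
    have := H3 k h1 a b c d l hL (by rwa [hta] at h4)
    linarith

lemma ffd_all (r : RS v x M K L P R p q y z) (h : Pk v x M K L D P) (w : α → ℚ) :
    ∑ k ∈ K \ R, (72 - ((L k).map w).sum) = ∑ k ∈ K \ R with (1 - v x) / 2 < v (tp L x k), dl L w k +
    ∑ k ∈ K \ R with (1 - v x) / 3 < v (tp L x k) ∧ v (tp L x k) ≤ (1 - v x) / 2, dl L w k +
    ∑ k ∈ K \ R with v (tp L x k) ≤ (1 - v x) / 3, dl L w k := by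
  have hx2 : v x ≤ 1 := h.le_one h.xM
  change ∑ k ∈ K \ R, dl L w k = _
  rw [sum_filter, sum_filter, sum_filter, ← sum_add_distrib, ← sum_add_distrib]
  refine sum_congr rfl fun k hk => ?_
  by_cases e1 : (1 - v x) / 2 < v (tp L x k)
  · rw [if_pos e1, if_neg (by rintro ⟨-, e⟩; linarith), if_neg (by linarith)]; ring
  · by_cases e2 : v (tp L x k) ≤ (1 - v x) / 3
    · rw [if_neg e1, if_neg (by rintro ⟨e, -⟩; linarith), if_pos e2]; ring
    · rw [if_neg e1, if_pos ⟨not_le.1 e2, not_lt.1 e1⟩, if_neg e2]; ring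
end

section
variable {v : α → ℚ} {x : α} {M : Finset α} {K : Finset ℕ} {L : ℕ → List α} {D : Finset ℕ} {P : α → ℕ}
  {R : Finset ℕ} {p q y z : ℕ → α}

lemma cmb_ab (r : RS v x M K L P R p q y z) (h : Pk v x M K L D P) {w W : α → ℚ} {e : ℕ} {t1 t2 : Lv} {k : ℕ} (hk : k ∈ R)
    (hW : W (q k) = w (y k) + w (z k) - 16 - e)
    (h1 : t1.ab ((1 - 5 * v x) / 12) ((11 * v x - 2) / 12) v w (y k)) (h2 : t2.ab ((1 - 5 * v x) / 12) ((11 * v x - 2) / 12) v w (z k))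
    (n1 : 24 ≤ t1.a ∧ 12 ≤ t1.b) :
    (cmb e t1 t2).ab ((1 - 5 * v x) / 12) ((11 * v x - 2) / 12) v W (q k) := by
  have hq := r.yzq h hk
  obtain ⟨a1, b1, -⟩ := h1
  obtain ⟨a2, b2, -⟩ := h2
  refine abs' ?_ ?_
  · rw [hW]
    have e1 : ((t1.w + t2.w : ℕ) : ℚ) ≤ ((t1.w + t2.w - 16 - e : ℕ) : ℚ) + 16 + e := by
      exact_mod_cast (by omega : t1.w + t2.w ≤ t1.w + t2.w - 16 - e + 16 + e)
    push_cast at e1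
    linarith
  · rw [Nat.cast_sub (by omega), Nat.cast_sub (by omega)]
    push_cast
    linarith

lemma w_ab (r : RS v x M K L P R p q y z) (h : Pk v x M K L D P) {A B : ℚ} {w W : α → ℚ} {e : ℕ} {t1 t2 : Lv} {k : ℕ} {ba bb : ℕ}
    (hW : W (q k) = w (y k) + w (z k) - 16 - e)
    (h1 : t1.ab A B v w (y k)) (h2 : t2.ab A B v w (z k)) (hb : ba * A + bb * B < v (q k)) :
    (Lv.mk ba bb (t1.w + t2.w - 16 - e) true).ab A B v W (q k) := by
  obtain ⟨a1, b1, -⟩ := h1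
  obtain ⟨a2, b2, -⟩ := h2
  refine abs' ?_ hb
  rw [hW]
  have e1 : ((t1.w + t2.w : ℕ) : ℚ) ≤ ((t1.w + t2.w - 16 - e : ℕ) : ℚ) + 16 + e := by
    exact_mod_cast (by omega : t1.w + t2.w ≤ t1.w + t2.w - 16 - e + 16 + e)
  push_cast at e1
  linarith

lemma inf3_sound (r : RS v x M K L P R p q y z) (h : Pk v x M K L D P) (hx1 : 2 / 11 < v x) (hx2 : v x ≤ 1 / 5)
    {w : α → ℚ} {t1 t2 : Lv} {k : ℕ} (hk : k ∈ R) {a b : ℕ}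
    (hp : a * ((1 - 5 * v x) / 12) + b * ((11 * v x - 2) / 12) < v (p k))
    (h1 : t1.ab ((1 - 5 * v x) / 12) ((11 * v x - 2) / 12) v w (y k))
    (h2 : t2.ab ((1 - 5 * v x) / 12) ((11 * v x - 2) / 12) v w (z k)) : inf3 a b t1 t2 = false := by
  by_contra hcon
  rw [Bool.not_eq_false] at hcon
  simp only [inf3, Bool.and_eq_true, decide_eq_true_eq] at hcon
  obtain ⟨c1, c2⟩ := hcon
  have hpyz := r.pyz h hk
  obtain ⟨a1, b1, -⟩ := h1
  obtain ⟨a2, b2, -⟩ := h2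
  have hA : 0 ≤ (1 - 5 * v x) / 12 := by linarith
  have hB : 0 ≤ (11 * v x - 2) / 12 := by linarith
  have e1 : (132 : ℚ) ≤ a + t1.a + t2.a := by exact_mod_cast c1
  have e2 : (60 : ℚ) ≤ b + t1.b + t2.b := by exact_mod_cast c2
  have f1 := mul_le_mul_of_nonneg_right e1 hA
  have f2 := mul_le_mul_of_nonneg_right e2 hB
  linarith

lemma dom_sound {A B : ℚ} (hA : 0 ≤ A) (hB : 0 ≤ B) {W : α → ℚ} {ls : List Lv} {t : Lv} {c : α} (ht : t.s = true) (hd : dom ls t = true)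
    (hab : t.ab A B v W c) : ∃ t ∈ ls, t.ab A B v W c := by
  simp only [dom, List.any_eq_true, Bool.and_eq_true, decide_eq_true_eq] at hd
  obtain ⟨s, hs, ⟨h1, h2⟩, h3⟩ := hd
  refine ⟨s, hs, ?_⟩
  obtain ⟨a1, -, a3⟩ := hab
  have a3 := a3 ht
  have e1 : (s.a : ℚ) ≤ t.a := by exact_mod_cast h1
  have e2 : (s.b : ℚ) ≤ t.b := by exact_mod_cast h2
  have e3 : (t.w : ℚ) ≤ s.w := by exact_mod_cast h3
  have f1 := mul_le_mul_of_nonneg_right e1 hA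
  have f2 := mul_le_mul_of_nonneg_right e2 hB
  exact ⟨by linarith, by linarith, fun _ => by linarith⟩

lemma okG_sound (r : RS v x M K L P R p q y z) (h : Pk v x M K L D P) (hx1 : 2 / 11 < v x) (hx2 : v x ≤ 1 / 5)
    {w W : α → ℚ} {k : ℕ} (hk : k ∈ R) {a b ba bb : ℕ} {ls N : List Lv} (hok : okG a b ba bb ls N = true)
    (hN : ∀ t ∈ N, 24 ≤ t.a ∧ 12 ≤ t.b)
    (hp : a * ((1 - 5 * v x) / 12) + b * ((11 * v x - 2) / 12) < v (p k))
    (hb : ba * ((1 - 5 * v x) / 12) + bb * ((11 * v x - 2) / 12) < v (q k))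
    (hW : W (q k) = w (y k) + w (z k) - 16)
    (h1 : ∃ t ∈ N, t.ab ((1 - 5 * v x) / 12) ((11 * v x - 2) / 12) v w (y k))
    (h2 : ∃ t ∈ N, t.ab ((1 - 5 * v x) / 12) ((11 * v x - 2) / 12) v w (z k)) :
    ∃ t ∈ ls, t.ab ((1 - 5 * v x) / 12) ((11 * v x - 2) / 12) v W (q k) := by
  obtain ⟨t1, m1, h1⟩ := h1
  obtain ⟨t2, m2, h2⟩ := h2
  have hW' : W (q k) = w (y k) + w (z k) - 16 - (0 : ℕ) := by rw [hW]; simp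
  simp only [okG, List.all_eq_true, Bool.or_eq_true] at hok
  rcases hok t1 m1 t2 m2 with (e | e) | e
  · rw [inf3_sound r h hx1 hx2 hk hp h1 h2] at e; simp at e
  · exact dom_sound (by linarith) (by linarith) rfl e (cmb_ab r h hk hW' h1 h2 (hN t1 m1))
  · exact dom_sound (by linarith) (by linarith) rfl e (w_ab r h hW' h1 h2 hb)

lemma okS_sound (r : RS v x M K L P R p q y z) (h : Pk v x M K L D P) (hx1 : 2 / 11 < v x) (hx2 : v x ≤ 1 / 5)
    {w W : α → ℚ} {k : ℕ} (hk : k ∈ R) {a b ba bb e : ℕ} {ls N : List Lv} (hok : okS a b ba bb e ls N = true)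
    (hN : ∀ t ∈ N, 24 ≤ t.a ∧ 12 ≤ t.b)
    (hp : a * ((1 - 5 * v x) / 12) + b * ((11 * v x - 2) / 12) < v (p k))
    (hb : ba * ((1 - 5 * v x) / 12) + bb * ((11 * v x - 2) / 12) < v (q k))
    (hW : W (q k) = w (y k) + w (z k) - 16 - e)
    (h1 : ∃ t ∈ N, t.ab ((1 - 5 * v x) / 12) ((11 * v x - 2) / 12) v w (y k))
    (h2 : ∃ t ∈ N, t.ab ((1 - 5 * v x) / 12) ((11 * v x - 2) / 12) v w (z k))
    {S : Finset α} (hqS : q k ∈ S) (hS0 : ∀ c ∈ S, 0 ≤ v c) (hS1 : ∑ c ∈ S, v c ≤ 1)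
    (hS : ∀ c ∈ S, c ≠ q k → ∃ t ∈ ls, t.ab ((1 - 5 * v x) / 12) ((11 * v x - 2) / 12) v W c) :
    ∑ c ∈ S, W c ≤ 88 := by
  obtain ⟨t1, m1, h1⟩ := h1
  obtain ⟨t2, m2, h2⟩ := h2
  have hA : 0 ≤ (1 - 5 * v x) / 12 := by linarith
  have hB : 0 < (11 * v x - 2) / 12 := by linarith
  have hbd : bd false (∑ c ∈ S, v c) ((132 : ℕ) * ((1 - 5 * v x) / 12) + (60 : ℕ) * ((11 * v x - 2) / 12)) := by
    refine ⟨?_, by simp⟩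
    push_cast; linarith
  simp only [okS, List.all_eq_true, Bool.or_eq_true] at hok
  rcases hok t1 m1 t2 m2 with (e | e) | e
  · rw [inf3_sound r h hx1 hx2 hk hp h1 h2] at e; simp at e
  · have := chk1_sound hA hB e hqS (cmb_ab r h hk hW h1 h2 (hN t1 m1)) hS0 hS hbd
    simpa using this
  · have := chk1_sound hA hB e hqS (w_ab r h hW h1 h2 hb) hS0 hS hbd
    simpa using this

lemma chk_use (hx1 : 2 / 11 < v x) (hx2 : v x ≤ 1 / 5)
    {W : α → ℚ} {ls : List Lv} (hok : chk 40 ls false 132 60 0 = true)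
    {S : Finset α} (hS0 : ∀ c ∈ S, 0 ≤ v c) (hS1 : ∑ c ∈ S, v c ≤ 1)
    (hS : ∀ c ∈ S, ∃ t ∈ ls, t.ab ((1 - 5 * v x) / 12) ((11 * v x - 2) / 12) v W c) :
    ∑ c ∈ S, W c ≤ 88 := by
  have hbd : bd false (∑ c ∈ S, v c) ((132 : ℕ) * ((1 - 5 * v x) / 12) + (60 : ℕ) * ((11 * v x - 2) / 12)) := by
    refine ⟨?_, by simp⟩
    push_cast; linarith
  have := chk_sound (A := (1 - 5 * v x) / 12) (by linarith) (by linarith) _ _ _ _ _ _ hok S hS0 hS hbd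
  simpa using this

open Classical in
/-- weights -/
noncomputable def ws (v : α → ℚ) (x : α) (u m2 : ℚ) (hi lo : α → Prop) (c : α) : ℚ :=
  if v c ≤ (1 - v x) / 4 then u
  else if v c ≤ 1 / 4 then (if lo c then 17 else 18)
  else if v c ≤ (1 - v x) / 3 then (if hi c then 19 else 18)
  else if v c ≤ 5 / 12 - 2 / 3 * v x then 24
  else if v c ≤ 1 / 2 - v x then m2
  else if v c ≤ 1 / 3 then 26
  else if v c ≤ (5 - 5 * v x) / 12 then 29
  else if v c ≤ 2 * v x then 30
  else if v c ≤ (1 - v x) / 2 then 34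
  else if v c ≤ 1 / 2 then 36 else 72 - 2 * u

lemma ws_elim {u m2 : ℚ} {hi lo : α → Prop} {c : α} (Q : ℚ → Prop)
    (a1 : v c ≤ (1 - v x) / 4 → Q u)
    (a2 : (1 - v x) / 4 < v c → v c ≤ 1 / 4 → lo c → Q 17)
    (a3 : (1 - v x) / 4 < v c → v c ≤ 1 / 4 → ¬ lo c → Q 18)
    (a4 : 1 / 4 < v c → v c ≤ (1 - v x) / 3 → hi c → Q 19)
    (a5 : 1 / 4 < v c → v c ≤ (1 - v x) / 3 → ¬ hi c → Q 18)
    (a6 : (1 - v x) / 3 < v c → v c ≤ 5 / 12 - 2 / 3 * v x → Q 24)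
    (a7 : 5 / 12 - 2 / 3 * v x < v c → v c ≤ 1 / 2 - v x → Q m2)
    (a8 : 1 / 2 - v x < v c → v c ≤ 1 / 3 → Q 26)
    (a9 : 1 / 3 < v c → v c ≤ (5 - 5 * v x) / 12 → Q 29)
    (b1 : (5 - 5 * v x) / 12 < v c → v c ≤ 2 * v x → Q 30)
    (b2 : 2 * v x < v c → v c ≤ (1 - v x) / 2 → Q 34)
    (b3 : (1 - v x) / 2 < v c → v c ≤ 1 / 2 → Q 36)
    (b4 : 1 / 2 < v c → Q (72 - 2 * u)) : Q (ws v x u m2 hi lo c) := by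
  unfold ws
  by_cases e1 : v c ≤ (1 - v x) / 4
  · rw [if_pos e1]; exact a1 e1
  rw [if_neg e1]
  by_cases e2 : v c ≤ 1 / 4
  · rw [if_pos e2]
    by_cases e : lo c
    · rw [if_pos e]; exact a2 (not_le.1 e1) e2 e
    · rw [if_neg e]; exact a3 (not_le.1 e1) e2 e
  rw [if_neg e2]
  by_cases e3 : v c ≤ (1 - v x) / 3
  · rw [if_pos e3]
    by_cases e : hi c
    · rw [if_pos e]; exact a4 (not_le.1 e2) e3 e
    · rw [if_neg e]; exact a5 (not_le.1 e2) e3 e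
  rw [if_neg e3]
  by_cases e4 : v c ≤ 5 / 12 - 2 / 3 * v x
  · rw [if_pos e4]; exact a6 (not_le.1 e3) e4
  rw [if_neg e4]
  by_cases e5 : v c ≤ 1 / 2 - v x
  · rw [if_pos e5]; exact a7 (not_le.1 e4) e5
  rw [if_neg e5]
  by_cases e6 : v c ≤ 1 / 3
  · rw [if_pos e6]; exact a8 (not_le.1 e5) e6
  rw [if_neg e6]
  by_cases e7 : v c ≤ (5 - 5 * v x) / 12
  · rw [if_pos e7]; exact a9 (not_le.1 e6) e7
  rw [if_neg e7]
  by_cases e8 : v c ≤ 2 * v x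
  · rw [if_pos e8]; exact b1 (not_le.1 e7) e8
  rw [if_neg e8]
  by_cases e9 : v c ≤ (1 - v x) / 2
  · rw [if_pos e9]; exact b2 (not_le.1 e8) e9
  rw [if_neg e9]
  by_cases f1 : v c ≤ 1 / 2
  · rw [if_pos f1]; exact b3 (not_le.1 e9) f1
  · rw [if_neg f1]; exact b4 (not_le.1 f1)

section
variable {u m2 : ℚ} {hi lo : α → Prop}
lemma ws1 (hx1 : 2 / 11 < v x) (hx2 : v x ≤ 1 / 5) (hu : 16 ≤ u) (hu' : u ≤ 17) (hm : 24 ≤ m2) (hm' : m2 ≤ 26) (c : α) : u ≤ ws v x u m2 hi lo c :=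
  by apply ws_elim (Q := fun t => u ≤ t) <;> intros <;> first | linarith | contradiction
lemma wsT (hx1 : 2 / 11 < v x) (hx2 : v x ≤ 1 / 5) (hu : 16 ≤ u) (hu' : u ≤ 17) (hm : 24 ≤ m2) (hm' : m2 ≤ 26) (c : α) (h : (1 - v x) / 4 < v c) : 17 ≤ ws v x u m2 hi lo c :=
  by apply ws_elim (Q := fun t => 17 ≤ t) <;> intros <;> first | linarith | contradiction
lemma wsT' (hx1 : 2 / 11 < v x) (hx2 : v x ≤ 1 / 5) (hu : 16 ≤ u) (hu' : u ≤ 17) (hm : 24 ≤ m2) (hm' : m2 ≤ 26) (c : α) (h : (1 - v x) / 4 < v c) (hl : ¬ lo c) : 18 ≤ ws v x u m2 hi lo c :=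
  by apply ws_elim (Q := fun t => 18 ≤ t) <;> intros <;> first | linarith | contradiction
lemma wsS (hx1 : 2 / 11 < v x) (hx2 : v x ≤ 1 / 5) (hu : 16 ≤ u) (hu' : u ≤ 17) (hm : 24 ≤ m2) (hm' : m2 ≤ 26) (c : α) (h : 1 / 4 < v c) : 18 ≤ ws v x u m2 hi lo c :=
  by apply ws_elim (Q := fun t => 18 ≤ t) <;> intros <;> first | linarith | contradiction
lemma wsS' (hx1 : 2 / 11 < v x) (hx2 : v x ≤ 1 / 5) (hu : 16 ≤ u) (hu' : u ≤ 17) (hm : 24 ≤ m2) (hm' : m2 ≤ 26) (c : α) (h : 1 / 4 < v c) (hh : hi c) : 19 ≤ ws v x u m2 hi lo c :=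
  by apply ws_elim (Q := fun t => 19 ≤ t) <;> intros <;> first | linarith | contradiction
lemma wsM (hx1 : 2 / 11 < v x) (hx2 : v x ≤ 1 / 5) (hu : 16 ≤ u) (hu' : u ≤ 17) (hm : 24 ≤ m2) (hm' : m2 ≤ 26) (c : α) (h : (1 - v x) / 3 < v c) : 24 ≤ ws v x u m2 hi lo c :=
  by apply ws_elim (Q := fun t => 24 ≤ t) <;> intros <;> first | linarith | contradiction
lemma wsM2 (hx1 : 2 / 11 < v x) (hx2 : v x ≤ 1 / 5) (hu : 16 ≤ u) (hu' : u ≤ 17) (hm : 24 ≤ m2) (hm' : m2 ≤ 26) (c : α) (h : 5 / 12 - 2 / 3 * v x < v c) : m2 ≤ ws v x u m2 hi lo c :=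
  by apply ws_elim (Q := fun t => m2 ≤ t) <;> intros <;> first | linarith | contradiction
lemma wsM3 (hx1 : 2 / 11 < v x) (hx2 : v x ≤ 1 / 5) (hu : 16 ≤ u) (hu' : u ≤ 17) (hm : 24 ≤ m2) (hm' : m2 ≤ 26) (c : α) (h : 1 / 2 - v x < v c) : 26 ≤ ws v x u m2 hi lo c :=
  by apply ws_elim (Q := fun t => 26 ≤ t) <;> intros <;> first | linarith | contradiction
lemma wsL (hx1 : 2 / 11 < v x) (hx2 : v x ≤ 1 / 5) (hu : 16 ≤ u) (hu' : u ≤ 17) (hm : 24 ≤ m2) (hm' : m2 ≤ 26) (c : α) (h : 1 / 3 < v c) : 29 ≤ ws v x u m2 hi lo c :=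
  by apply ws_elim (Q := fun t => 29 ≤ t) <;> intros <;> first | linarith | contradiction
lemma wsLh (hx1 : 2 / 11 < v x) (hx2 : v x ≤ 1 / 5) (hu : 16 ≤ u) (hu' : u ≤ 17) (hm : 24 ≤ m2) (hm' : m2 ≤ 26) (c : α) (h : (5 - 5 * v x) / 12 < v c) : 30 ≤ ws v x u m2 hi lo c :=
  by apply ws_elim (Q := fun t => 30 ≤ t) <;> intros <;> first | linarith | contradiction
lemma wsLp (hx1 : 2 / 11 < v x) (hx2 : v x ≤ 1 / 5) (hu : 16 ≤ u) (hu' : u ≤ 17) (hm : 24 ≤ m2) (hm' : m2 ≤ 26) (c : α) (h : 2 * v x < v c) : 34 ≤ ws v x u m2 hi lo c :=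
  by apply ws_elim (Q := fun t => 34 ≤ t) <;> intros <;> first | linarith | contradiction
lemma wsB (hx1 : 2 / 11 < v x) (hx2 : v x ≤ 1 / 5) (hu : 16 ≤ u) (hu' : u ≤ 17) (hm : 24 ≤ m2) (hm' : m2 ≤ 26) (c : α) (h : (1 - v x) / 2 < v c) : 36 ≤ ws v x u m2 hi lo c :=
  by apply ws_elim (Q := fun t => 36 ≤ t) <;> intros <;> first | linarith | contradiction
lemma wsG (hx1 : 2 / 11 < v x) (hx2 : v x ≤ 1 / 5) (hu : 16 ≤ u) (hu' : u ≤ 17) (hm : 24 ≤ m2) (hm' : m2 ≤ 26) (c : α) (h : 1 / 2 < v c) : 72 - 2 * u ≤ ws v x u m2 hi lo c :=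
  by apply ws_elim (Q := fun t => 72 - 2 * u ≤ t) <;> intros <;> first | linarith | contradiction

lemma vsLp (hx1 : 2 / 11 < v x) (hx2 : v x ≤ 1 / 5) (hu : 16 ≤ u) (hu' : u ≤ 17) (hm : 24 ≤ m2) (hm' : m2 ≤ 26) (c : α) (h : v c ≤ (1 - v x) / 2) : ws v x u m2 hi lo c ≤ 34 :=
  by apply ws_elim (Q := fun t => t ≤ 34) <;> intros <;> first | linarith | contradiction
lemma vsB (hx1 : 2 / 11 < v x) (hx2 : v x ≤ 1 / 5) (hu : 16 ≤ u) (hu' : u ≤ 17) (hm : 24 ≤ m2) (hm' : m2 ≤ 26) (c : α) (h : v c ≤ 1 / 2) : ws v x u m2 hi lo c ≤ 36 :=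
  by apply ws_elim (Q := fun t => t ≤ 36) <;> intros <;> first | linarith | contradiction
lemma vsG (hx1 : 2 / 11 < v x) (hx2 : v x ≤ 1 / 5) (hu : 16 ≤ u) (hu' : u ≤ 17) (hm : 24 ≤ m2) (hm' : m2 ≤ 26) (c : α) : ws v x u m2 hi lo c ≤ 72 - 2 * u :=
  by apply ws_elim (Q := fun t => t ≤ 72 - 2 * u) <;> intros <;> first | linarith | contradiction
end
end

section
variable {v : α → ℚ} {x : α} {M : Finset α} {K : Finset ℕ} {L : ℕ → List α} {D : Finset ℕ} {P : α → ℕ}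
  {R : Finset ℕ} {p q y z : ℕ → α}

/-- extra for special bins -/
def sp (v : α → ℚ) (p : ℕ → α) (k : ℕ) : ℚ := if v (p k) ≤ 1 / 2 then 2 else 0

lemma top_e (r : RS v x M K L P R p q y z) (h : Pk v x M K L D P) (hR : Red M P) (hx1 : 2 / 11 < v x) (hx2 : v x ≤ 1 / 5)
    {m2 : ℚ} (hm : 24 ≤ m2) (hm' : m2 ≤ 26) {hi lo : α → Prop} :
    ∑ k ∈ K \ R with (1 - v x) / 2 < v (tp L x k), dl L (ws v x 17 m2 hi lo) k + ∑ k ∈ R, sp v p k ≤ 2 := by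
  obtain ⟨t1, t2⟩ := ffd_top r h hR hx2 (w := ws v x 17 m2 hi lo) (u := 17) (by norm_num) (by norm_num)
    (ws1 hx1 hx2 (by norm_num) (by norm_num) hm hm') (wsLp hx1 hx2 (by norm_num) (by norm_num) hm hm')
    (wsB hx1 hx2 (by norm_num) (by norm_num) hm hm') (wsG hx1 hx2 (by norm_num) (by norm_num) hm hm')
  by_cases hs : ∃ k ∈ R, v (p k) ≤ 1 / 2
  · have t2 := t2 hs
    obtain ⟨k, hk, hpk⟩ := hs
    have : ∑ i ∈ R, sp v p i = sp v p k := by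
      refine sum_eq_single_of_mem k hk fun i hi hik => ?_
      unfold sp
      rw [if_neg]
      intro hpi
      exact hik (r.special_unique h hR hi hk hpi (by linarith [r.qx i hi]) hpk (by linarith [r.qx k hk]))
    rw [this]
    unfold sp
    rw [if_pos hpk]
    linarith
  · push Not at hs
    have : ∑ i ∈ R, sp v p i = 0 := sum_eq_zero fun i hi => by unfold sp; rw [if_neg (not_le.2 (hs i hi))]
    rw [this]
    linarith

lemma m3_or (h : Pk v x M K L D P) (hR : Red M P) (hx1 : 2 / 11 < v x) (hx2 : v x ≤ 1 / 5)
    {m2 : ℚ} (hm : 24 ≤ m2) (hm' : m2 ≤ 26) {hi lo : α → Prop} {k : ℕ} (hk : k ∈ K)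
    (ht1 : (1 - v x) / 3 < v (tp L x k)) (ht2 : v (tp L x k) ≤ 1 / 3) :
    dl L (ws v x 17 m2 hi lo) k ≤ 7 ∨ ∃ a b c, L k = [a, b, c] ∧ (1 - v x) / 3 < v a ∧ v a ≤ 1 / 3 ∧ v b ≤ (1 - v x) / 3 ∧
      v c ≤ v b ∧ (1 - v x) / 4 < v c ∧ 1 < v a + v b + v c + v x := by
  have w1 := fun c => ws1 (x := x) (v := v) (hi := hi) (lo := lo) hx1 hx2 (by norm_num : (16:ℚ) ≤ 17) (by norm_num) hm hm' c
  have w2 := fun c => wsM (x := x) (v := v) (hi := hi) (lo := lo) hx1 hx2 (by norm_num : (16:ℚ) ≤ 17) (by norm_num) hm hm' c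
  have h0 := wsum_nonneg (by norm_num) w1
  obtain ⟨a, b, c, l, hL, hta, hba, hcb, hf1, hf2, hf3, hg, -⟩ := h.i3 hR hk (by linarith)
  rw [hta] at ht1 ht2
  have := w2 a ht1
  by_cases hb : (1 - v x) / 3 < v b
  · left
    have := w2 b hb
    have := w1 c
    have := h0 l
    simp only [dl, hL, List.map_cons, List.sum_cons]
    linarith
  · cases l with
    | nil =>
      simp only [Gr] at hg
      right
      exact ⟨a, b, c, hL, ht1, ht2, not_lt.1 hb, hcb, by linarith, hg⟩
    | cons d l =>
      left
      have := w1 b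
      have := w1 c
      have := w1 d
      have := h0 l
      simp only [dl, hL, List.map_cons, List.sum_cons]
      linarith

/-- small tops with all high -/
lemma ST_all (h : Pk v x M K L D P) (hR : Red M P) (hx1 : 2 / 11 < v x) (hx2 : v x ≤ 1 / 5)
    {u m2 : ℚ} (hu : 16 ≤ u) (hu' : u ≤ 17) (hm : 24 ≤ m2) (hm' : m2 ≤ 26) {hi lo : α → Prop} (hhi : ∀ c, hi c) (hlo : ∀ c, ¬ lo c) :
    ∑ k ∈ K \ R with v (tp L x k) ≤ (1 - v x) / 3, dl L (ws v x u m2 hi lo) k ≤ 71 - 4 * u := by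
  have w1 := fun c => ws1 (x := x) (v := v) (hi := hi) (lo := lo) hx1 hx2 hu hu' hm hm' c
  have wS := fun c hc => wsS' (x := x) (v := v) (hi := hi) (lo := lo) hx1 hx2 hu hu' hm hm' c hc (hhi c)
  have wT := fun c hc => wsT' (x := x) (v := v) (hi := hi) (lo := lo) hx1 hx2 hu hu' hm hm' c hc (hlo c)
  have h0 := wsum_nonneg (by linarith) w1
  refine ffd_ST h hR hx1 hx2 (u := u) (D1 := 17 - u) (D2 := 53 - 3 * u) (D3 := 54 - 3 * u) hu (by linarith) (by linarith)
    (by linarith) (by linarith) (by linarith) w1 ?_ ?_ ?_ ?_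
  · intro k hk a b c d l hL h1 h2 h3 h4 h5
    have := wS a (by linarith)
    have := wS b (by linarith)
    have := wS c (by linarith)
    have := w1 d
    have := h0 l
    simp only [dl, hL, List.map_cons, List.sum_cons]
    linarith
  · intro k hk a b c d l hL h1 h2 h3 h4 h5 h6 h7
    have := wS a (by linarith)
    have := wT b (by linarith)
    have := wT c (by linarith)
    have := w1 d
    have := h0 l
    simp only [dl, hL, List.map_cons, List.sum_cons]
    linarith
  · intro k hk a b c d l hL h1
    have := wS a (by linarith)
    have := w1 b
    have := w1 c
    have := w1 d
    have := h0 l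
    simp only [dl, hL, List.map_cons, List.sum_cons]
    linarith
  · intro k hk a b c d l hL h1 h2 h3 h4 h5
    have := wT a (by linarith)
    have := w1 b
    have := w1 c
    have := w1 d
    have := h0 l
    simp only [dl, hL, List.map_cons, List.sum_cons]
    refine ⟨by linarith, fun h6 => ?_⟩
    have := wT b (by linarith)
    have := wT c (by linarith)
    have := wT d (by linarith)
    linarith

lemma scenB_LM (r : RS v x M K L P R p q y z) (h : Pk v x M K L D P) (hR : Red M P) (hx1 : 2 / 11 < v x) (hx2 : v x ≤ 1 / 5)
    {hi lo : α → Prop} (hhi : ∀ c, hi c) (hlo : ∀ c, ¬ lo c) :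
    ∑ k ∈ K \ R with (1 - v x) / 3 < v (tp L x k) ∧ v (tp L x k) ≤ (1 - v x) / 2, dl L (ws v x 17 25 hi lo) k ≤ 11 := by
  have e1 : (16 : ℚ) ≤ 17 := by norm_num
  have e2 : (17 : ℚ) ≤ 17 := by norm_num
  have e3 : (24 : ℚ) ≤ 25 := by norm_num
  have e4 : (25 : ℚ) ≤ 26 := by norm_num
  have w1 := fun c => ws1 (x := x) (v := v) (hi := hi) (lo := lo) hx1 hx2 e1 e2 e3 e4 c
  have wS := fun c hc => wsS' (x := x) (v := v) (hi := hi) (lo := lo) hx1 hx2 e1 e2 e3 e4 c hc (hhi c)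
  have wT := fun c hc => wsT' (x := x) (v := v) (hi := hi) (lo := lo) hx1 hx2 e1 e2 e3 e4 c hc (hlo c)
  have w2 := fun c => wsM (x := x) (v := v) (hi := hi) (lo := lo) hx1 hx2 e1 e2 e3 e4 c
  have w3 := fun c => wsL (x := x) (v := v) (hi := hi) (lo := lo) hx1 hx2 e1 e2 e3 e4 c
  have wM2 := fun c => wsM2 (x := x) (v := v) (hi := hi) (lo := lo) hx1 hx2 e1 e2 e3 e4 c
  have wM3 := fun c => wsM3 (x := x) (v := v) (hi := hi) (lo := lo) hx1 hx2 e1 e2 e3 e4 c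
  have wLh := fun c => wsLh (x := x) (v := v) (hi := hi) (lo := lo) hx1 hx2 e1 e2 e3 e4 c
  have h0 := wsum_nonneg (by norm_num) w1
  have hM3 : ∀ k a b c, L k = [a, b, c] → (1 - v x) / 3 < v a → v a ≤ 1 / 3 → v b ≤ (1 - v x) / 3 →
      v c ≤ v b → (1 - v x) / 4 < v c → 1 < v a + v b + v c + v x → dl L (ws v x 17 25 hi lo) k ≤ 10 := by
    intro k a b c hL h1 h2 h3 h4 h5 h6
    simp only [dl, hL, List.map_cons, List.sum_cons, List.map_nil, List.sum_nil]
    by_cases hc : 1 / 4 < v c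
    · have := w2 a h1
      have := wS b (by linarith)
      have := wS c hc
      linarith
    · have := wT c h5
      by_cases hb : 1 / 4 < v b
      · have := wS b hb
        have := wM2 a (by linarith)
        linarith
      · have := wT b (by linarith)
        have := wM3 a (by linarith)
        linarith
  have hMd : ∀ k ∈ K, (1 - v x) / 3 < v (tp L x k) → v (tp L x k) ≤ 1 / 3 → dl L (ws v x 17 25 hi lo) k ≤ 10 := by
    intro k hk h1 h2
    rcases m3_or (hi := hi) (lo := lo) h hR hx1 hx2 e3 e4 hk h1 h2 with e | ⟨a, b, c, hL, g1, g2, g3, g4, g5, g6⟩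
    · linarith
    · exact hM3 k a b c hL g1 g2 g3 g4 g5 g6
  refine ffd_LM h hR hx1 hx2 (u := 17) e1 (by norm_num) w1 w2 w3 ?_ ?_ ?_
  · intro k hk a b c l hL h1 h2 h3 h4 h5
    have := w3 a h1
    have := w1 b
    have := w1 c
    have := h0 l
    simp only [dl, hL, List.map_cons, List.sum_cons]
    linarith
  · intro k hk j hj hkj h1 h2 a b c l hL h3 h4 h5 h6 h7 h8
    have g1 := w3 a h3
    have g2 := w2 b h5
    have g3 := w1 c
    have g4 := h0 l
    have hjK := (mem_sdiff.1 hj).1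
    rcases m3_or (hi := hi) (lo := lo) h hR hx1 hx2 e3 e4 hjK h1 h2 with e | ⟨a', b', c', hL', f1, f2, f3, f4, f5, f6⟩
    · simp only [dl, hL, List.map_cons, List.sum_cons] at e ⊢
      linarith
    · have := hM3 j a' b' c' hL' f1 f2 f3 f4 f5 f6
      have hk1 : dl L (ws v x 17 25 hi lo) k ≤ 1 := by
        simp only [dl, hL, List.map_cons, List.sum_cons]
        by_cases ha : (5 - 5 * v x) / 12 < v a
        · have := wLh a ha
          linarith
        · have := h7 c' (h.rem_later hjK (by simp [hL']) hkj) (by linarith)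
          have := wT c (by linarith)
          linarith
      linarith
  · intro k hk a b c l hL h1 h2 h3 h4 h5 h6
    have := hMd k (mem_sdiff.1 hk).1 (by rwa [tp_eq hL]) (by rwa [tp_eq hL])
    linarith

lemma scenB (r : RS v x M K L P R p q y z) (h : Pk v x M K L D P) (hR : Red M P)
    (hc : 11 * D.card ≤ 9 * K.card) (hx1 : 2 / 11 < v x) (hx2 : v x ≤ 1 / 5) (hq : ∀ k ∈ R, 1 / 3 < v (q k)) : False := by
  have e1 : (16 : ℚ) ≤ 17 := by norm_num
  have e2 : (17 : ℚ) ≤ 17 := by norm_num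
  have e3 : (24 : ℚ) ≤ 25 := by norm_num
  have e4 : (25 : ℚ) ≤ 26 := by norm_num
  refine r.fwR h hR hc (ws v x 17 25 (fun _ => True) (fun _ => False)) (sp v p) ?_ ?_
  swap
  · rw [ffd_all r h]
    have t1 := top_e r h hR hx1 hx2 e3 e4 (hi := fun _ => True) (lo := fun _ => False)
    have t2 := scenB_LM r h hR hx1 hx2 (hi := fun _ => True) (lo := fun _ => False) (by simp) (by simp)
    have t3 := ST_all (R := R) h hR hx1 hx2 e1 e2 e3 e4 (hi := fun _ => True) (lo := fun _ => False) (by simp) (by simp)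
    have t4 := ws1 (v := v) hx1 hx2 e1 e2 e3 e4 (hi := fun _ => True) (lo := fun _ => False) x
    linarith
  intro W Wq Wn S hSM hS0 hnp hS1 h3
  have hN : ∀ (W' : α → ℚ) c, v x ≤ v c → v c ≤ 2 * v x → W' c = ws v x 17 25 (fun _ => True) (fun _ => False) c →
      ∃ t ∈ nB, t.ab ((1 - 5 * v x) / 12) ((11 * v x - 2) / 12) v W' c := by
    intro W' c hge h2
    refine ws_elim (fun τ => W' c = τ → ∃ t ∈ nB, t.ab ((1 - 5 * v x) / 12) ((11 * v x - 2) / 12) v W' c)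
      ?_ ?_ ?_ ?_ ?_ ?_ ?_ ?_ ?_ ?_ ?_ ?_ ?_
    · exact fun a e => ⟨⟨24, 12, 17, false⟩, by simp [nB], abn (by rw [e]; norm_num) (by push_cast; linarith)⟩
    · exact fun _ _ e => e.elim
    · exact fun a b _ e => ⟨⟨27, 12, 18, true⟩, by simp [nB], abs' (by rw [e]; norm_num) (by push_cast; linarith)⟩
    · exact fun a b _ e => ⟨⟨33, 15, 19, true⟩, by simp [nB], abs' (by rw [e]; norm_num) (by push_cast; linarith)⟩
    · exact fun _ _ e => (e trivial).elim
    · exact fun a b e => ⟨⟨36, 16, 24, true⟩, by simp [nB], abs' (by rw [e]; norm_num) (by push_cast; linarith)⟩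
    · exact fun a b e => ⟨⟨39, 17, 25, true⟩, by simp [nB], abs' (by rw [e]; norm_num) (by push_cast; linarith)⟩
    · exact fun a b e => ⟨⟨42, 18, 26, true⟩, by simp [nB], abs' (by rw [e]; norm_num) (by push_cast; linarith)⟩
    · exact fun a b e => ⟨⟨44, 20, 29, true⟩, by simp [nB], abs' (by rw [e]; norm_num) (by push_cast; linarith)⟩
    · exact fun a b e => ⟨⟨45, 20, 30, true⟩, by simp [nB], abs' (by rw [e]; norm_num) (by push_cast; linarith)⟩
    · exact fun a b e => by linarith
    · exact fun a b e => by linarith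
    · exact fun a e => by linarith
  have hNb : ∀ c ∈ S, (∀ k ∈ R, c ≠ q k) → ∃ t ∈ kB, t.ab ((1 - 5 * v x) / 12) ((11 * v x - 2) / 12) v W c := by
    intro c hcS hcq
    have hge := h.ge c (hSM hcS)
    have hw := Wn c hcq
    by_cases hc2 : v c ≤ 2 * v x
    · obtain ⟨t, ht, hab⟩ := hN W c hge hc2 hw
      exact ⟨t, by simp [kB, ht], hab⟩
    · rw [not_le] at hc2
      by_cases hc3 : v c ≤ (1 - v x) / 2
      · exact ⟨⟨48, 24, 34, true⟩, by simp [kB], abs' (by rw [hw]; exact vsLp hx1 hx2 e1 e2 e3 e4 c hc3) (by push_cast; linarith)⟩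
      · by_cases hc4 : v c ≤ 1 / 2
        · exact ⟨⟨54, 24, 36, true⟩, by simp [kB], abs' (by rw [hw]; exact vsB hx1 hx2 e1 e2 e3 e4 c hc4) (by push_cast; linarith)⟩
        · exact ⟨⟨66, 30, 38, true⟩, by simp [kB], abs' (by rw [hw]; have := vsG (v := v) hx1 hx2 e1 e2 e3 e4 (hi := fun _ => True) (lo := fun _ => False) c; push_cast; linarith) (by push_cast; linarith)⟩
  have hY : ∀ k ∈ R, ∃ t ∈ nB, t.ab ((1 - 5 * v x) / 12) ((11 * v x - 2) / 12) v (ws v x 17 25 (fun _ => True) (fun _ => False)) (y k) :=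
    fun k hk => hN _ _ (h.ge _ (r.yM hk).1) (by linarith [r.o_lt h hk (Or.inl rfl), r.qx k hk]) rfl
  have hZ : ∀ k ∈ R, ∃ t ∈ nB, t.ab ((1 - 5 * v x) / 12) ((11 * v x - 2) / 12) v (ws v x 17 25 (fun _ => True) (fun _ => False)) (z k) :=
    fun k hk => hN _ _ (h.ge _ (r.zM hk).1) (by linarith [r.o_lt h hk (Or.inr rfl), r.qx k hk]) rfl
  have hnB : ∀ t ∈ nB, 24 ≤ t.a ∧ 12 ≤ t.b := by simp [nB]
  have hQ : ∀ k ∈ R, 1 / 2 < v (p k) → ∃ t ∈ kB, t.ab ((1 - 5 * v x) / 12) ((11 * v x - 2) / 12) v W (q k) := by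
    intro k hk hpk
    refine okG_sound r h hx1 hx2 hk kB1 hnB (by push_cast; linarith) (by push_cast; linarith [hq k hk]) ?_ (hY k hk) (hZ k hk)
    rw [Wq k hk, sp, if_neg (not_le.2 hpk)]; ring
  by_cases hs : ∃ k ∈ R, v (p k) ≤ 1 / 2 ∧ q k ∈ S
  · obtain ⟨k, hk, hpk, hqS⟩ := hs
    refine okS_sound r h hx1 hx2 hk kB2 hnB (by push_cast; linarith [r.pB k hk]) (by push_cast; linarith [hq k hk]) ?_
      (hY k hk) (hZ k hk) hqS hS0 hS1 ?_
    · rw [Wq k hk, sp, if_pos hpk]; push_cast; ring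
    · intro c hcS hck
      by_cases hcq : ∃ j ∈ R, c = q j
      · obtain ⟨j, hj, rfl⟩ := hcq
        refine hQ j hj ?_
        by_contra hpj
        exact hck (by rw [r.special_unique h hR hj hk (not_lt.1 hpj) (by linarith [r.qx j hj]) hpk (by linarith [r.qx k hk])])
      · push Not at hcq
        exact hNb c hcS hcq
  · push Not at hs
    refine chk_use hx1 hx2 kB0 hS0 hS1 ?_
    intro c hcS
    by_cases hcq : ∃ j ∈ R, c = q j
    · obtain ⟨j, hj, rfl⟩ := hcq
      refine hQ j hj ?_
      by_contra hpj
      exact hs j hj (not_lt.1 hpj) hcS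
    · push Not at hcq
      exact hNb c hcS hcq
end

section
variable {v : α → ℚ} {x : α} {M : Finset α} {K : Finset ℕ} {L : ℕ → List α} {D : Finset ℕ} {P : α → ℕ}
  {R : Finset ℕ} {p q y z : ℕ → α}

lemma RS.nonq (r : RS v x M K L P R p q y z) (h : Pk v x M K L D P) {k : ℕ} (hk : k ∈ K \ R) {c : α} (hc : c ∈ L k) :
    c ∈ M ∧ ∀ i ∈ R, c ≠ q i := by
  obtain ⟨h1, h2⟩ := mem_sdiff.1 hk
  refine ⟨(h.sub k h1 c hc).1, ?_⟩
  rintro i hi rfl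
  exact h2 (h.disj k h1 i (r.RK i hi) _ hc (r.qL hi) ▸ hi)

lemma scenC_LM (r : RS v x M K L P R p q y z) (h : Pk v x M K L D P) (hR : Red M P) (hx1 : 2 / 11 < v x) (hx2 : v x ≤ 1 / 5)
    (hq : ∃ i ∈ R, v (q i) ≤ (1 - v x) / 3) {hi lo : α → Prop} (hhi : ∀ c, hi c) (hlo : ∀ c, ¬ lo c) :
    ∑ k ∈ K \ R with (1 - v x) / 3 < v (tp L x k) ∧ v (tp L x k) ≤ (1 - v x) / 2, dl L (ws v x 16 24 hi lo) k ≤ 4 := by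
  have e1 : (16 : ℚ) ≤ 16 := by norm_num
  have e2 : (16 : ℚ) ≤ 17 := by norm_num
  have e3 : (24 : ℚ) ≤ 24 := by norm_num
  have e4 : (24 : ℚ) ≤ 26 := by norm_num
  have w1 := fun c => ws1 (x := x) (v := v) (hi := hi) (lo := lo) hx1 hx2 e1 e2 e3 e4 c
  have wT := fun c hc => wsT' (x := x) (v := v) (hi := hi) (lo := lo) hx1 hx2 e1 e2 e3 e4 c hc (hlo c)
  have w2 := fun c => wsM (x := x) (v := v) (hi := hi) (lo := lo) hx1 hx2 e1 e2 e3 e4 c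
  have w3 := fun c => wsL (x := x) (v := v) (hi := hi) (lo := lo) hx1 hx2 e1 e2 e3 e4 c
  have wLp := fun c => wsLp (x := x) (v := v) (hi := hi) (lo := lo) hx1 hx2 e1 e2 e3 e4 c
  have h0 := wsum_nonneg (by norm_num) w1
  have key : ∀ k ∈ K \ R, ∀ c ∈ L k, (1 - v x) / 3 < v c → 2 * v x < v c := by
    intro k hk c hc h1
    by_contra hcon
    obtain ⟨i, hiR, hqi⟩ := hq
    obtain ⟨g1, g2⟩ := r.nonq h hk hc
    have := r.F4 h hR g1 g2 (by linarith) (not_lt.1 hcon) hiR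
    linarith
  refine ffd_LM h hR hx1 hx2 (u := 16) e1 (by norm_num) w1 w2 w3 ?_ ?_ ?_
  · intro k hk a b c l hL h1 h2 h3 h4 h5
    have := wLp a (key k hk a (by simp [hL]) (by linarith))
    have hb : v b ≤ (1 - v x) / 3 := by
      by_contra hb
      have := key k hk b (by simp [hL]) (not_le.1 hb)
      linarith
    have := w1 b
    have := w1 c
    have := h0 l
    cases l with
    | nil =>
      simp only [List.map_cons, List.sum_cons, List.map_nil, List.sum_nil] at h5
      have := wT b (by linarith)
      simp only [dl, hL, List.map_cons, List.sum_cons, List.map_nil, List.sum_nil]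
      linarith
    | cons d l =>
      have := w1 d
      have := h0 l
      simp only [dl, hL, List.map_cons, List.sum_cons]
      linarith
  · intro k hk j hj hkj h1 h2 a b c l hL h3 h4 h5 h6 h7 h8
    have := key k hk b (by simp [hL]) h5
    linarith
  · intro k hk a b c l hL h1 h2 h3 h4 h5 h6
    have := key k hk a (by simp [hL]) h1
    linarith

lemma scenC (r : RS v x M K L P R p q y z) (h : Pk v x M K L D P) (hR : Red M P)
    (hc : 11 * D.card ≤ 9 * K.card) (hx1 : 2 / 11 < v x) (hx2 : v x ≤ 1 / 5) (hq : ∃ i ∈ R, v (q i) ≤ (1 - v x) / 3) : False := by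
  have e1 : (16 : ℚ) ≤ 16 := by norm_num
  have e2 : (16 : ℚ) ≤ 17 := by norm_num
  have e3 : (24 : ℚ) ≤ 24 := by norm_num
  have e4 : (24 : ℚ) ≤ 26 := by norm_num
  refine r.fwR h hR hc (ws v x 16 24 (fun _ => True) (fun _ => False)) (fun _ => 0) ?_ ?_
  swap
  · rw [ffd_all r h]
    have t1 := (ffd_top r h hR hx2 (w := ws v x 16 24 (fun _ => True) (fun _ => False)) (u := 16) (by norm_num) (by norm_num)
      (ws1 hx1 hx2 e1 e2 e3 e4) (wsLp hx1 hx2 e1 e2 e3 e4)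
      (wsB hx1 hx2 e1 e2 e3 e4) (wsG hx1 hx2 e1 e2 e3 e4)).1
    have t2 := scenC_LM r h hR hx1 hx2 hq (hi := fun _ => True) (lo := fun _ => False) (by simp) (by simp)
    have t3 := ST_all (R := R) h hR hx1 hx2 e1 e2 e3 e4 (hi := fun _ => True) (lo := fun _ => False) (by simp) (by simp)
    have t4 := ws1 (v := v) hx1 hx2 e1 e2 e3 e4 (hi := fun _ => True) (lo := fun _ => False) x
    simp only [sum_const_zero]
    linarith
  intro W Wq Wn S hSM hS0 hnp hS1 h3
  have hN : ∀ (W' : α → ℚ) c, c ∈ M → (∀ k ∈ R, c ≠ q k) → v c ≤ 2 * v x → W' c = ws v x 16 24 (fun _ => True) (fun _ => False) c →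
      ∃ t ∈ nC, t.ab ((1 - 5 * v x) / 12) ((11 * v x - 2) / 12) v W' c := by
    intro W' c hcM hcq h2
    have hge := h.ge c hcM
    have hle : v c ≤ (1 - v x) / 3 := by
      obtain ⟨i, hiR, hqi⟩ := hq
      linarith [r.F4 h hR hcM hcq (by linarith) h2 hiR]
    refine ws_elim (fun τ => W' c = τ → ∃ t ∈ nC, t.ab ((1 - 5 * v x) / 12) ((11 * v x - 2) / 12) v W' c)
      ?_ ?_ ?_ ?_ ?_ ?_ ?_ ?_ ?_ ?_ ?_ ?_ ?_
    · exact fun a e => ⟨⟨24, 12, 16, false⟩, by simp [nC], abn (by rw [e]; norm_num) (by push_cast; linarith)⟩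
    · exact fun _ _ e => e.elim
    · exact fun a b _ e => ⟨⟨27, 12, 18, true⟩, by simp [nC], abs' (by rw [e]; norm_num) (by push_cast; linarith)⟩
    · exact fun a b _ e => ⟨⟨33, 15, 19, true⟩, by simp [nC], abs' (by rw [e]; norm_num) (by push_cast; linarith)⟩
    · exact fun _ _ e => (e trivial).elim
    all_goals intros; linarith
  have hNb : ∀ c ∈ S, (∀ k ∈ R, c ≠ q k) → ∃ t ∈ kC, t.ab ((1 - 5 * v x) / 12) ((11 * v x - 2) / 12) v W c := by
    intro c hcS hcq
    have hw := Wn c hcq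
    by_cases hc2 : v c ≤ 2 * v x
    · obtain ⟨t, ht, hab⟩ := hN W c (hSM hcS) hcq hc2 hw
      refine ⟨t, ?_, hab⟩
      simp only [nC, kC, List.mem_cons, List.not_mem_nil, or_false] at ht ⊢
      tauto
    · rw [not_le] at hc2
      by_cases hc3 : v c ≤ (1 - v x) / 2
      · exact ⟨⟨48, 24, 34, true⟩, by simp [kC], abs' (by rw [hw]; exact vsLp hx1 hx2 e1 e2 e3 e4 c hc3) (by push_cast; linarith)⟩
      · by_cases hc4 : v c ≤ 1 / 2
        · exact ⟨⟨54, 24, 36, true⟩, by simp [kC], abs' (by rw [hw]; exact vsB hx1 hx2 e1 e2 e3 e4 c hc4) (by push_cast; linarith)⟩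
        · exact ⟨⟨66, 30, 40, true⟩, by simp [kC], abs' (by rw [hw]; have := vsG (v := v) hx1 hx2 e1 e2 e3 e4 (hi := fun _ => True) (lo := fun _ => False) c; push_cast; linarith) (by push_cast; linarith)⟩
  have hO : ∀ k ∈ R, ∀ o, o = y k ∨ o = z k → o ∈ M → ∃ t ∈ nC, t.ab ((1 - 5 * v x) / 12) ((11 * v x - 2) / 12) v (ws v x 16 24 (fun _ => True) (fun _ => False)) o :=
    fun k hk o ho hoM => hN _ _ hoM (fun i hi => r.o_ne_q h hR hk hi ho) (by linarith [r.o_lt h hk ho, r.qx k hk]) rfl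
  refine chk_use hx1 hx2 kC0 hS0 hS1 ?_
  intro c hcS
  by_cases hcq : ∃ j ∈ R, c = q j
  · obtain ⟨k, hk, rfl⟩ := hcq
    refine okG_sound r h hx1 hx2 hk kCq (by simp [nC]) (by push_cast; linarith [r.pB k hk]) ?_ ?_
      (hO k hk _ (Or.inl rfl) (r.yM hk).1) (hO k hk _ (Or.inr rfl) (r.zM hk).1)
    · have := r.o_lt h hk (Or.inl rfl)
      have := h.ge _ (r.yM hk).1
      push_cast; linarith
    · rw [Wq k hk]; ring
  · push Not at hcq
    exact hNb c hcS hcq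
end

section
variable {v : α → ℚ} {x : α} {M : Finset α} {K : Finset ℕ} {L : ℕ → List α} {D : Finset ℕ} {P : α → ℕ}
  {R : Finset ℕ} {p q y z : ℕ → α}

lemma scenA_opt (r : RS v x M K L P R p q y z) (h : Pk v x M K L D P) (hR : Red M P)
    (hc : 11 * D.card ≤ 9 * K.card) (hx1 : 2 / 11 < v x) (hx2 : v x ≤ 1 / 5) (hq : ∃ i ∈ R, v (q i) ≤ 1 / 3)
    (hqs : ∀ k ∈ R, (1 - v x) / 3 < v (q k)) (hi lo : α → Prop)
    (hinf : ∀ s t, 1 / 4 < v s → hi s → t ∈ M → (1 - v x) / 4 < v t → v t ≤ 1 / 4 → ¬ lo t →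
      ∀ i ∈ R, ∀ j ∈ R, 1 < v (q i) + v (q j) + v s + v t)
    (hF : ∑ k ∈ K \ R with (1 - v x) / 3 < v (tp L x k) ∧ v (tp L x k) ≤ (1 - v x) / 2, dl L (ws v x 17 24 hi lo) k +
      ∑ k ∈ K \ R with v (tp L x k) ≤ (1 - v x) / 3, dl L (ws v x 17 24 hi lo) k ≤ 14) : False := by
  have e1 : (16 : ℚ) ≤ 17 := by norm_num
  have e2 : (17 : ℚ) ≤ 17 := by norm_num
  have e3 : (24 : ℚ) ≤ 24 := by norm_num
  have e4 : (24 : ℚ) ≤ 26 := by norm_num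
  refine r.fwR h hR hc (ws v x 17 24 hi lo) (sp v p) ?_ ?_
  swap
  · rw [ffd_all r h]
    have t1 := top_e r h hR hx1 hx2 e3 e4 (hi := hi) (lo := lo)
    have t4 := ws1 (v := v) hx1 hx2 e1 e2 e3 e4 (hi := hi) (lo := lo) x
    linarith
  intro W Wq Wn S hSM hS0 hnp hS1 h3
  have h13 : ∀ c, c ∈ M → (∀ k ∈ R, c ≠ q k) → v c ≤ 2 * v x → v c ≤ 1 / 3 := by
    intro c hcM hcq h2
    obtain ⟨i, hiR, hqi⟩ := hq
    linarith [r.F4 h hR hcM hcq (by linarith) h2 hiR]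
  have hN : ∀ (ls : List Lv) (W' : α → ℚ) c, c ∈ M → (∀ k ∈ R, c ≠ q k) → v c ≤ 2 * v x → W' c = ws v x 17 24 hi lo c →
      (⟨24, 12, 17, false⟩ : Lv) ∈ ls → ((⟨27, 12, 18, true⟩ : Lv) ∈ ls ∨ (⟨33, 15, 19, true⟩ : Lv) ∈ ls) →
      ((1 - v x) / 4 < v c → v c ≤ 1 / 4 → ¬ lo c → (⟨27, 12, 18, true⟩ : Lv) ∈ ls) →
      (1 / 4 < v c → v c ≤ (1 - v x) / 3 → hi c → (⟨33, 15, 19, true⟩ : Lv) ∈ ls) →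
      (⟨36, 16, 24, true⟩ : Lv) ∈ ls → (⟨42, 18, 26, true⟩ : Lv) ∈ ls →
      ∃ t ∈ ls, t.ab ((1 - 5 * v x) / 12) ((11 * v x - 2) / 12) v W' c := by
    intro ls W' c hcM hcq h2 hw l1 l2 l3 l4 l5 l6
    have hge := h.ge c hcM
    have hle := h13 c hcM hcq h2
    revert hw
    refine ws_elim (fun τ => W' c = τ → ∃ t ∈ ls, t.ab ((1 - 5 * v x) / 12) ((11 * v x - 2) / 12) v W' c)
      ?_ ?_ ?_ ?_ ?_ ?_ ?_ ?_ ?_ ?_ ?_ ?_ ?_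
    · exact fun a e => ⟨_, l1, abn (by rw [e]; norm_num) (by push_cast; linarith)⟩
    · exact fun _ _ _ e => ⟨_, l1, abn (by rw [e]; norm_num) (by push_cast; linarith)⟩
    · exact fun a b f e => ⟨_, l3 a b f, abs' (by rw [e]; norm_num) (by push_cast; linarith)⟩
    · exact fun a b f e => ⟨_, l4 a b f, abs' (by rw [e]; norm_num) (by push_cast; linarith)⟩
    · intro a b f e
      rcases l2 with l2 | l2
      · exact ⟨_, l2, abs' (by rw [e]; norm_num) (by push_cast; linarith)⟩
      · exact ⟨_, l2, abs' (by rw [e]; norm_num) (by push_cast; linarith)⟩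
    · exact fun a b e => ⟨_, l5, abs' (by rw [e]; norm_num) (by push_cast; linarith)⟩
    · exact fun a b e => ⟨_, l5, abs' (by rw [e]; norm_num) (by push_cast; linarith)⟩
    · exact fun a b e => ⟨_, l6, abs' (by rw [e]; norm_num) (by push_cast; linarith)⟩
    all_goals intros; linarith
  have hNb : ∀ (ls : List Lv), ∀ c ∈ S, (∀ k ∈ R, c ≠ q k) →
      (⟨24, 12, 17, false⟩ : Lv) ∈ ls → ((⟨27, 12, 18, true⟩ : Lv) ∈ ls ∨ (⟨33, 15, 19, true⟩ : Lv) ∈ ls) →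
      ((1 - v x) / 4 < v c → v c ≤ 1 / 4 → ¬ lo c → (⟨27, 12, 18, true⟩ : Lv) ∈ ls) →
      (1 / 4 < v c → v c ≤ (1 - v x) / 3 → hi c → (⟨33, 15, 19, true⟩ : Lv) ∈ ls) →
      (∀ t ∈ bigs, t ∈ ls) →
      ∃ t ∈ ls, t.ab ((1 - 5 * v x) / 12) ((11 * v x - 2) / 12) v W c := by
    intro ls c hcS hcq l1 l2 l3 l4 l5
    have hw := Wn c hcq
    by_cases hc2 : v c ≤ 2 * v x
    · exact hN ls W c (hSM hcS) hcq hc2 hw l1 l2 l3 l4 (l5 _ (by simp [bigs])) (l5 _ (by simp [bigs]))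
    · rw [not_le] at hc2
      by_cases hc3 : v c ≤ (1 - v x) / 2
      · exact ⟨⟨48, 24, 34, true⟩, l5 _ (by simp [bigs]), abs' (by rw [hw]; exact vsLp hx1 hx2 e1 e2 e3 e4 c hc3) (by push_cast; linarith)⟩
      · by_cases hc4 : v c ≤ 1 / 2
        · exact ⟨⟨54, 24, 36, true⟩, l5 _ (by simp [bigs]), abs' (by rw [hw]; exact vsB hx1 hx2 e1 e2 e3 e4 c hc4) (by push_cast; linarith)⟩
        · exact ⟨⟨66, 30, 38, true⟩, l5 _ (by simp [bigs]), abs' (by rw [hw]; have := vsG (v := v) hx1 hx2 e1 e2 e3 e4 (hi := hi) (lo := lo) c; push_cast; linarith) (by push_cast; linarith)⟩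
  have hO : ∀ k ∈ R, ∀ o, o = y k ∨ o = z k → o ∈ M → ∃ t ∈ nA, t.ab ((1 - 5 * v x) / 12) ((11 * v x - 2) / 12) v (ws v x 17 24 hi lo) o :=
    fun k hk o ho hoM => hN nA _ _ hoM (fun i hi => r.o_ne_q h hR hk hi ho) (by linarith [r.o_lt h hk ho, r.qx k hk]) rfl
      (by simp [nA]) (by simp [nA]) (by simp [nA]) (by simp [nA]) (by simp [nA]) (by simp [nA])
  have hY : ∀ k ∈ R, _ := fun k hk => hO k hk _ (Or.inl rfl) (r.yM hk).1
  have hZ : ∀ k ∈ R, _ := fun k hk => hO k hk _ (Or.inr rfl) (r.zM hk).1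
  have hnA : ∀ t ∈ nA, 24 ≤ t.a ∧ 12 ≤ t.b := by simp [nA]
  have hQ : ∀ k ∈ R, 1 / 2 < v (p k) → ∃ t ∈ qA, t.ab ((1 - 5 * v x) / 12) ((11 * v x - 2) / 12) v W (q k) := by
    intro k hk hpk
    refine okG_sound r h hx1 hx2 hk kAq hnA (by push_cast; linarith) (by push_cast; linarith [hqs k hk]) ?_ (hY k hk) (hZ k hk)
    rw [Wq k hk, sp, if_neg (not_le.2 hpk)]; ring
  have hSp : ∀ ls, okS 54 24 36 16 2 ls nA = true → ∀ k ∈ R, v (p k) ≤ 1 / 2 → q k ∈ S →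
      (∀ c ∈ S, c ≠ q k → ∃ t ∈ ls, t.ab ((1 - 5 * v x) / 12) ((11 * v x - 2) / 12) v W c) → ∑ c ∈ S, W c ≤ 88 := by
    intro ls hls k hk hpk hqS hh
    refine okS_sound r h hx1 hx2 hk hls hnA (by push_cast; linarith [r.pB k hk]) (by push_cast; linarith [hqs k hk]) ?_
      (hY k hk) (hZ k hk) hqS hS0 hS1 hh
    rw [Wq k hk, sp, if_pos hpk]; push_cast; ring
  have hfin : ∀ ls, chk 40 ls false 132 60 0 = true → okS 54 24 36 16 2 ls nA = true → (∀ t ∈ qA, t ∈ ls) →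
      (∀ c ∈ S, (∀ k ∈ R, c ≠ q k) → ∃ t ∈ ls, t.ab ((1 - 5 * v x) / 12) ((11 * v x - 2) / 12) v W c) → ∑ c ∈ S, W c ≤ 88 := by
    intro ls o1 o2 o3 hn
    have hQ' : ∀ k ∈ R, 1 / 2 < v (p k) → ∃ t ∈ ls, t.ab ((1 - 5 * v x) / 12) ((11 * v x - 2) / 12) v W (q k) := by
      intro k hk hpk
      obtain ⟨t, ht, hab⟩ := hQ k hk hpk
      exact ⟨t, o3 t ht, hab⟩
    by_cases hs : ∃ k ∈ R, v (p k) ≤ 1 / 2 ∧ q k ∈ S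
    · obtain ⟨k, hk, hpk, hqS⟩ := hs
      refine hSp ls o2 k hk hpk hqS ?_
      intro c hcS hck
      by_cases hcq : ∃ j ∈ R, c = q j
      · obtain ⟨j, hj, rfl⟩ := hcq
        refine hQ' j hj ?_
        by_contra hpj
        exact hck (by rw [r.special_unique h hR hj hk (not_lt.1 hpj) (by linarith [r.qx j hj]) hpk (by linarith [r.qx k hk])])
      · push Not at hcq
        exact hn c hcS hcq
    · push Not at hs
      refine chk_use hx1 hx2 o1 hS0 hS1 ?_
      intro c hcS
      by_cases hcq : ∃ j ∈ R, c = q j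
      · obtain ⟨j, hj, rfl⟩ := hcq
        refine hQ' j hj ?_
        by_contra hpj
        exact hs j hj (not_lt.1 hpj) hcS
      · push Not at hcq
        exact hn c hcS hcq
  by_cases hs : ∃ s ∈ S, (∀ k ∈ R, s ≠ q k) ∧ 1 / 4 < v s ∧ v s ≤ (1 - v x) / 3 ∧ hi s
  swap
  · refine hfin kA1 kA10 kA1s (by simp [kA1, qA, bigs]) fun c hcS hcq => ?_
    refine hNb kA1 c hcS hcq (by simp [kA1]) (by simp [kA1]) (by simp [kA1]) ?_ (by simp [kA1, bigs])
    exact fun a b e => (hs ⟨c, hcS, hcq, a, b, e⟩).elim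
  by_cases ht : ∃ t ∈ S, (∀ k ∈ R, t ≠ q k) ∧ (1 - v x) / 4 < v t ∧ v t ≤ 1 / 4 ∧ ¬ lo t
  swap
  · refine hfin kA2 kA20 kA2s (by simp [kA2, qA, bigs]) fun c hcS hcq => ?_
    refine hNb kA2 c hcS hcq (by simp [kA2]) (by simp [kA2]) ?_ (by simp [kA2]) (by simp [kA2, bigs])
    exact fun a b e => (ht ⟨c, hcS, hcq, a, b, e⟩).elim
  obtain ⟨s, hsS, hsq, hs1, hs2, hs3⟩ := hs
  obtain ⟨t, htS, htq, ht1, ht2, ht3⟩ := ht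
  have huniq : ∀ i ∈ R, q i ∈ S → ∀ j ∈ R, q j ∈ S → q i = q j := by
    intro i hi' hiS j hj hjS
    by_contra hne
    have := hinf s t hs1 hs3 (hSM htS) ht1 ht2 ht3 i hi' j hj
    have hst : s ≠ t := by rintro rfl; linarith
    have hsub : ({q i, q j, s, t} : Finset α) ⊆ S := by
      intro c hc
      simp only [mem_insert, mem_singleton] at hc
      rcases hc with rfl | rfl | rfl | rfl <;> assumption
    have hsum := sum_le_sum_of_subset_of_nonneg hsub (f := v) (fun c hc _ => hS0 c hc)
    rw [sum_insert, sum_insert, sum_insert, sum_singleton] at hsum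
    · linarith
    · simpa using hst
    · simp only [mem_insert, mem_singleton, not_or]
      exact ⟨(hsq j hj).symm, (htq j hj).symm⟩
    · simp only [mem_insert, mem_singleton, not_or]
      exact ⟨hne, (hsq i hi').symm, (htq i hi').symm⟩
  have hn3 : ∀ c ∈ S, (∀ k ∈ R, c ≠ q k) → ∃ t ∈ kA3, t.ab ((1 - 5 * v x) / 12) ((11 * v x - 2) / 12) v W c :=
    fun c hcS hcq => hNb kA3 c hcS hcq (by simp [kA3]) (by simp [kA3]) (by simp [kA3]) (by simp [kA3]) (by simp [kA3, bigs])
  by_cases hqS : ∃ k ∈ R, q k ∈ S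
  swap
  · refine chk_use hx1 hx2 kA30 hS0 hS1 fun c hcS => hn3 c hcS ?_
    rintro k hk rfl
    exact hqS ⟨k, hk, hcS⟩
  obtain ⟨k, hk, hkS⟩ := hqS
  have hoth : ∀ c ∈ S, c ≠ q k → ∃ t ∈ kA3, t.ab ((1 - 5 * v x) / 12) ((11 * v x - 2) / 12) v W c := by
    intro c hcS hck
    refine hn3 c hcS ?_
    rintro j hj rfl
    exact hck (huniq j hj hcS k hk hkS)
  by_cases hpk : v (p k) ≤ 1 / 2
  · exact hSp kA3 kA3s k hk hpk hkS hoth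
  · obtain ⟨l, hl, hab⟩ := hQ k hk (not_le.1 hpk)
    have hA : 0 ≤ (1 - 5 * v x) / 12 := by linarith
    have hB : 0 < (11 * v x - 2) / 12 := by linarith
    have hbd : bd false (∑ c ∈ S, v c) ((132 : ℕ) * ((1 - 5 * v x) / 12) + (60 : ℕ) * ((11 * v x - 2) / 12)) := by
      refine ⟨?_, by simp⟩
      push_cast; linarith
    simp only [qA, List.mem_cons, List.not_mem_nil, or_false] at hl
    rcases hl with rfl | rfl
    · have := chk1_sound hA hB kA3q.1 hkS hab hS0 hoth hbd
      simpa using this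
    · have := chk1_sound hA hB kA3q.2 hkS hab hS0 hoth hbd
      simpa using this

/-- bins with a medium top -/
def M3 (v : α → ℚ) (x : α) (L : ℕ → List α) (k : ℕ) (a b c : α) : Prop :=
  L k = [a, b, c] ∧ (1 - v x) / 3 < v a ∧ v a ≤ 1 / 3 ∧ v b ≤ (1 - v x) / 3 ∧
      v c ≤ v b ∧ (1 - v x) / 4 < v c ∧ 1 < v a + v b + v c + v x

lemma scenA_LM (r : RS v x M K L P R p q y z) (h : Pk v x M K L D P) (hR : Red M P) (hx1 : 2 / 11 < v x) (hx2 : v x ≤ 1 / 5)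
    (hq : ∃ i ∈ R, v (q i) ≤ 1 / 3) {hi lo : α → Prop} {DM : ℚ} (hDM : 7 ≤ DM)
    (H : ∀ k ∈ K \ R, ∀ a b c, M3 v x L k a b c → dl L (ws v x 17 24 hi lo) k ≤ DM) :
    ∑ k ∈ K \ R with (1 - v x) / 3 < v (tp L x k) ∧ v (tp L x k) ≤ (1 - v x) / 2, dl L (ws v x 17 24 hi lo) k ≤ DM := by
  have e1 : (16 : ℚ) ≤ 17 := by norm_num
  have e2 : (17 : ℚ) ≤ 17 := by norm_num
  have e3 : (24 : ℚ) ≤ 24 := by norm_num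
  have e4 : (24 : ℚ) ≤ 26 := by norm_num
  have w1 := fun c => ws1 (x := x) (v := v) (hi := hi) (lo := lo) hx1 hx2 e1 e2 e3 e4 c
  have w2 := fun c => wsM (x := x) (v := v) (hi := hi) (lo := lo) hx1 hx2 e1 e2 e3 e4 c
  have w3 := fun c => wsL (x := x) (v := v) (hi := hi) (lo := lo) hx1 hx2 e1 e2 e3 e4 c
  have wLp := fun c => wsLp (x := x) (v := v) (hi := hi) (lo := lo) hx1 hx2 e1 e2 e3 e4 c
  have h0 := wsum_nonneg (by norm_num) w1
  have key : ∀ k ∈ K \ R, ∀ c ∈ L k, 1 / 3 < v c → 2 * v x < v c := by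
    intro k hk c hc h1
    by_contra hcon
    obtain ⟨i, hiR, hqi⟩ := hq
    obtain ⟨g1, g2⟩ := r.nonq h hk hc
    have := r.F4 h hR g1 g2 (by linarith) (not_lt.1 hcon) hiR
    linarith
  refine ffd_LM h hR hx1 hx2 (u := 17) e1 (by linarith) w1 w2 w3 ?_ ?_ ?_
  · intro k hk a b c l hL h1 h2 h3 h4 h5
    have := wLp a (key k hk a (by simp [hL]) h1)
    have := w1 b
    have := w1 c
    have := h0 l
    simp only [dl, hL, List.map_cons, List.sum_cons]
    linarith
  · intro k hk j hj hkj h1 h2 a b c l hL h3 h4 h5 h6 h7 h8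
    have := wLp a (key k hk a (by simp [hL]) h3)
    have := w2 b h5
    have := w1 c
    have := h0 l
    simp only [dl, hL, List.map_cons, List.sum_cons] at h8
    linarith
  · intro k hk a b c l hL h1 h2 h3 h4 h5 h6
    rcases m3_or (hi := hi) (lo := lo) h hR hx1 hx2 e3 e4 (mem_sdiff.1 hk).1 (by rwa [tp_eq hL]) (by rwa [tp_eq hL]) with e | ⟨a, b, c, hh⟩
    · linarith
    · exact H k hk a b c hh

/-- bound using a medium bin -/
lemma M3_inf (r : RS v x M K L P R p q y z) (h : Pk v x M K L D P) (hR : Red M P) (hx1 : 2 / 11 < v x) (hx2 : v x ≤ 1 / 5)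
    (hqs : ∀ k ∈ R, (1 - v x) / 3 < v (q k)) {k : ℕ} (hk : k ∈ K \ R) {a b c : α} (hM : M3 v x L k a b c) {s t : α}
    (hs : v c ≤ v s) (ht : t ∈ M) {i j : ℕ} (hi : i ∈ R) (hj : j ∈ R) : 1 < v (q i) + v (q j) + v s + v t := by
  obtain ⟨h1, h2, h3, h4, h5, h6, h7⟩ := hM
  obtain ⟨g1, g2⟩ := r.nonq h hk (c := a) (by simp [h1])
  have := r.F4 h hR g1 g2 (by linarith) (by linarith) hi
  have := hqs j hj
  have := h.ge t ht
  linarith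

lemma scenA1 (r : RS v x M K L P R p q y z) (h : Pk v x M K L D P) (hR : Red M P)
    (hc : 11 * D.card ≤ 9 * K.card) (hx1 : 2 / 11 < v x) (hx2 : v x ≤ 1 / 5) (hq : ∃ i ∈ R, v (q i) ≤ 1 / 3)
    (hqs : ∀ k ∈ R, (1 - v x) / 3 < v (q k)) (hm : ∃ k ∈ K \ R, ∃ a b c, M3 v x L k a b c ∧ v c ≤ 1 / 4) : False := by
  have e1 : (16 : ℚ) ≤ 17 := by norm_num
  have e2 : (17 : ℚ) ≤ 17 := by norm_num
  have e3 : (24 : ℚ) ≤ 24 := by norm_num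
  have e4 : (24 : ℚ) ≤ 26 := by norm_num
  refine scenA_opt r h hR hc hx1 hx2 hq hqs (fun _ => True) (fun _ => False) ?_ ?_
  · intro s t hs _ ht _ _ _ i hi j hj
    obtain ⟨k, hk, a, b, c, hM, hc4⟩ := hm
    exact M3_inf r h hR hx1 hx2 hqs hk hM (by linarith) ht hi hj
  · have t3 := ST_all (R := R) h hR hx1 hx2 e1 e2 e3 e4 (hi := fun _ => True) (lo := fun _ => False) (by simp) (by simp)
    have t2 := scenA_LM r h hR hx1 hx2 hq (hi := fun _ => True) (lo := fun _ => False) (DM := 11) (by norm_num) (by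
      rintro k hk a b c ⟨hL, h1, h2, h3, h4, h5, h6⟩
      have w2 := fun c => wsM (x := x) (v := v) (hi := fun _ => True) (lo := fun _ => False) hx1 hx2 e1 e2 e3 e4 c
      have wM3 := fun c => wsM3 (x := x) (v := v) (hi := fun _ => True) (lo := fun _ => False) hx1 hx2 e1 e2 e3 e4 c
      have wS := fun c hc => wsS' (x := x) (v := v) (hi := fun _ => True) (lo := fun _ => False) hx1 hx2 e1 e2 e3 e4 c hc trivial
      have wT := fun c hc => wsT' (x := x) (v := v) (hi := fun _ => True) (lo := fun _ => False) hx1 hx2 e1 e2 e3 e4 c hc id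
      simp only [dl, hL, List.map_cons, List.sum_cons, List.map_nil, List.sum_nil]
      have := w2 a h1
      have := wT c h5
      by_cases hb : 1 / 4 < v b
      · have := wS b hb
        linarith
      · have := wT b (by linarith)
        have := wM3 a (by linarith)
        linarith)
    linarith

/-- bins with three large-ish items and a tiny one -/
def FB (v : α → ℚ) (x : α) (L : ℕ → List α) (K R : Finset ℕ) (k : ℕ) : Prop :=
  k ∈ K \ R ∧ ∃ a b c d, L k = [a, b, c, d] ∧ v a ≤ (1 - v x) / 3 ∧ v b ≤ v a ∧ v c ≤ v b ∧ 1 / 4 < v c ∧ v d ≤ (1 - v x) / 4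
/-- third value -/
def th (v : α → ℚ) (x : α) (L : ℕ → List α) (k : ℕ) : ℚ := v ((L k).getD 2 x)
/-- minimal such bins -/
def Fs (v : α → ℚ) (x : α) (L : ℕ → List α) (K R : Finset ℕ) (k : ℕ) : Prop :=
  FB v x L K R k ∧ ∀ j, FB v x L K R j → th v x L k ≤ th v x L j
/-- high items -/
def hi2 (v : α → ℚ) (x : α) (L : ℕ → List α) (K R : Finset ℕ) (s : α) : Prop :=
  (∃ k ∈ K \ R, ∃ a b c, M3 v x L k a b c ∧ v c ≤ v s) ∨ ∃ k, FB v x L K R k ∧ th v x L k ≤ v s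
/-- low items -/
def lo2 (v : α → ℚ) (x : α) (L : ℕ → List α) (K R : Finset ℕ) (t : α) : Prop :=
  ∃ i, Fs v x L K R i ∧ ∃ j ∈ K, j < i ∧ t ∈ L j

lemma exists_Fs {k : ℕ} (hk : FB v x L K R k) : ∃ i, Fs v x L K R i ∧ th v x L i ≤ th v x L k := by
  classical
  obtain ⟨i, hi, hmin⟩ := exists_min_image ((K \ R).filter (FB v x L K R)) (th v x L) ⟨k, mem_filter.2 ⟨hk.1, hk⟩⟩
  exact ⟨i, ⟨(mem_filter.1 hi).2, fun j hj => hmin j (mem_filter.2 ⟨hj.1, hj⟩)⟩, hmin k (mem_filter.2 ⟨hk.1, hk⟩)⟩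

lemma scenA2 (r : RS v x M K L P R p q y z) (h : Pk v x M K L D P) (hR : Red M P)
    (hc : 11 * D.card ≤ 9 * K.card) (hx1 : 2 / 11 < v x) (hx2 : v x ≤ 1 / 5) (hq : ∃ i ∈ R, v (q i) ≤ 1 / 3)
    (hqs : ∀ k ∈ R, (1 - v x) / 3 < v (q k)) (hm : ∀ k ∈ K \ R, ∀ a b c, M3 v x L k a b c → 1 / 4 < v c) : False := by
  have e1 : (16 : ℚ) ≤ 17 := by norm_num
  have e2 : (17 : ℚ) ≤ 17 := by norm_num
  have e3 : (24 : ℚ) ≤ 24 := by norm_num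
  have e4 : (24 : ℚ) ≤ 26 := by norm_num
  have w1 := fun c => ws1 (x := x) (v := v) (hi := hi2 v x L K R) (lo := lo2 v x L K R) hx1 hx2 e1 e2 e3 e4 c
  have w2 := fun c => wsM (x := x) (v := v) (hi := hi2 v x L K R) (lo := lo2 v x L K R) hx1 hx2 e1 e2 e3 e4 c
  have wS := fun c => wsS' (x := x) (v := v) (hi := hi2 v x L K R) (lo := lo2 v x L K R) hx1 hx2 e1 e2 e3 e4 c
  have wS0 := fun c => wsS (x := x) (v := v) (hi := hi2 v x L K R) (lo := lo2 v x L K R) hx1 hx2 e1 e2 e3 e4 c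
  have wT := fun c => wsT' (x := x) (v := v) (hi := hi2 v x L K R) (lo := lo2 v x L K R) hx1 hx2 e1 e2 e3 e4 c
  have h0 := wsum_nonneg (by norm_num) w1
  refine scenA_opt r h hR hc hx1 hx2 hq hqs (hi2 v x L K R) (lo2 v x L K R) ?_ ?_
  · rintro s t hs (⟨k, hk, a, b, c, hM, hcs⟩ | ⟨k, hk, hks⟩) htM ht1 ht2 hlo i hi j hj
    · exact M3_inf r h hR hx1 hx2 hqs hk hM hcs htM hi hj
    · obtain ⟨m, hm, hmk⟩ := exists_Fs hk
      have hm' := hm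
      obtain ⟨⟨hmK, a, b, c, d, hL, f1, f2, f3, f4, f5⟩, -⟩ := hm'
      have hthm : th v x L m = v c := by simp [th, hL]
      have hmK' := (mem_sdiff.1 hmK).1
      obtain ⟨a', b', c', d', l, hL', hta, -, -, -, -, -, -, g4, -⟩ := h.i4 hR hmK' (by rw [tp_eq hL]; exact f1)
      rw [hL] at hL'
      simp only [List.cons.injEq] at hL'
      obtain ⟨rfl, rfl, rfl, rfl, -⟩ := hL'
      have hrem : h.rem m t := by
        refine ⟨htM, fun n hn hnm htn => ?_⟩
        rcases hnm.lt_or_eq with e | rfl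
        · exact hlo ⟨m, hm, n, hn, e, htn⟩
        · rw [hL] at htn
          simp only [List.mem_cons, List.not_mem_nil, or_false] at htn
          rcases htn with rfl | rfl | rfl | rfl <;> linarith
      have := hqs i hi
      have := hqs j hj
      by_contra hcon
      have := g4 t hrem (by linarith)
      linarith
  have t2 := scenA_LM r h hR hx1 hx2 hq (hi := hi2 v x L K R) (lo := lo2 v x L K R) (DM := 10) (by norm_num) (by
    intro k hk a b c hM
    have hc4 := hm k hk a b c hM
    have hM' := hM
    obtain ⟨hL, h1, h2, h3, h4, h5, h6⟩ := hM'
    have := w2 a h1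
    have := wS b (by linarith) (Or.inl ⟨k, hk, a, b, c, hM, h4⟩)
    have := wS c hc4 (Or.inl ⟨k, hk, a, b, c, hM, le_rfl⟩)
    simp only [dl, hL, List.map_cons, List.sum_cons, List.map_nil, List.sum_nil]
    linarith)
  have lo_later : ∀ k ∈ K \ R, ∀ t ∈ L k, lo2 v x L K R t → ∃ i a b c d, Fs v x L K R i ∧ L i = [a, b, c, d] ∧ h.rem k a ∧ h.rem k c ∧
      v c ≤ (1 - v x) / 3 ∧ 1 / 4 < v c ∧ v c ≤ v a ∧ th v x L i = v c := by
    rintro k hk t ht ⟨i, hi, j, hj, hji, htj⟩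
    have hjk := h.disj j hj k (mem_sdiff.1 hk).1 t htj ht
    subst hjk
    have hi' := hi
    obtain ⟨⟨hiK, a, b, c, d, hL, f1, f2, f3, f4, f5⟩, -⟩ := hi'
    exact ⟨i, a, b, c, d, hi, hL, h.rem_later (mem_sdiff.1 hiK).1 (by simp [hL]) hji,
      h.rem_later (mem_sdiff.1 hiK).1 (by simp [hL]) hji, by linarith, f4, by linarith, by simp [th, hL]⟩
  have t3 : ∑ k ∈ K \ R with v (tp L x k) ≤ (1 - v x) / 3, dl L (ws v x 17 24 (hi2 v x L K R) (lo2 v x L K R)) k ≤ 4 := by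
    refine ffd_ST h hR hx1 hx2 (u := 17) (D1 := 1) (D2 := 3) (D3 := 3) e1 (by norm_num) (by norm_num) (by norm_num)
      (by norm_num) (by norm_num) w1 ?_ ?_ ?_ ?_
    · intro k hk a b c d l hL h1 h2 h3 h4 h5
      have g1 := w1 d
      have g2 := h0 l
      have g3 := wS0 a (by linarith)
      have g4 := wS0 b (by linarith)
      have g5 := wS0 c (by linarith)
      by_cases hd : (1 - v x) / 4 < v d
      · by_cases hlo : lo2 v x L K R d
        · obtain ⟨i, a', b', c', d', hF, hLi, r1, r2, u1, u2, u3, u4⟩ := lo_later k hk d (by simp [hL]) hlo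
          have hcc := h5 c' r2 (by linarith)
          have := wS a (by linarith) (Or.inr ⟨i, hF.1, by linarith⟩)
          have := wS b (by linarith) (Or.inr ⟨i, hF.1, by linarith⟩)
          have := wS c (by linarith) (Or.inr ⟨i, hF.1, by linarith⟩)
          simp only [dl, hL, List.map_cons, List.sum_cons]
          linarith
        · have := wT d hd hlo
          simp only [dl, hL, List.map_cons, List.sum_cons]
          linarith
      · cases l with
        | nil =>
          have hF : FB v x L K R k := ⟨hk, a, b, c, d, hL, h1, h2, h3, h4, not_lt.1 hd⟩
          have ht : th v x L k = v c := by simp [th, hL]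
          have := wS a (by linarith) (Or.inr ⟨k, hF, by linarith⟩)
          have := wS b (by linarith) (Or.inr ⟨k, hF, by linarith⟩)
          have := wS c (by linarith) (Or.inr ⟨k, hF, by linarith⟩)
          simp only [dl, hL, List.map_cons, List.sum_cons]
          linarith
        | cons e l =>
          have := w1 e
          have := h0 l
          simp only [dl, hL, List.map_cons, List.sum_cons]
          linarith
    · intro k hk a b c d l hL h1 h2 h3 h4 h5 h6 h7
      have nolo : ∀ t ∈ L k, ¬ lo2 v x L K R t := by
        intro t ht hlo
        obtain ⟨i, a', b', c', d', hF, hLi, r1, r2, u1, u2, u3, u4⟩ := lo_later k hk t ht hlo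
        have := h7 c' r2 (by linarith)
        linarith
      have := w1 d
      have := h0 l
      have := wT a (by linarith) (nolo a (by simp [hL]))
      have := wT b (by linarith) (nolo b (by simp [hL]))
      have := wT c (by linarith) (nolo c (by simp [hL]))
      simp only [dl, hL, List.map_cons, List.sum_cons]
      linarith
    · intro k hk a b c d l hL h1
      have := wS0 a (by linarith)
      have := w1 b
      have := w1 c
      have := w1 d
      have := h0 l
      simp only [dl, hL, List.map_cons, List.sum_cons]
      linarith
    · intro k hk a b c d l hL h1 h2 h3 h4 h5
      have nolo : ∀ t ∈ L k, ¬ lo2 v x L K R t := by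
        intro t ht hlo
        obtain ⟨i, a', b', c', d', hF, hLi, r1, r2, u1, u2, u3, u4⟩ := lo_later k hk t ht hlo
        have := h.tp_top (mem_sdiff.1 hk).1 r1
        rw [tp_eq hL] at this
        linarith
      have := w1 b
      have := w1 c
      have := w1 d
      have := h0 l
      have := wT a (by linarith) (nolo a (by simp [hL]))
      simp only [dl, hL, List.map_cons, List.sum_cons]
      refine ⟨by linarith, fun h6 => ?_⟩
      have := wT b (by linarith) (nolo b (by simp [hL]))
      have := wT c (by linarith) (nolo c (by simp [hL]))
      have := wT d (by linarith) (nolo d (by simp [hL]))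
      linarith
  linarith

lemma small_mid_case (r : RS v x M K L P R p q y z) (h : Pk v x M K L D P) (hR : Red M P)
    (hc : 11 * D.card ≤ 9 * K.card) (hx1 : 2 / 11 < v x) (hx2 : v x ≤ 1 / 5) : False := by
  by_cases h1 : ∀ k ∈ R, 1 / 3 < v (q k)
  · exact scenB r h hR hc hx1 hx2 h1
  push Not at h1
  by_cases h2 : ∃ i ∈ R, v (q i) ≤ (1 - v x) / 3
  · exact scenC r h hR hc hx1 hx2 h2
  push Not at h2
  by_cases hm : ∃ k ∈ K \ R, ∃ a b c, M3 v x L k a b c ∧ v c ≤ 1 / 4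
  · exact scenA1 r h hR hc hx1 hx2 h1 h2 hm
  · push Not at hm
    exact scenA2 r h hR hc hx1 hx2 h1 h2 hm
end

/-- if `MMS^{⌊9n/11⌋}(v, M) = 1` and `(M, A, v, 1)` is First Fit Valid,
then the allocation `A` contains all chores of `M`. -/
theorem ffv_allocates_all_chores
    (n : ℕ) (hn : 2 ≤ n) (M : Finset α)
    (v : α → ℚ) (hv : ∀ c ∈ M, 0 < v c)
    (hmms : IsMMS v M (9 * n / 11) 1)
    (A : Fin n → Finset α) (hffv : FirstFitValid M A v 1) :
    Finset.univ.biUnion A = M := by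
  have hMA : ∀ k, A k ⊆ M := hffv.1
  refine subset_antisymm (by simpa [Finset.biUnion_subset] using hMA) ?_
  intro x hxM
  by_contra hxA
  have hxA' : ∀ k, x ∉ A k := by
    intro k hk
    exact hxA (Finset.mem_biUnion.2 ⟨k, Finset.mem_univ k, hk⟩)
  obtain ⟨⟨Pt, hPt, hPc⟩, -⟩ := hmms
  obtain ⟨M', K, L, D, P', hpk, hK, hD⟩ := pk_of_ffv n M v hv _ Pt hPt hPc A hffv x hxM hxA'
  obtain ⟨M2, K2, D2, P2, h, hc, hR⟩ := Pk_reduce v x L _ M' K D P' rfl hpk (by rw [hK, hD]; omega)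
  by_cases h1 : v x ≤ 2 / 11
  · exact case_small h hc h1
  obtain ⟨R, p, q, y, z, r⟩ := exists_RS h hR
  by_cases h2 : v x ≤ 1 / 5
  · exact small_mid_case r h hR hc (not_le.1 h1) h2
  by_cases h3 : v x ≤ 1 / 4
  · exact mid_case r h hR hc (not_le.1 h2) h3
  · exact case_large h hR hc (not_le.1 h3)
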